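/- Let k ≥ 1 be an integer, let 0 < θ < (2k+1)/(4(k+1)), and let H = T^a with 1/2 + θ < a ≤ 1. Define N_{η_k}(σ, m, H) := #{ ρ'_k = β'_k + iγ'_k : η_k(ρ'_k) = 0, m > β'_k > σ > 1/2, T < γ'_k < T+H }, where 2 < m = o(H). Then, as T → ∞, N_{η_k}(σ, m, H) ≤ (H/(2π(σ − 1/2))) · ( log(4^k P_k(θ))/2 + (k−1)·log 2 + o(1) ), where P_k(θ) := k²θ/(3(2k−1)4^{k−1}) + 1/(4^k(2k+1)θ) + 1/4^k. -/

import Mathlib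

open Filter

/-- `h(s) = π^{-s/2} Γ(s/2)`. -/
noncomputable def hFun (s : ℂ) : ℂ := (Real.pi : ℂ) ^ (-s / 2) * Complex.Gamma (s / 2)

/-- `χ(s) = h(1-s)/h(s)`, the factor in the functional equation of `ζ`. -/
noncomputable def chiFun (s : ℂ) : ℂ := hFun (1 - s) / hFun s

/-- `ω(s) = χ'(s)/χ(s)`. -/
noncomputable def omegaFun (s : ℂ) : ℂ := deriv chiFun s / chiFun s

/-- `λ(s) = (ω'/ω)(s) − ω(s)/2`. -/
noncomputable def lambdaFun (s : ℂ) : ℂ := deriv omegaFun s / omegaFun s - omegaFun s / 2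

/-- The Matsumoto–Tanigawa functions: `η_1 = ζ − ζ'/ω` and `η_{k+1} = λ·η_k + η_k'`. -/
noncomputable def etaMT : ℕ → ℂ → ℂ
  | 0 => fun _ => 0
  | 1 => fun s => riemannZeta s - deriv riemannZeta s / omegaFun s
  | (n + 2) => fun s => lambdaFun s * etaMT (n + 1) s + deriv (etaMT (n + 1)) s

/-- `P_k(θ) = k²θ/(3(2k−1)4^{k−1}) + 1/(4^k(2k+1)θ) + 1/4^k` (here `4^{k-1}` is
interpreted as `4^k/4`). -/
noncomputable def Pmoll (k : ℕ) (θ : ℝ) : ℝ :=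
  (k : ℝ) ^ 2 * θ / (3 * (2 * (k : ℝ) - 1) * ((4 : ℝ) ^ k / 4))
    + 1 / ((4 : ℝ) ^ k * (2 * (k : ℝ) + 1) * θ) + 1 / (4 : ℝ) ^ k


namespace ZDE
open Filter Topology

lemma gammaSeq_norm_le {s : ℂ} (hs : 0 < s.re) {n : ℕ} (hn : n ≠ 0) :
    ‖Complex.GammaSeq s n‖ ≤ Real.Gamma s.re := by
  have hint := Real.GammaIntegral_convergent hs
  rw [Complex.GammaSeq_eq_approx_Gamma_integral hs hn, Real.Gamma_eq_integral hs,
    intervalIntegral.integral_of_le (Nat.cast_nonneg n)]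
  have hint2 : MeasureTheory.IntegrableOn (fun x : ℝ => Real.exp (-x) * x ^ (s.re - 1))
      (Set.Ioc 0 (n:ℝ)) := hint.mono_set Set.Ioc_subset_Ioi_self
  refine (MeasureTheory.norm_integral_le_of_norm_le hint2 ?_).trans ?_
  · refine (MeasureTheory.ae_restrict_iff' measurableSet_Ioc).mpr (Eventually.of_forall ?_)
    intro x hx
    rw [norm_mul, Complex.norm_cpow_eq_rpow_re_of_pos hx.1]
    have h0 : 0 ≤ 1 - x / n := by
      have : x / n ≤ 1 := div_le_one_of_le₀ hx.2 (Nat.cast_nonneg n)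
      linarith
    rw [Complex.norm_real, Real.norm_of_nonneg (pow_nonneg h0 n)]
    simp only [Complex.sub_re, Complex.one_re]
    gcongr
    · exact Real.rpow_nonneg hx.1.le _
    · exact Real.one_sub_div_pow_le_exp_neg hx.2
  · refine MeasureTheory.setIntegral_mono_set hint ?_ Set.Ioc_subset_Ioi_self.eventuallyLE
    refine (MeasureTheory.ae_restrict_iff' measurableSet_Ioi).mpr (Eventually.of_forall ?_)
    intro x hx
    have : (0:ℝ) < x := hx
    simp only [Pi.zero_apply]
    positivity

lemma ne_of_re_pos {s : ℂ} (hs : 0 < s.re) (j : ℕ) : s + j ≠ 0 := by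
  intro h
  have := congrArg Complex.re h
  simp at this
  have : (0:ℝ) ≤ j := Nat.cast_nonneg j
  linarith

lemma gammaSeq_diff {n : ℕ} (hn : n ≠ 0) :
    DifferentiableOn ℂ (fun s => Complex.GammaSeq s n) {s | 0 < s.re} := by
  intro s hs
  apply DifferentiableAt.differentiableWithinAt
  unfold Complex.GammaSeq
  have hn' : (n:ℂ) ≠ 0 := by exact_mod_cast hn
  refine DifferentiableAt.div ?_ ?_ ?_
  · exact ((differentiableAt_id).const_cpow (Or.inl hn')).mul_const _
  · fun_prop
  · exact Finset.prod_ne_zero_iff.mpr (fun j _ => ne_of_re_pos hs j)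

lemma gammaSeq_logDeriv {s : ℂ} (hs : 0 < s.re) {n : ℕ} (hn : n ≠ 0) :
    logDeriv (fun s => Complex.GammaSeq s n) s
      = Real.log n - ∑ j ∈ Finset.range (n + 1), 1 / (s + j) := by
  have hn' : (n:ℂ) ≠ 0 := by exact_mod_cast hn
  unfold Complex.GammaSeq
  rw [logDeriv_div (f := fun s : ℂ => (n : ℂ) ^ s * (n.factorial:ℂ))
    (g := fun s : ℂ => ∏ j ∈ Finset.range (n + 1), (s + j))]
  · congr 1
    · rw [logDeriv_mul_const]
      · rw [logDeriv_apply, Complex.ofReal_log (Nat.cast_nonneg n), Complex.ofReal_natCast]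
        have := (hasDerivAt_id s).const_cpow (c := (n:ℂ)) (Or.inl hn')
        simp only [id, mul_one] at this
        rw [this.deriv]
        have : (n:ℂ)^s ≠ 0 := by simp [hn']
        field_simp
      · exact_mod_cast n.factorial_ne_zero
    · rw [logDeriv_prod]
      · refine Finset.sum_congr rfl fun j _ => ?_
        rw [logDeriv_apply]
        simp
      · exact fun j _ => ne_of_re_pos hs j
      · intro j _; fun_prop
  · have : (n:ℂ)^s ≠ 0 := by simp [hn']
    exact mul_ne_zero this (by exact_mod_cast n.factorial_ne_zero)
  · exact Finset.prod_ne_zero_iff.mpr (fun j _ => ne_of_re_pos hs j)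
  · exact ((differentiableAt_id).const_cpow (Or.inl hn')).mul_const _
  · fun_prop

lemma not_neg_nat {s : ℂ} (hs : 0 < s.re) (m : ℕ) : s ≠ -m := by
  intro h; apply ne_of_re_pos hs m; rw [h]; ring

lemma digamma_lim {s : ℂ} (hs : 0 < s.re) :
    Tendsto (fun n : ℕ => (Real.log n : ℂ) - ∑ j ∈ Finset.range (n + 1), 1 / (s + j)) atTop
      (𝓝 (Complex.digamma s)) := by
  set r := s.re / 2 with hr
  have hr0 : 0 < r := by positivity
  have hU : IsOpen {s : ℂ | 0 < s.re} := isOpen_lt continuous_const Complex.continuous_re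
  have hsub : Metric.closedBall s r ⊆ {s : ℂ | 0 < s.re} := by
    intro w hw
    have h1 : |(w - s).re| ≤ r := (Complex.abs_re_le_norm _).trans (by simpa [dist_eq_norm] using hw)
    have := (abs_le.mp h1).1
    simp only [Complex.sub_re] at this
    simp only [Set.mem_setOf_eq]; linarith
  have hG : DifferentiableOn ℂ Complex.Gamma {s : ℂ | 0 < s.re} := fun w hw =>
    (Complex.differentiableAt_Gamma w (not_neg_nat hw)).differentiableWithinAt
  have hcirc : ∀ θ, circleMap s r θ ∈ {s : ℂ | 0 < s.re} := fun θ =>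
    hsub (circleMap_mem_closedBall s hr0.le θ)
  have key : Tendsto (fun n : ℕ => deriv (fun s => Complex.GammaSeq s n) s) atTop
      (𝓝 (deriv Complex.Gamma s)) := by
    rw [← Complex.cderiv_eq_deriv hU hG hr0 hsub]
    have : (fun n : ℕ => Complex.cderiv r (fun s => Complex.GammaSeq s n) s) =ᶠ[atTop]
        (fun n : ℕ => deriv (fun s => Complex.GammaSeq s n) s) := by
      filter_upwards [eventually_ne_atTop 0] with n hn
      exact Complex.cderiv_eq_deriv hU (gammaSeq_diff hn) hr0 hsub
    refine Tendsto.congr' this ?_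
    unfold Complex.cderiv circleIntegral
    refine Tendsto.const_smul ?_ _
    refine intervalIntegral.tendsto_integral_filter_of_dominated_convergence
      (fun θ => r * ((r^2)⁻¹ * Real.Gamma (circleMap s r θ).re)) ?_ ?_ ?_ ?_
    · filter_upwards [eventually_ne_atTop 0] with n hn
      apply Continuous.aestronglyMeasurable
      have h1 : Continuous (fun θ => Complex.GammaSeq (circleMap s r θ) n) :=
        (gammaSeq_diff hn).continuousOn.comp_continuous (continuous_circleMap s r) hcirc
      have h2 : Continuous (fun θ => ((circleMap s r θ - s) ^ 2)⁻¹) := by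
        refine Continuous.inv₀ (by fun_prop) ?_
        intro θ
        simp [hr0.ne']
      have h3 : Continuous (fun θ => deriv (circleMap s r) θ) := by
        simp only [deriv_circleMap]; fun_prop
      exact h3.smul (h2.smul h1)
    · filter_upwards [eventually_ne_atTop 0] with n hn
      refine Eventually.of_forall fun θ _ => ?_
      rw [norm_smul, norm_smul, deriv_circleMap]
      simp only [norm_mul, norm_circleMap_zero, Complex.norm_I, mul_one, norm_inv, norm_pow,
        circleMap_sub_center, abs_of_pos hr0]
      gcongr
      exact gammaSeq_norm_le (hcirc θ) hn
    · apply Continuous.intervalIntegrable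
      have : Continuous (fun θ => Real.Gamma (circleMap s r θ).re) := by
        rw [continuous_iff_continuousAt]
        intro θ
        have h0 : 0 < (circleMap s r θ).re := hcirc θ
        have h1 : ContinuousAt Real.Gamma (circleMap s r θ).re :=
          (Real.differentiableAt_Gamma (fun m => by
            have : (0:ℝ) ≤ m := Nat.cast_nonneg m
            linarith)).continuousAt
        exact ContinuousAt.comp (f := fun θ => (circleMap s r θ).re) h1 (by fun_prop)
      fun_prop
    · refine Eventually.of_forall fun θ _ => ?_
      exact ((Complex.GammaSeq_tendsto_Gamma _).const_smul _).const_smul _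
  have hne : Complex.Gamma s ≠ 0 := Complex.Gamma_ne_zero_of_re_pos hs
  have h2 := key.div (Complex.GammaSeq_tendsto_Gamma s) hne
  refine Tendsto.congr' ?_ h2
  filter_upwards [eventually_ne_atTop 0] with n hn
  rw [← gammaSeq_logDeriv hs hn, logDeriv_apply]
  rfl

end ZDE

namespace ZDE
open Filter Topology

lemma digamma_sum_bound {s : ℂ} (hs : 0 < s.re) {K : ℕ} (hK : 1 ≤ K) (hKs : (K:ℝ) ≤ s.im) {n : ℕ}
    (hn : K ≤ n) :
    ∑ j ∈ Finset.range (n + 1), (1 / (s + j)).re ≤ 3 / 2 + Real.log n - Real.log K := by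
  have hKp : (1:ℝ) ≤ K := by exact_mod_cast hK
  have hre : ∀ j : ℕ, (1 / (s + j)).re = (s.re + j) / ((s.re + j)^2 + s.im^2) := by
    intro j
    simp [Complex.normSq_apply, Complex.inv_re, sq]
  have h1 : ∀ j : ℕ, (1 / (s + j)).re ≤ 1 / (2 * K) := by
    intro j
    rw [hre, div_le_div_iff₀ (by positivity) (by positivity)]
    have : (0:ℝ) ≤ j := Nat.cast_nonneg j
    nlinarith [sq_nonneg (s.re + j - s.im), mul_le_mul_of_nonneg_left hKs (by linarith : 0 ≤ s.re + j)]
  have h2 : ∀ j : ℕ, 1 ≤ j → (1 / (s + j)).re ≤ 1 / j := by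
    intro j hj
    have : (1:ℝ) ≤ j := by exact_mod_cast hj
    rw [hre, div_le_div_iff₀ (by positivity) (by positivity)]
    nlinarith [sq_nonneg s.im, mul_pos hs (by linarith : (0:ℝ) < j), sq_nonneg s.re]
  induction n, hn using Nat.le_induction with
  | base =>
    rw [Finset.sum_range_succ]
    have : ∑ j ∈ Finset.range K, (1 / (s + j)).re ≤ ∑ j ∈ Finset.range K, 1 / (2 * (K:ℝ)) :=
      Finset.sum_le_sum fun j _ => h1 j
    rw [Finset.sum_const, Finset.card_range, nsmul_eq_mul] at this
    have h3 : (K:ℝ) * (1 / (2 * K)) = 1 / 2 := by field_simp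
    have h4 := h2 K hK
    have h5 : 1 / (K:ℝ) ≤ 1 := by rw [div_le_one (by linarith)]; exact hKp
    linarith
  | succ n hn ih =>
    rw [Finset.sum_range_succ]
    have h4 := h2 (n + 1) (by omega)
    have hnp : (1:ℝ) ≤ n := hKp.trans (by exact_mod_cast hn)
    have h5 := Real.one_sub_inv_le_log_of_pos (x := ((n:ℝ) + 1) / n) (by positivity)
    rw [Real.log_div (by positivity) (by positivity)] at h5
    have h6 : 1 - (((n:ℝ) + 1) / n)⁻¹ = 1 / (n + 1) := by field_simp; ring
    push_cast at h4 ⊢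
    linarith

lemma digamma_re_ge {s : ℂ} (hs : 0 < s.re) {K : ℕ} (hK : 1 ≤ K) (hKs : (K:ℝ) ≤ s.im) :
    Real.log K - 3 / 2 ≤ (Complex.digamma s).re := by
  have h := (Complex.continuous_re.tendsto _).comp (digamma_lim hs)
  refine ge_of_tendsto h ?_
  filter_upwards [eventually_ge_atTop K] with n hn
  have := digamma_sum_bound hs hK hKs hn
  simp only [Function.comp_apply, Complex.sub_re, Complex.ofReal_re, Complex.re_sum]
  linarith

lemma norm_exp_I_mul (z : ℂ) : ‖Complex.exp (z * Complex.I)‖ = Real.exp (-z.im) := by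
  rw [Complex.norm_exp]; simp

lemma norm_exp_neg_I_mul (z : ℂ) : ‖Complex.exp (-z * Complex.I)‖ = Real.exp (z.im) := by
  rw [Complex.norm_exp]; simp

lemma norm_cos_ge (z : ℂ) : (Real.exp z.im - Real.exp (-z.im)) / 2 ≤ ‖Complex.cos z‖ := by
  rw [Complex.cos, norm_div, Complex.norm_ofNat]
  have := norm_sub_norm_le (Complex.exp (-z * Complex.I)) (-Complex.exp (z * Complex.I))
  rw [norm_neg, norm_exp_neg_I_mul, norm_exp_I_mul, sub_neg_eq_add, add_comm] at this
  linarith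

lemma norm_cos_le (z : ℂ) : ‖Complex.cos z‖ ≤ (Real.exp z.im + Real.exp (-z.im)) / 2 := by
  rw [Complex.cos, norm_div, Complex.norm_ofNat]
  have := norm_add_le (Complex.exp (z * Complex.I)) (Complex.exp (-z * Complex.I))
  rw [norm_exp_I_mul, norm_exp_neg_I_mul] at this
  linarith

lemma norm_sin_le (z : ℂ) : ‖Complex.sin z‖ ≤ (Real.exp z.im + Real.exp (-z.im)) / 2 := by
  rw [Complex.sin, norm_div, norm_mul, Complex.norm_I, mul_one, Complex.norm_ofNat]
  have := norm_sub_le (Complex.exp (-z * Complex.I)) (Complex.exp (z * Complex.I))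
  rw [norm_exp_neg_I_mul, norm_exp_I_mul] at this
  linarith

lemma cos_ne {z : ℂ} (hz : 0 < z.im) : Complex.cos z ≠ 0 := by
  have h := norm_cos_ge z
  have : Real.exp (-z.im) < Real.exp z.im := Real.exp_lt_exp.mpr (by linarith)
  intro h0
  rw [h0, norm_zero] at h
  linarith

lemma norm_tan_le {z : ℂ} (hz : 1 ≤ z.im) : ‖Complex.tan z‖ ≤ 2 := by
  rw [Complex.tan, norm_div, div_le_iff₀ (norm_pos_iff.mpr (cos_ne (by linarith)))]
  have h1 := norm_sin_le z
  have h2 := norm_cos_ge z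
  have h3 : 2 ≤ Real.exp z.im := by
    have := Real.add_one_le_exp z.im; linarith
  have h4 : Real.exp (-z.im) * Real.exp z.im = 1 := by rw [← Real.exp_add]; simp
  have h5 : Real.exp (-z.im) ≤ 1/2 := by
    have := Real.exp_pos (-z.im)
    nlinarith
  nlinarith

lemma im_ne_nat {s : ℂ} (hs : 0 < s.im) (m : ℂ) (hm : m.im = 0) : s ≠ m := by
  rintro rfl; linarith

lemma chi_eq {s : ℂ} (hs : 0 < s.im) :
    chiFun s = (2 * (2 * Real.pi : ℂ) ^ (-s) * Complex.Gamma s * Complex.cos (Real.pi * s / 2))⁻¹ := by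
  have h := Complex.Gammaℝ_div_Gammaℝ_one_sub (s := s) (fun n => im_ne_nat hs _ (by simp))
  rw [← Complex.Gammaℂ_def, ← h, inv_div]
  rfl

lemma pis_im (s : ℂ) : ((Real.pi : ℂ) * s / 2).im = Real.pi * s.im / 2 := by
  rw [Complex.div_ofNat_im]; simp

lemma pis_im_pos {s : ℂ} (hs : 0 < s.im) : 0 < ((Real.pi : ℂ) * s / 2).im := by
  rw [pis_im]; positivity

lemma Gamma_ne {s : ℂ} (hs : 0 < s.im) : Complex.Gamma s ≠ 0 :=
  Complex.Gamma_ne_zero fun m => im_ne_nat hs _ (by simp)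

lemma Gamma_diff {s : ℂ} (hs : 0 < s.im) : DifferentiableAt ℂ Complex.Gamma s :=
  Complex.differentiableAt_Gamma s fun m => im_ne_nat hs _ (by simp)

lemma two_pi_ne : (2 * Real.pi : ℂ) ≠ 0 := by
  simp [Real.pi_ne_zero]

lemma isOpen_im : IsOpen {s : ℂ | 0 < s.im} := isOpen_lt continuous_const Complex.continuous_im

lemma X_ne {s : ℂ} (hs : 0 < s.im) :
    2 * (2 * Real.pi : ℂ) ^ (-s) * Complex.Gamma s * Complex.cos (Real.pi * s / 2) ≠ 0 := by
  have h1 := Gamma_ne hs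
  have h2 := cos_ne (pis_im_pos hs)
  have h3 : (2 * Real.pi : ℂ) ^ (-s) ≠ 0 := by simp [Real.pi_ne_zero]
  exact mul_ne_zero (mul_ne_zero (mul_ne_zero two_ne_zero h3) h1) h2

lemma pow_diff (s : ℂ) : DifferentiableAt ℂ (fun s => 2 * (2 * Real.pi : ℂ) ^ (-s)) s :=
  ((differentiableAt_id.neg).const_cpow (Or.inl two_pi_ne)).const_mul _

lemma X_diff {s : ℂ} (hs : 0 < s.im) : DifferentiableAt ℂ (fun s =>
    2 * (2 * Real.pi : ℂ) ^ (-s) * Complex.Gamma s * Complex.cos (Real.pi * s / 2)) s :=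
  ((pow_diff s).mul (Gamma_diff hs)).mul (by fun_prop)

lemma chi_ne {s : ℂ} (hs : 0 < s.im) : chiFun s ≠ 0 := by
  rw [chi_eq hs]; exact inv_ne_zero (X_ne hs)

lemma chi_eventuallyEq {s : ℂ} (hs : 0 < s.im) : chiFun =ᶠ[𝓝 s] fun s =>
    (2 * (2 * Real.pi : ℂ) ^ (-s) * Complex.Gamma s * Complex.cos (Real.pi * s / 2))⁻¹ := by
  filter_upwards [isOpen_im.mem_nhds hs] with w hw
  exact chi_eq hw

lemma chi_diff {s : ℂ} (hs : 0 < s.im) : DifferentiableAt ℂ chiFun s :=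
  ((X_diff hs).inv (X_ne hs)).congr_of_eventuallyEq (chi_eventuallyEq hs)

lemma omega_diff {s : ℂ} (hs : 0 < s.im) : DifferentiableAt ℂ omegaFun s := by
  have h : DifferentiableOn ℂ chiFun {s : ℂ | 0 < s.im} := fun w hw =>
    (chi_diff hw).differentiableWithinAt
  have h2 := (h.deriv isOpen_im).differentiableAt (isOpen_im.mem_nhds hs)
  exact h2.div (chi_diff hs) (chi_ne hs)

lemma logDeriv_inv_fun {f : ℂ → ℂ} {s : ℂ} (hf : DifferentiableAt ℂ f s) (h0 : f s ≠ 0) :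
    logDeriv (fun s => (f s)⁻¹) s = - logDeriv f s := by
  rw [logDeriv_apply, logDeriv_apply, (hf.hasDerivAt.fun_inv h0).deriv]
  field_simp

lemma omega_eq {s : ℂ} (hs : 0 < s.im) :
    omegaFun s = Real.log (2 * Real.pi) + Real.pi / 2 * Complex.tan (Real.pi * s / 2)
      - Complex.digamma s := by
  have h0 : omegaFun s = logDeriv chiFun s := rfl
  have hcos := cos_ne (pis_im_pos hs)
  have h3 : (2 * Real.pi : ℂ) ^ (-s) ≠ 0 := by simp [Real.pi_ne_zero]
  have h1 : logDeriv chiFun s = logDeriv (fun s =>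
    (2 * (2 * Real.pi : ℂ) ^ (-s) * Complex.Gamma s * Complex.cos (Real.pi * s / 2))⁻¹) s := by
    rw [logDeriv_apply, logDeriv_apply, (chi_eventuallyEq hs).deriv_eq, (chi_eventuallyEq hs).eq_of_nhds]
  rw [h0, h1, logDeriv_inv_fun (X_diff hs) (X_ne hs), 
    logDeriv_mul (f := fun s => 2 * (2 * Real.pi : ℂ) ^ (-s) * Complex.Gamma s)
      (g := fun s => Complex.cos (Real.pi * s / 2)) s
      (mul_ne_zero (mul_ne_zero two_ne_zero h3) (Gamma_ne hs))
      hcos ((pow_diff s).mul (Gamma_diff hs)) (by fun_prop),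
    logDeriv_mul (f := fun s => 2 * (2 * Real.pi : ℂ) ^ (-s)) (g := Complex.Gamma) s
      (mul_ne_zero two_ne_zero h3) (Gamma_ne hs) (pow_diff s) (Gamma_diff hs),
    logDeriv_const_mul _ _ two_ne_zero]
  have e1 : logDeriv (fun s => (2 * Real.pi : ℂ) ^ (-s)) s = - Real.log (2 * Real.pi) := by
    rw [logDeriv_apply]
    have := (hasDerivAt_id s).neg.const_cpow (c := (2 * Real.pi:ℂ)) (Or.inl two_pi_ne)
    have e : deriv (fun s => (2 * Real.pi : ℂ) ^ (-s)) s = (2 * Real.pi : ℂ) ^ (-s) * Complex.log (2 * Real.pi) * -1 :=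
      this.deriv
    rw [e, Complex.ofReal_log (by positivity)]
    push_cast
    field_simp
  have e2 : logDeriv (fun s : ℂ => Complex.cos (Real.pi * s / 2)) s
      = - (Real.pi / 2 * Complex.tan (Real.pi * s / 2)) := by
    rw [logDeriv_apply]
    have h := (((hasDerivAt_id s).const_mul (Real.pi : ℂ)).div_const 2).ccos
    have e : deriv (fun s : ℂ => Complex.cos (Real.pi * s / 2)) s = _ := h.deriv
    rw [e, Complex.tan]
    simp only [id]
    ring
  rw [e1, e2, Complex.digamma_def]
  ring

lemma omega_large (B : ℝ) : ∃ τ : ℝ, 1 ≤ τ ∧ ∀ s : ℂ, 0 < s.re → τ ≤ s.im → B ≤ ‖omegaFun s‖ := by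
  have h : Tendsto (fun K : ℕ => Real.log K) atTop atTop :=
    Real.tendsto_log_atTop.comp tendsto_natCast_atTop_atTop
  obtain ⟨K, hK, hK1⟩ := ((h.eventually_ge_atTop
    (B + 3 / 2 + Real.log (2 * Real.pi) + Real.pi)).and (eventually_ge_atTop 1)).exists
  refine ⟨K, by exact_mod_cast hK1, fun s hs hKs => ?_⟩
  have hK1' : (1:ℝ) ≤ K := by exact_mod_cast hK1
  have him : 1 ≤ s.im := hK1'.trans hKs
  have h1 := digamma_re_ge hs hK1 hKs
  have h2 : ‖(Real.pi / 2 : ℂ) * Complex.tan (Real.pi * s / 2)‖ ≤ Real.pi := by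
    have : 1 ≤ ((Real.pi : ℂ) * s / 2).im := by
      rw [pis_im]; nlinarith [Real.pi_gt_three]
    rw [norm_mul, norm_div, Complex.norm_real, Complex.norm_ofNat, Real.norm_of_nonneg Real.pi_pos.le]
    nlinarith [norm_tan_le this, Real.pi_pos]
  have h3 := (abs_le.mp ((Complex.abs_re_le_norm _).trans h2)).2
  have h4 := (abs_le.mp (Complex.abs_re_le_norm (omegaFun s))).1
  rw [omega_eq (by linarith : 0 < s.im)] at h4 ⊢
  simp only [Complex.sub_re, Complex.add_re, Complex.ofReal_re] at h4
  linarith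

end ZDE

namespace ZDE
open Filter Topology

/-- vector of values at shifted points -/
noncomputable def vec {J : ℕ} (p : Fin J → ℂ) (f : ℂ → ℂ) (z : ℂ) : EuclideanSpace ℂ (Fin J) :=
  WithLp.toLp 2 (fun j => f (z + p j))

/-- unnormalised root mean square -/
noncomputable def nrm {J : ℕ} (p : Fin J → ℂ) (f : ℂ → ℂ) (z : ℂ) : ℝ := ‖vec p f z‖

variable {J : ℕ} {p : Fin J → ℂ} {f g : ℂ → ℂ} {z : ℂ}

lemma nrm_nonneg (p : Fin J → ℂ) (f : ℂ → ℂ) (z : ℂ) : 0 ≤ nrm p f z := norm_nonneg _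

lemma nrm_sq (p : Fin J → ℂ) (f : ℂ → ℂ) (z : ℂ) : nrm p f z ^ 2 = ∑ j, ‖f (z + p j)‖ ^ 2 := by
  unfold nrm vec
  rw [EuclideanSpace.norm_sq_eq]

lemma nrm_add_le (p : Fin J → ℂ) (f g : ℂ → ℂ) (z : ℂ) :
    nrm p (fun s => f s + g s) z ≤ nrm p f z + nrm p g z := by
  have : vec p (fun s => f s + g s) z = vec p f z + vec p g z := by
    ext j; simp [vec]
  unfold nrm
  rw [this]; exact norm_add_le _ _

lemma nrm_le_mul {δ : ℝ} (hδ : 0 ≤ δ) (h : ∀ j, ‖f (z + p j)‖ ≤ δ * ‖g (z + p j)‖) :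
    nrm p f z ≤ δ * nrm p g z := by
  refine le_of_sq_le_sq ?_ (mul_nonneg hδ (nrm_nonneg _ _ _))
  rw [mul_pow, nrm_sq, nrm_sq, Finset.mul_sum]
  refine Finset.sum_le_sum fun j _ => ?_
  rw [← mul_pow]
  exact pow_le_pow_left₀ (norm_nonneg _) (h j) 2

lemma nrm_mono (h : ∀ j, ‖f (z + p j)‖ ≤ ‖g (z + p j)‖) : nrm p f z ≤ nrm p g z := by
  simpa using nrm_le_mul (δ := 1) zero_le_one (by simpa using h)

lemma nrm_congr (h : ∀ j, f (z + p j) = g (z + p j)) : nrm p f z = nrm p g z :=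
  le_antisymm (nrm_mono fun j => by rw [h]) (nrm_mono fun j => by rw [h])

lemma nrm_le_const {δ : ℝ} (hδ : 0 ≤ δ) (h : ∀ j, ‖f (z + p j)‖ ≤ δ) :
    nrm p f z ≤ δ * √J := by
  refine le_of_sq_le_sq ?_ (mul_nonneg hδ (Real.sqrt_nonneg _))
  rw [mul_pow, nrm_sq, Real.sq_sqrt (Nat.cast_nonneg J)]
  calc ∑ j, ‖f (z + p j)‖ ^ 2 ≤ ∑ j : Fin J, δ ^ 2 :=
        Finset.sum_le_sum fun j _ => pow_le_pow_left₀ (norm_nonneg _) (h j) 2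
    _ = δ ^ 2 * J := by simp [mul_comm]

lemma sum_le_nrm (p : Fin J → ℂ) (f : ℂ → ℂ) (z : ℂ) :
    ∑ j, ‖f (z + p j)‖ ≤ √J * nrm p f z := by
  refine le_of_sq_le_sq ?_ (mul_nonneg (Real.sqrt_nonneg _) (nrm_nonneg _ _ _))
  rw [mul_pow, nrm_sq, Real.sq_sqrt (Nat.cast_nonneg J)]
  have := sq_sum_le_card_mul_sum_sq (s := (Finset.univ : Finset (Fin J)))
    (f := fun j => ‖f (z + p j)‖)
  simpa using this

lemma vec_hasDerivAt (h : ∀ j, DifferentiableAt ℂ f (z + p j)) :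
    HasDerivAt (vec p f) (vec p (deriv f) z) z := by
  rw [hasDerivAt_iff_hasFDerivAt]
  have h1 : HasFDerivAt (vec p f) (ContinuousLinearMap.toSpanSingleton ℂ (vec p (deriv f) z)) z := by
    rw [← hasFDerivWithinAt_univ, hasFDerivWithinAt_euclidean]
    intro j
    rw [hasFDerivWithinAt_univ]
    have h2 := (h j).hasDerivAt.comp_add_const z (p j)
    rw [hasDerivAt_iff_hasFDerivAt] at h2
    refine h2.congr_fderiv ?_
    ext
    simp [vec]
  exact h1

lemma vec_diff (h : ∀ j, DifferentiableAt ℂ f (z + p j)) : DifferentiableAt ℂ (vec p f) z :=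
  (vec_hasDerivAt h).differentiableAt

lemma nrm_deriv_le {r C : ℝ} (hr : 0 < r)
    (hd : ∀ w ∈ Metric.closedBall z r, ∀ j, DifferentiableAt ℂ f (w + p j))
    (hC : ∀ w ∈ Metric.closedBall z r, nrm p f w ≤ C) : nrm p (deriv f) z ≤ C / r := by
  have h1 : DifferentiableOn ℂ (vec p f) (Metric.closedBall z r) := fun w hw =>
    (vec_diff (hd w hw)).differentiableWithinAt
  have h2 : DiffContOnCl ℂ (vec p f) (Metric.ball z r) :=
    (h1.mono Metric.closure_ball_subset_closedBall).diffContOnCl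
  have h3 := Complex.norm_deriv_le_of_forall_mem_sphere_norm_le hr h2
    (fun w hw => hC w (Metric.sphere_subset_closedBall hw))
  rw [(vec_hasDerivAt (hd z (Metric.mem_closedBall_self hr.le))).deriv] at h3
  exact h3

lemma ball_re {w z : ℂ} {r : ℝ} (h : w ∈ Metric.closedBall z r) : |w.re - z.re| ≤ r := by
  rw [← Complex.sub_re]
  exact (Complex.abs_re_le_norm _).trans (by simpa [dist_eq_norm] using h)

lemma ball_im {w z : ℂ} {r : ℝ} (h : w ∈ Metric.closedBall z r) : |w.im - z.im| ≤ r := by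
  rw [← Complex.sub_im]
  exact (Complex.abs_im_le_norm _).trans (by simpa [dist_eq_norm] using h)

lemma coef_omega {δ : ℝ} (hδ : 0 < δ) : ∃ τ : ℝ, 1 ≤ τ ∧ ∀ s : ℂ, 0 < s.re → τ ≤ s.im →
    omegaFun s ≠ 0 ∧ ‖(omegaFun s)⁻¹‖ ≤ δ := by
  obtain ⟨τ, h1, h2⟩ := omega_large δ⁻¹
  refine ⟨τ, h1, fun s hs ht => ?_⟩
  have h := h2 s hs ht
  have h0 : 0 < ‖omegaFun s‖ := (inv_pos.mpr hδ).trans_le h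
  refine ⟨norm_pos_iff.mp h0, ?_⟩
  rw [norm_inv]
  exact inv_le_of_inv_le₀ hδ h

lemma deriv_small {f : ℂ → ℂ} {z : ℂ} {r δ : ℝ} (hr : 0 < r)
    (hd : ∀ w ∈ Metric.closedBall z r, DifferentiableAt ℂ f w)
    (hC : ∀ w ∈ Metric.closedBall z r, ‖f w‖ ≤ δ) : ‖deriv f z‖ ≤ δ / r := by
  have h1 : DifferentiableOn ℂ f (Metric.closedBall z r) := fun w hw =>
    (hd w hw).differentiableWithinAt
  exact Complex.norm_deriv_le_of_forall_mem_sphere_norm_le hr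
    (h1.mono Metric.closure_ball_subset_closedBall).diffContOnCl
    (fun w hw => hC w (Metric.sphere_subset_closedBall hw))

lemma lambda_eq {s : ℂ} (hs : 0 < s.im) (h0 : omegaFun s ≠ 0) :
    lambdaFun s = - omegaFun s * (1 / 2 + deriv (fun s => (omegaFun s)⁻¹) s) := by
  rw [((omega_diff hs).hasDerivAt.fun_inv h0).deriv, lambdaFun]
  field_simp
  ring

lemma lambda_diff {s : ℂ} (hs : 0 < s.im) (h0 : omegaFun s ≠ 0) : DifferentiableAt ℂ lambdaFun s := by
  have h : DifferentiableOn ℂ omegaFun {s : ℂ | 0 < s.im} := fun w hw =>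
    (omega_diff hw).differentiableWithinAt
  have h2 := (h.deriv isOpen_im).differentiableAt (isOpen_im.mem_nhds hs)
  exact (h2.div (omega_diff hs) h0).sub ((omega_diff hs).div_const 2)

lemma coef_lambda {δ : ℝ} (hδ : 0 < δ) : ∃ τ : ℝ, 1 ≤ τ ∧ ∀ s : ℂ, 1 / 8 < s.re → τ ≤ s.im →
    omegaFun s ≠ 0 ∧ ‖(omegaFun s)⁻¹‖ ≤ δ ∧ lambdaFun s ≠ 0 ∧ ‖(lambdaFun s)⁻¹‖ ≤ δ := by
  obtain ⟨τ, h1, h2⟩ := coef_omega (δ := min (δ / 4) (1 / 32)) (by positivity)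
  refine ⟨τ + 1, by linarith, fun s hs ht => ?_⟩
  have hs0 := h2 s (by linarith) (by linarith)
  have hd : ‖deriv (fun s => (omegaFun s)⁻¹) s‖ ≤ 1 / 32 / (1 / 8) := by
    have hb : ∀ w ∈ Metric.closedBall s (1 / 8), 0 < w.re ∧ τ ≤ w.im := fun w hw => by
      have := abs_le.mp (ball_re hw); have := abs_le.mp (ball_im hw)
      constructor <;> linarith
    refine deriv_small (by norm_num) (fun w hw => ?_) (fun w hw => ?_)
    · obtain ⟨h3, h4⟩ := hb w hw
      exact (omega_diff (by linarith)).fun_inv (h2 w h3 h4).1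
    · obtain ⟨h3, h4⟩ := hb w hw
      exact (h2 w h3 h4).2.trans (min_le_right _ _)
  have hl : 1 / 4 ≤ ‖1 / 2 + deriv (fun s => (omegaFun s)⁻¹) s‖ := by
    have := norm_sub_le (1 / 2 + deriv (fun s => (omegaFun s)⁻¹) s) (deriv (fun s => (omegaFun s)⁻¹) s)
    rw [add_sub_cancel_right] at this
    have e : ‖(1 / 2 : ℂ)‖ = 1 / 2 := by simp
    rw [e] at this
    linarith
  have hω := norm_pos_iff.mpr hs0.1
  have hdiv : ‖omegaFun s‖⁻¹ ≤ δ / 4 := by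
    rw [← norm_inv]; exact hs0.2.trans (min_le_left _ _)
  have heq := lambda_eq (by linarith : 0 < s.im) hs0.1
  have hn : ‖lambdaFun s‖ = ‖omegaFun s‖ * ‖1 / 2 + deriv (fun s => (omegaFun s)⁻¹) s‖ := by
    rw [heq, norm_mul, norm_neg]
  refine ⟨hs0.1, (hs0.2.trans (min_le_left _ _)).trans (by linarith), ?_, ?_⟩
  · rw [← norm_pos_iff, hn]; positivity
  · rw [norm_inv, hn, mul_inv]
    have : ‖1 / 2 + deriv (fun s => (omegaFun s)⁻¹) s‖⁻¹ ≤ 4 := by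
      apply inv_le_of_inv_le₀ (by norm_num); linarith
    calc _ ≤ δ / 4 * 4 := by gcongr
      _ = δ := by ring

lemma coef_all {δ : ℝ} (hδ : 0 < δ) : ∃ τ : ℝ, 1 ≤ τ ∧ ∀ s : ℂ, 1 / 4 < s.re → τ ≤ s.im →
    omegaFun s ≠ 0 ∧ ‖(omegaFun s)⁻¹‖ ≤ δ ∧ lambdaFun s ≠ 0 ∧ ‖(lambdaFun s)⁻¹‖ ≤ δ ∧
    ‖deriv (fun s => (lambdaFun s)⁻¹) s‖ ≤ δ := by
  obtain ⟨τ, h1, h2⟩ := coef_lambda (δ := δ / 8) (by positivity)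
  refine ⟨τ + 1, by linarith, fun s hs ht => ?_⟩
  obtain ⟨a, b, c, d⟩ := h2 s (by linarith) (by linarith)
  refine ⟨a, by linarith, c, by linarith, ?_⟩
  have hb : ∀ w ∈ Metric.closedBall s (1 / 8), 1 / 8 < w.re ∧ τ ≤ w.im := fun w hw => by
    have := abs_le.mp (ball_re hw); have := abs_le.mp (ball_im hw)
    constructor <;> linarith
  have : δ = δ / 8 / (1 / 8) := by ring
  rw [this]
  refine deriv_small (by norm_num) (fun w hw => ?_) (fun w hw => ?_)
  · obtain ⟨h3, h4⟩ := hb w hw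
    obtain ⟨a, b, c, d⟩ := h2 w h3 h4
    exact (lambda_diff (by linarith) a).fun_inv c
  · obtain ⟨h3, h4⟩ := hb w hw
    exact (h2 w h3 h4).2.2.2

/-- threshold height -/
noncomputable def tau0 : ℝ := Classical.choose (coef_all one_pos)

lemma tau0_ge : 1 ≤ tau0 := (Classical.choose_spec (coef_all one_pos)).1

/-- good region -/
def Om : Set ℂ := {s | 1 / 4 < s.re ∧ tau0 < s.im}

lemma Om_open : IsOpen Om :=
  (isOpen_lt continuous_const Complex.continuous_re).inter
    (isOpen_lt continuous_const Complex.continuous_im)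

lemma Om_im {s : ℂ} (h : s ∈ Om) : 1 < s.im := tau0_ge.trans_lt h.2

lemma Om_omega {s : ℂ} (h : s ∈ Om) : omegaFun s ≠ 0 :=
  ((Classical.choose_spec (coef_all one_pos)).2 s h.1 h.2.le).1

lemma Om_lambda {s : ℂ} (h : s ∈ Om) : lambdaFun s ≠ 0 :=
  ((Classical.choose_spec (coef_all one_pos)).2 s h.1 h.2.le).2.2.1

lemma Om_lambda_diff {s : ℂ} (h : s ∈ Om) : DifferentiableAt ℂ lambdaFun s :=
  lambda_diff (by linarith [Om_im h]) (Om_omega h)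

lemma zeta_diff {s : ℂ} (h : 0 < s.im) : DifferentiableAt ℂ riemannZeta s :=
  differentiableAt_riemannZeta (im_ne_nat h 1 (by simp))

lemma zeta_deriv_diff {s : ℂ} (hs : 0 < s.im) : DifferentiableAt ℂ (deriv riemannZeta) s := by
  have h : DifferentiableOn ℂ riemannZeta {s : ℂ | 0 < s.im} := fun w hw =>
    (zeta_diff hw).differentiableWithinAt
  exact (h.deriv isOpen_im).differentiableAt (isOpen_im.mem_nhds hs)

lemma eta_diffOn (k : ℕ) : DifferentiableOn ℂ (etaMT (k + 1)) Om := by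
  induction k with
  | zero =>
    intro s hs
    have h := Om_im hs
    exact ((zeta_diff (by linarith)).sub ((zeta_deriv_diff (by linarith)).div
      (omega_diff (by linarith)) (Om_omega hs))).differentiableWithinAt
  | succ k ih =>
    intro s hs
    have h1 := (ih.deriv Om_open).differentiableAt (Om_open.mem_nhds hs)
    have h2 := ih.differentiableAt (Om_open.mem_nhds hs)
    exact (((Om_lambda_diff hs).mul h2).add h1).differentiableWithinAt

/-- normalised eta -/
noncomputable def etaN (k : ℕ) (s : ℂ) : ℂ := etaMT (k + 1) s * (lambdaFun s)⁻¹ ^ k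

lemma etaN_diff (k : ℕ) {s : ℂ} (hs : s ∈ Om) : DifferentiableAt ℂ (etaN k) s :=
  ((eta_diffOn k).differentiableAt (Om_open.mem_nhds hs)).mul
    (((Om_lambda_diff hs).inv (Om_lambda hs)).pow k)

lemma etaN_zero (s : ℂ) : etaN 0 s - riemannZeta s = - (omegaFun s)⁻¹ * deriv riemannZeta s := by
  simp [etaN, etaMT]; ring

lemma etaN_succ (k : ℕ) {s : ℂ} (hs : s ∈ Om) :
    etaN (k + 1) s = etaN k s - k * deriv (fun s => (lambdaFun s)⁻¹) s * etaN k s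
      + (lambdaFun s)⁻¹ * deriv (etaN k) s := by
  have h0 := Om_lambda hs
  have e1 := ((eta_diffOn k).differentiableAt (Om_open.mem_nhds hs)).hasDerivAt
  have e2 := ((Om_lambda_diff hs).fun_inv h0).hasDerivAt
  have e3 : deriv (etaN k) s = _ := (e1.mul (e2.fun_pow k)).deriv
  rw [e3]
  have e4 : etaN (k + 1) s = (lambdaFun s * etaMT (k + 1) s + deriv (etaMT (k + 1)) s)
    * (lambdaFun s)⁻¹ ^ (k + 1) := rfl
  rw [e4]
  unfold etaN
  set m := (lambdaFun s)⁻¹ with hm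
  have hl : lambdaFun s = m⁻¹ := by rw [hm, inv_inv]
  have hm0 : m ≠ 0 := inv_ne_zero h0
  rw [hl]
  rcases k with _ | k
  · simp; field_simp
  · simp only [Nat.add_sub_cancel]
    field_simp
    ring

lemma step_zero {r δ A : ℝ} (hr : 0 < r) (hδ : 0 ≤ δ)
    (hOm : ∀ w ∈ Metric.closedBall z r, ∀ j, w + p j ∈ Om)
    (h1 : ∀ j, ‖(omegaFun (z + p j))⁻¹‖ ≤ δ)
    (hA : ∀ w ∈ Metric.closedBall z r, nrm p riemannZeta w ≤ A) :
    nrm p (fun s => etaN 0 s - riemannZeta s) z ≤ δ * (A / r) := by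
  have h2 : nrm p (deriv riemannZeta) z ≤ A / r :=
    nrm_deriv_le hr (fun w hw j => zeta_diff (by linarith [Om_im (hOm w hw j)])) hA
  refine (nrm_le_mul (g := deriv riemannZeta) hδ fun j => ?_).trans
    (mul_le_mul_of_nonneg_left h2 hδ)
  rw [etaN_zero, norm_mul, norm_neg]
  exact mul_le_mul_of_nonneg_right (h1 j) (norm_nonneg _)

lemma step_succ (k : ℕ) {r δ A ε : ℝ} (hr : 0 < r) (hδ : 0 ≤ δ)
    (hOm : ∀ w ∈ Metric.closedBall z r, ∀ j, w + p j ∈ Om)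
    (h1 : ∀ j, ‖(lambdaFun (z + p j))⁻¹‖ ≤ δ)
    (h2 : ∀ j, ‖deriv (fun s => (lambdaFun s)⁻¹) (z + p j)‖ ≤ δ)
    (hA : ∀ w ∈ Metric.closedBall z r, nrm p riemannZeta w ≤ A)
    (hε : ∀ w ∈ Metric.closedBall z r, nrm p (fun s => etaN k s - riemannZeta s) w ≤ ε) :
    nrm p (fun s => etaN (k + 1) s - riemannZeta s) z
      ≤ ε + k * δ * (ε + A) + δ * ((ε + A) / r) := by
  have hz := Metric.mem_closedBall_self (x := z) hr.le
  have hN : ∀ w ∈ Metric.closedBall z r, nrm p (etaN k) w ≤ ε + A := by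
    intro w hw
    refine le_trans ?_ ((nrm_add_le p (fun s => etaN k s - riemannZeta s) riemannZeta w).trans
      (add_le_add (hε w hw) (hA w hw)))
    exact nrm_mono fun j => by simp
  have h3 : nrm p (deriv (etaN k)) z ≤ (ε + A) / r :=
    nrm_deriv_le hr (fun w hw j => etaN_diff k (hOm w hw j)) hN
  have e : nrm p (fun s => etaN (k + 1) s - riemannZeta s) z =
      nrm p (fun s => ((etaN k s - riemannZeta s)
        + (-(k * deriv (fun s => (lambdaFun s)⁻¹) s * etaN k s)))
        + (lambdaFun s)⁻¹ * deriv (etaN k) s) z := by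
    refine nrm_congr fun j => ?_
    simp only [etaN_succ k (hOm z hz j)]
    ring
  rw [e]
  refine (nrm_add_le _ _ _ _).trans (add_le_add ((nrm_add_le _ _ _ _).trans
    (add_le_add (hε z hz) ?_)) ?_)
  · refine (nrm_le_mul (g := etaN k) (by positivity : 0 ≤ k * δ) fun j => ?_).trans
      (mul_le_mul_of_nonneg_left (hN z hz) (by positivity))
    rw [norm_neg, norm_mul, norm_mul, Complex.norm_natCast]
    gcongr
    exact h2 j
  · refine (nrm_le_mul (g := deriv (etaN k)) hδ fun j => ?_).trans
      (mul_le_mul_of_nonneg_left h3 hδ)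
    rw [norm_mul]
    gcongr
    exact h1 j

/-- Abstract induction. -/
lemma etaN_approx {ι : Type*} {l : Filter ι} (Jn : ι → ℕ) (q : ∀ i, Fin (Jn i) → ℂ)
    (Z : ι → ℕ → Set ℂ) (τ : ι → ℝ) (hτ : Tendsto τ l atTop) (S : ι → ℝ) (hS : ∀ i, 0 < S i)
    {r A : ℝ} (hr : 0 < r) (hA0 : 0 ≤ A)
    (hZ : ∀ i n, ∀ z ∈ Z i (n + 1), ∀ w ∈ Metric.closedBall z r, w ∈ Z i n)
    (hZ0 : ∀ᶠ i in l, ∀ n, ∀ z ∈ Z i n, ∀ j, 1 / 4 < (z + q i j).re ∧ τ i ≤ (z + q i j).im)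
    (hA : ∀ᶠ i in l, ∀ n, ∀ z ∈ Z i n, nrm (q i) riemannZeta z ≤ A * S i) (k : ℕ) :
    ∀ ε > 0, ∀ᶠ i in l, ∀ z ∈ Z i (k + 1),
      nrm (q i) (fun s => etaN k s - riemannZeta s) z ≤ ε * S i := by
  have hOm : ∀ᶠ i in l, ∀ n, ∀ z ∈ Z i n, ∀ j, z + q i j ∈ Om := by
    filter_upwards [hZ0, hτ.eventually_gt_atTop tau0] with i h1 h2 n z hz j
    exact ⟨(h1 n z hz j).1, h2.trans_le (h1 n z hz j).2⟩
  induction k with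
  | zero =>
    intro ε hε
    obtain ⟨τ', -, h'⟩ := coef_all (δ := ε * r / (A + 1)) (by positivity)
    filter_upwards [hZ0, hOm, hτ.eventually_ge_atTop τ', hA] with i h1 h2 h3 h4 z hz
    refine (step_zero hr (by positivity) (fun w hw j => h2 0 w (hZ i 0 z hz w hw) j)
      (fun j => (h' _ (h1 _ z hz j).1 (h3.trans (h1 _ z hz j).2)).2.1)
      (fun w hw => h4 0 w (hZ i 0 z hz w hw))).trans ?_
    have := hS i
    rw [show ε * r / (A + 1) * (A * S i / r) = ε * S i * (A / (A + 1)) by field_simp]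
    have : A / (A + 1) ≤ 1 := by rw [div_le_one (by positivity)]; linarith
    have h5 : 0 ≤ ε * S i := by positivity
    nlinarith
  | succ k ih =>
    intro ε hε
    set ε' := min (ε / 2) 1 with hε'
    have hε'0 : 0 < ε' := by positivity
    set δ := ε / 2 / (k * (1 + A) + (1 + A) / r) with hδ
    have hden : 0 < k * (1 + A) + (1 + A) / r := by positivity
    have hδ0 : 0 < δ := by positivity
    obtain ⟨τ', -, h'⟩ := coef_all hδ0
    filter_upwards [hZ0, hOm, hτ.eventually_ge_atTop τ', hA, ih ε' hε'0] with i h1 h2 h3 h4 h5 z hz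
    have h6 := fun j => h' _ (h1 _ z hz j).1 (h3.trans (h1 _ z hz j).2)
    refine (step_succ k hr hδ0.le (fun w hw j => h2 _ w (hZ i _ z hz w hw) j)
      (fun j => (h6 j).2.2.2.1) (fun j => (h6 j).2.2.2.2)
      (fun w hw => h4 _ w (hZ i _ z hz w hw)) (fun w hw => h5 w (hZ i _ z hz w hw))).trans ?_
    have hSi := hS i
    have e1 : ε' ≤ ε / 2 := min_le_left _ _
    have e2 : ε' ≤ 1 := min_le_right _ _
    calc ε' * S i + k * δ * (ε' * S i + A * S i) + δ * ((ε' * S i + A * S i) / r)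
        = (ε' + δ * (k * (ε' + A) + (ε' + A) / r)) * S i := by ring
      _ ≤ (ε / 2 + δ * (k * (1 + A) + (1 + A) / r)) * S i := by gcongr
      _ = ε * S i := by rw [hδ, div_mul_cancel₀ _ hden.ne']; ring

end ZDE

namespace ZDE
open Filter Topology

lemma geom_bound {x : ℝ} (hx0 : x ≠ 0) (hx : |x| ≤ 1 / 2) (J : ℕ) :
    ‖∑ j ∈ Finset.range J, (Complex.exp (x * Complex.I)) ^ j‖ ≤ 4 / |x| := by
  have hn : ‖(x : ℂ) * Complex.I‖ = |x| := by simp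
  have h1 := Complex.norm_exp_sub_one_sub_id_le (x := (x : ℂ) * Complex.I) (by rw [hn]; linarith)
  rw [hn] at h1
  have hxp : 0 < |x| := abs_pos.mpr hx0
  have h2 : |x| / 2 ≤ ‖Complex.exp (x * Complex.I) - 1‖ := by
    have := norm_sub_norm_le ((x : ℂ) * Complex.I) (-(Complex.exp (x * Complex.I) - 1 - x * Complex.I))
    rw [norm_neg, hn] at this
    have e : (x : ℂ) * Complex.I - -(Complex.exp (x * Complex.I) - 1 - x * Complex.I)
      = Complex.exp (x * Complex.I) - 1 := by ring
    rw [e] at this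
    nlinarith
  have h3 : Complex.exp (x * Complex.I) ≠ 1 := by
    intro h; rw [h] at h2; simp at h2; linarith
  rw [geom_sum_eq h3, norm_div]
  have h4 : ‖Complex.exp (x * Complex.I) ^ J - 1‖ ≤ 2 := by
    refine (norm_sub_le _ _).trans ?_
    rw [norm_pow, Complex.norm_exp_ofReal_mul_I]; simp; norm_num
  calc _ ≤ 2 / (|x| / 2) := by gcongr
    _ = 4 / |x| := by field_simp; norm_num

lemma sum_kernel (I : Finset ℕ) (a : ℕ → ℝ) (K : ℕ → ℕ → ℝ) (hK : ∀ m ∈ I, ∀ n ∈ I, 0 ≤ K m n)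
    (hs : ∀ m n, K m n = K n m) {B : ℝ} (hB : ∀ m ∈ I, ∑ n ∈ I, K m n ≤ B) :
    ∑ m ∈ I, ∑ n ∈ I, a m * a n * K m n ≤ B * ∑ m ∈ I, a m ^ 2 := by
  have h1 : ∑ m ∈ I, ∑ n ∈ I, a m * a n * K m n ≤
      ∑ m ∈ I, ∑ n ∈ I, (a m ^ 2 * K m n / 2 + a n ^ 2 * K m n / 2) := by
    refine Finset.sum_le_sum fun m hm => Finset.sum_le_sum fun n hn => ?_
    nlinarith [mul_nonneg (hK m hm n hn) (sq_nonneg (a m - a n))]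
  have h2 : ∑ m ∈ I, ∑ n ∈ I, a m ^ 2 * K m n / 2 ≤ B / 2 * ∑ m ∈ I, a m ^ 2 := by
    rw [Finset.mul_sum]
    refine Finset.sum_le_sum fun m hm => ?_
    rw [← Finset.sum_div, ← Finset.mul_sum]
    nlinarith [mul_le_mul_of_nonneg_left (hB m hm) (sq_nonneg (a m))]
  have h3 : ∑ m ∈ I, ∑ n ∈ I, a n ^ 2 * K m n / 2 = ∑ m ∈ I, ∑ n ∈ I, a m ^ 2 * K m n / 2 := by
    rw [Finset.sum_comm]
    refine Finset.sum_congr rfl fun m _ => Finset.sum_congr rfl fun n _ => ?_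
    rw [hs]
  simp only [Finset.sum_add_distrib] at h1
  rw [h3] at h1
  linarith

lemma inv_sum_le (M m : ℕ) (hm : m ∈ Finset.Icc 1 M) :
    ∑ n ∈ (Finset.Icc 1 M).erase m, 1 / |(m : ℝ) - n| ≤ 2 * (1 + Real.log M) := by
  obtain ⟨h1, h2⟩ := Finset.mem_Icc.mp hm
  have hs : (Finset.Icc 1 M).erase m = Finset.Ico 1 m ∪ Finset.Ioc m M := by
    ext n; simp; omega
  have hd : Disjoint (Finset.Ico 1 m) (Finset.Ioc m M) := by
    rw [Finset.disjoint_left]; intro n; simp; omega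
  have hh : ∑ i ∈ Finset.Icc 1 M, (i : ℝ)⁻¹ ≤ 1 + Real.log M := by
    have := harmonic_le_one_add_log M
    simpa [harmonic_eq_sum_Icc] using this
  rw [hs, Finset.sum_union hd]
  have e1 : ∑ n ∈ Finset.Ico 1 m, 1 / |(m : ℝ) - n| ≤ ∑ i ∈ Finset.Icc 1 M, (i : ℝ)⁻¹ := by
    have : ∑ n ∈ Finset.Ico 1 m, 1 / |(m : ℝ) - n| = ∑ i ∈ (Finset.Ico 1 m).image (fun n => m - n), (i : ℝ)⁻¹ := by
      rw [Finset.sum_image]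
      · refine Finset.sum_congr rfl fun n hn => ?_
        have := (Finset.mem_Ico.mp hn).2
        rw [Nat.cast_sub this.le, one_div, abs_of_pos]
        have : (n : ℝ) < m := by exact_mod_cast this
        linarith
      · intro a ha b hb hab
        simp at ha hb hab; omega
    rw [this]
    refine Finset.sum_le_sum_of_subset_of_nonneg ?_ (fun _ _ _ => by positivity)
    intro i; simp; omega
  have e2 : ∑ n ∈ Finset.Ioc m M, 1 / |(m : ℝ) - n| ≤ ∑ i ∈ Finset.Icc 1 M, (i : ℝ)⁻¹ := by
    have : ∑ n ∈ Finset.Ioc m M, 1 / |(m : ℝ) - n| = ∑ i ∈ (Finset.Ioc m M).image (fun n => n - m), (i : ℝ)⁻¹ := by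
      rw [Finset.sum_image]
      · refine Finset.sum_congr rfl fun n hn => ?_
        have := (Finset.mem_Ioc.mp hn).1
        rw [Nat.cast_sub this.le, one_div, abs_sub_comm, abs_of_pos]
        have : (m : ℝ) < n := by exact_mod_cast this
        linarith
      · intro a ha b hb hab
        simp at ha hb hab; omega
    rw [this]
    refine Finset.sum_le_sum_of_subset_of_nonneg ?_ (fun _ _ _ => by positivity)
    intro i; simp; omega
  linarith

lemma log_gap {M m n : ℕ} (hm : m ∈ Finset.Icc 1 M) (hn : n ∈ Finset.Icc 1 M) :
    |(m : ℝ) - n| / M ≤ |Real.log m - Real.log n| := by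
  wlog h : n ≤ m generalizing m n
  · rw [abs_sub_comm, abs_sub_comm (Real.log m)]
    exact this hn hm (by omega)
  obtain ⟨h1, h2⟩ := Finset.mem_Icc.mp hm
  obtain ⟨h3, h4⟩ := Finset.mem_Icc.mp hn
  have hm0 : (0 : ℝ) < m := by exact_mod_cast h1
  have hn0 : (0 : ℝ) < n := by exact_mod_cast h3
  have hM : (m : ℝ) ≤ M := by exact_mod_cast h2
  have hnm : (n : ℝ) ≤ m := by exact_mod_cast h
  have h5 := Real.one_sub_inv_le_log_of_pos (show 0 < (m : ℝ) / n by positivity)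
  rw [Real.log_div hm0.ne' hn0.ne', inv_div] at h5
  refine le_trans ?_ (le_abs_self _)
  refine le_trans ?_ h5
  rw [abs_of_nonneg (by linarith)]
  have : 1 - (n : ℝ) / m = (m - n) / m := by field_simp
  rw [this]
  exact div_le_div_of_nonneg_left (by linarith) hm0 hM

lemma large_sieve {M J : ℕ} {h : ℝ} (h0 : h ≠ 0) (hM : |h| * Real.log M ≤ 1 / 2) {I : Finset ℕ}
    (hI : I ⊆ Finset.Icc 1 M) (b : ℕ → ℂ) :
    ∑ j ∈ Finset.range J, ‖∑ n ∈ I, b n * (Complex.exp ((h * Real.log n : ℝ) * Complex.I)) ^ j‖ ^ 2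
      ≤ (J + 8 * M * (1 + Real.log M) / |h|) * ∑ n ∈ I, ‖b n‖ ^ 2 := by
  set u : ℕ → ℂ := fun n => Complex.exp ((h * Real.log n : ℝ) * Complex.I) with hu
  have hp : 0 < |h| := abs_pos.mpr h0
  set K : ℕ → ℕ → ℝ := fun m n => if m = n then (J : ℝ) else 4 * M / |h| * (1 / |(m : ℝ) - n|) with hK
  have hexp : ∀ j, ((‖∑ n ∈ I, b n * u n ^ j‖ ^ 2 : ℝ) : ℂ) =
      ∑ m ∈ I, ∑ n ∈ I, b m * (starRingEnd ℂ) (b n) * (u m * (starRingEnd ℂ) (u n)) ^ j := by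
    intro j
    push_cast
    rw [← Complex.mul_conj', map_sum, Finset.sum_mul_sum]
    refine Finset.sum_congr rfl fun m _ => Finset.sum_congr rfl fun n _ => ?_
    rw [map_mul, map_pow]; ring
  have hcu : ∀ m n, u m * (starRingEnd ℂ) (u n) =
      Complex.exp ((h * (Real.log m - Real.log n) : ℝ) * Complex.I) := by
    intro m n
    simp only [hu]
    rw [← Complex.exp_conj, ← Complex.exp_add]
    congr 1
    simp only [map_mul, Complex.conj_ofReal, Complex.conj_I]
    push_cast; ring
  have hKb : ∀ m ∈ I, ∀ n ∈ I, ‖∑ j ∈ Finset.range J, (u m * (starRingEnd ℂ) (u n)) ^ j‖ ≤ K m n := by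
    intro m hm n hn
    by_cases hmn : m = n
    · simp only [hK, if_pos hmn]
      refine (norm_sum_le _ _).trans ?_
      have : ∀ j ∈ Finset.range J, ‖(u m * (starRingEnd ℂ) (u n)) ^ j‖ ≤ 1 := by
        intro j _
        rw [hcu, norm_pow, Complex.norm_exp_ofReal_mul_I]; simp
      simpa using Finset.sum_le_sum this
    · simp only [hK, if_neg hmn]
      have hm' := hI hm
      have hn' := hI hn
      have hg := log_gap hm' hn'
      have hmn' : 0 < |(m : ℝ) - n| := abs_pos.mpr (sub_ne_zero.mpr (by exact_mod_cast hmn))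
      obtain ⟨g1, g2⟩ := Finset.mem_Icc.mp hm'
      obtain ⟨g3, g4⟩ := Finset.mem_Icc.mp hn'
      have hM0 : (0 : ℝ) < M := by exact_mod_cast (show 0 < M by omega)
      have hl : 0 < |Real.log m - Real.log n| := lt_of_lt_of_le (by positivity) hg
      have hub : |Real.log m - Real.log n| ≤ Real.log M := by
        have a1 := Real.log_nonneg (show (1 : ℝ) ≤ m by exact_mod_cast g1)
        have a2 := Real.log_nonneg (show (1 : ℝ) ≤ n by exact_mod_cast g3)
        have a3 := Real.log_le_log (by exact_mod_cast g1) (show (m : ℝ) ≤ M by exact_mod_cast g2)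
        have a4 := Real.log_le_log (by exact_mod_cast g3) (show (n : ℝ) ≤ M by exact_mod_cast g4)
        rw [abs_le]; constructor <;> linarith
      rw [hcu]
      refine (geom_bound (mul_ne_zero h0 (abs_pos.mp hl)) ?_ J).trans ?_
      · rw [abs_mul]
        exact (mul_le_mul_of_nonneg_left hub hp.le).trans hM
      · rw [abs_mul]
        calc 4 / (|h| * |Real.log m - Real.log n|) ≤ 4 / (|h| * (|(m : ℝ) - n| / M)) := by gcongr
          _ = _ := by field_simp
  have hmain : ∑ j ∈ Finset.range J, ‖∑ n ∈ I, b n * u n ^ j‖ ^ 2 ≤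
      ∑ m ∈ I, ∑ n ∈ I, ‖b m‖ * ‖b n‖ * K m n := by
    have e : ((∑ j ∈ Finset.range J, ‖∑ n ∈ I, b n * u n ^ j‖ ^ 2 : ℝ) : ℂ) =
        ∑ m ∈ I, ∑ n ∈ I, b m * (starRingEnd ℂ) (b n) *
          ∑ j ∈ Finset.range J, (u m * (starRingEnd ℂ) (u n)) ^ j := by
      rw [Complex.ofReal_sum, Finset.sum_congr rfl fun j _ => hexp j, Finset.sum_comm]
      refine Finset.sum_congr rfl fun m _ => ?_
      rw [Finset.sum_comm]
      refine Finset.sum_congr rfl fun n _ => ?_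
      rw [Finset.mul_sum]
    have e2 : ∑ j ∈ Finset.range J, ‖∑ n ∈ I, b n * u n ^ j‖ ^ 2 =
        ‖((∑ j ∈ Finset.range J, ‖∑ n ∈ I, b n * u n ^ j‖ ^ 2 : ℝ) : ℂ)‖ := by
      rw [Complex.norm_real, Real.norm_of_nonneg (by positivity)]
    rw [e2, e]
    refine (norm_sum_le _ _).trans (Finset.sum_le_sum fun m hm => (norm_sum_le _ _).trans
      (Finset.sum_le_sum fun n hn => ?_))
    rw [norm_mul, norm_mul, RCLike.norm_conj]
    gcongr
    exact hKb m hm n hn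
  refine hmain.trans ?_
  refine sum_kernel I (fun n => ‖b n‖) K (fun m hm n hn => (norm_nonneg _).trans (hKb m hm n hn))
    (fun m n => ?_) (fun m hm => ?_)
  · simp only [hK, eq_comm (a := n), abs_sub_comm (n : ℝ)]
  · have hnn : ∀ n ∈ Finset.Icc 1 M, n ∉ I → 0 ≤ K m n := fun n _ _ => by
      simp only [hK]; split_ifs <;> positivity
    refine (Finset.sum_le_sum_of_subset_of_nonneg hI hnn).trans ?_
    rw [← Finset.add_sum_erase _ _ (hI hm)]
    have : ∑ n ∈ (Finset.Icc 1 M).erase m, K m n =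
        4 * M / |h| * ∑ n ∈ (Finset.Icc 1 M).erase m, 1 / |(m : ℝ) - n| := by
      rw [Finset.mul_sum]
      refine Finset.sum_congr rfl fun n hn => ?_
      simp only [hK]
      rw [if_neg (Finset.ne_of_mem_erase hn).symm]
    rw [this]
    have e3 := mul_le_mul_of_nonneg_left (inv_sum_le M m (hI hm)) (show 0 ≤ 4 * M / |h| by positivity)
    have e4 : K m m = J := by simp [hK]
    rw [e4]
    calc _ ≤ (J : ℝ) + 4 * M / |h| * (2 * (1 + Real.log M)) := by gcongr
      _ = _ := by ring

end ZDE

namespace ZDE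
open Filter Topology

/-- spacing -/
noncomputable def hh (T : ℝ) : ℝ := 1 / (2 * Real.log T)

/-- number of points -/
noncomputable def JJ (a T : ℝ) : ℕ := ⌈(T ^ a + 3) * (2 * Real.log T)⌉₊

/-- the points -/
noncomputable def pp (a T : ℝ) (j : Fin (JJ a T)) : ℂ := ((T + (j : ℕ) * hh T : ℝ) : ℂ) * Complex.I

lemma pp_re (a T : ℝ) (j : Fin (JJ a T)) : (pp a T j).re = 0 := by simp [pp]

lemma pp_im (a T : ℝ) (j : Fin (JJ a T)) : (pp a T j).im = T + (j : ℕ) * hh T := by simp [pp]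

lemma log_le_pow {b C : ℝ} (hb : 0 < b) : ∀ᶠ T : ℝ in atTop, C * (1 + Real.log T) ≤ T ^ b := by
  have h1 := (isLittleO_log_rpow_atTop hb).bound (show 0 < 1 / (2 * (|C| + 1)) by positivity)
  have h2 := (tendsto_rpow_atTop hb).eventually_ge_atTop (2 * |C|)
  filter_upwards [h1, h2, eventually_ge_atTop 1] with T h1 h2 h3
  rw [Real.norm_of_nonneg (Real.log_nonneg h3), Real.norm_of_nonneg (by positivity),
    div_mul_eq_mul_div, one_mul, le_div_iff₀ (by positivity)] at h1
  have := Real.log_nonneg h3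
  nlinarith [le_abs_self C, abs_nonneg C]

lemma eventually_J (a : ℝ) {a' : ℝ} (h : a' < a) (ha' : a' ≤ 1) (h0 : 0 < a') :
    ∀ᶠ T : ℝ in atTop, 0 < Real.log T ∧ 8 * (T ^ a') * (1 + Real.log T) / hh T ≤ JJ a T := by
  filter_upwards [log_le_pow (C := 8) (sub_pos.mpr h), eventually_gt_atTop 1] with T h1 h2
  have hl := Real.log_pos h2
  refine ⟨hl, le_trans ?_ (Nat.le_ceil _)⟩
  have h3 : (0 : ℝ) < T ^ a' := by positivity
  have : T ^ (a - a') * T ^ a' = T ^ a := by rw [← Real.rpow_add (by linarith)]; congr 1; ring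
  unfold hh
  rw [div_div_eq_mul_div, div_one]
  gcongr
  nlinarith

lemma large_sieve_gen (a : ℝ) {a' : ℝ} (h : a' < a) (ha' : a' ≤ 1) (h0 : 0 < a') :
    ∀ᶠ T : ℝ in atTop, ∀ e : ℝ, |e| = 1 → ∀ I : Finset ℕ, (∀ n ∈ I, 1 ≤ n ∧ (n : ℝ) ≤ T ^ a') →
      ∀ (b : ℕ → ℂ) (z : ℂ),
      nrm (pp a T) (fun s => ∑ n ∈ I, b n * (n : ℂ) ^ (e * s)) z ^ 2 ≤
        2 * JJ a T * ∑ n ∈ I, ‖b n‖ ^ 2 * (n : ℝ) ^ (2 * (e * z.re)) := by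
  filter_upwards [eventually_J a h ha' h0, eventually_gt_atTop 1] with T ⟨hl, h1⟩ hT e he I hI b z
  have hpow : T ^ a' ≤ T := by
    nth_rw 2 [← Real.rpow_one T]
    exact Real.rpow_le_rpow_of_exponent_le hT.le ha'
  have hpow1 : 1 ≤ T ^ a' := Real.one_le_rpow hT.le h0.le
  set M := ⌊T ^ a'⌋₊ with hM
  have hM1 : 1 ≤ M := Nat.le_floor (by simpa using hpow1)
  have hMT : (M : ℝ) ≤ T ^ a' := Nat.floor_le (by positivity)
  have hlM : Real.log M ≤ Real.log T := Real.log_le_log (by exact_mod_cast hM1) (hMT.trans hpow)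
  have hlM0 : 0 ≤ Real.log M := Real.log_nonneg (by exact_mod_cast hM1)
  have hhp : 0 < hh T := by unfold hh; positivity
  have habs : |e * hh T| = hh T := by rw [abs_mul, he, one_mul, abs_of_pos hhp]
  have hne : e * hh T ≠ 0 := by rw [← abs_pos, habs]; exact hhp
  have hIM : I ⊆ Finset.Icc 1 M := fun n hn => Finset.mem_Icc.mpr ⟨(hI n hn).1, Nat.le_floor (hI n hn).2⟩
  have key := large_sieve (M := M) (J := JJ a T) (h := e * hh T) hne
    (by rw [habs]
        calc hh T * Real.log M ≤ hh T * Real.log T := by gcongr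
          _ = 1 / 2 := by unfold hh; field_simp) hIM
    (fun n => b n * (n : ℂ) ^ (e * (z + T * Complex.I)))
  rw [habs] at key
  have e1 : nrm (pp a T) (fun s => ∑ n ∈ I, b n * (n : ℂ) ^ (e * s)) z ^ 2 =
      ∑ j ∈ Finset.range (JJ a T), ‖∑ n ∈ I, b n * (n : ℂ) ^ (e * (z + T * Complex.I)) *
        (Complex.exp ((e * hh T * Real.log n : ℝ) * Complex.I)) ^ j‖ ^ 2 := by
    rw [nrm_sq, ← Fin.sum_univ_eq_sum_range (fun j => ‖∑ n ∈ I, b n * (n : ℂ) ^ (e * (z + T * Complex.I)) *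
        (Complex.exp ((e * hh T * Real.log n : ℝ) * Complex.I)) ^ j‖ ^ 2)]
    refine Finset.sum_congr rfl fun j _ => ?_
    congr 2
    refine Finset.sum_congr rfl fun n hn => ?_
    have hn0 : (n : ℂ) ≠ 0 := by
      have := (hI n hn).1
      exact_mod_cast (by omega : n ≠ 0)
    rw [mul_assoc, ← Complex.exp_nat_mul]
    congr 1
    rw [Complex.cpow_def_of_ne_zero hn0, Complex.cpow_def_of_ne_zero hn0, ← Complex.exp_add]
    congr 1
    rw [← Complex.natCast_log]
    simp only [pp]
    push_cast
    ring
  rw [e1]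
  refine key.trans ?_
  have e2 : ∑ n ∈ I, ‖b n * (n : ℂ) ^ (e * (z + T * Complex.I))‖ ^ 2 =
      ∑ n ∈ I, ‖b n‖ ^ 2 * (n : ℝ) ^ (2 * (e * z.re)) := by
    refine Finset.sum_congr rfl fun n hn => ?_
    have hn0 : 0 < n := by have := (hI n hn).1; omega
    rw [norm_mul, Complex.norm_natCast_cpow_of_pos hn0, mul_pow]
    congr 1
    rw [← Real.rpow_natCast, ← Real.rpow_mul (by positivity)]
    congr 1
    simp; ring
  rw [e2]
  refine mul_le_mul_of_nonneg_right ?_ (Finset.sum_nonneg fun n _ => by positivity)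
  have : 8 * (M : ℝ) * (1 + Real.log M) / hh T ≤ 8 * (T ^ a') * (1 + Real.log T) / hh T := by
    gcongr
  linarith

end ZDE

namespace ZDE
open Filter Topology

lemma norm_Gamma_le {s : ℂ} (hs : 0 < s.re) : ‖Complex.Gamma s‖ ≤ Real.Gamma s.re := by
  rw [Complex.Gamma_eq_integral hs, Real.Gamma_eq_integral hs, Complex.GammaIntegral]
  refine (MeasureTheory.norm_integral_le_integral_norm _).trans (le_of_eq ?_)
  refine MeasureTheory.setIntegral_congr_fun measurableSet_Ioi fun x hx => ?_
  have hx0 : 0 < x := hx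
  simp only [norm_mul]
  rw [Complex.norm_real, Real.norm_of_nonneg (Real.exp_pos _).le,
    Complex.norm_cpow_eq_rpow_re_of_pos hx0]
  simp

lemma norm_ge_one_of_im {s : ℂ} (h : 1 ≤ |s.im|) : 1 ≤ ‖s‖ := h.trans (Complex.abs_im_le_norm s)

lemma ne_zero_of_im {s : ℂ} (h : 1 ≤ |s.im|) : s ≠ 0 := by
  rw [← norm_pos_iff]; linarith [norm_ge_one_of_im h]

lemma Gamma_shift {s : ℂ} (h : 1 ≤ |s.im|) (n : ℕ) : ‖Complex.Gamma s‖ ≤ ‖Complex.Gamma (s + n)‖ := by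
  induction n with
  | zero => simp
  | succ n ih =>
    have h1 : 1 ≤ |(s + n).im| := by simpa using h
    have e : s + ((n + 1 : ℕ) : ℂ) = (s + n) + 1 := by push_cast; ring
    rw [e, Complex.Gamma_add_one _ (ne_zero_of_im h1), norm_mul]
    nlinarith [norm_ge_one_of_im h1, norm_nonneg (Complex.Gamma (s + n))]

lemma Gamma_crude (B : ℕ) : ∃ C : ℝ, 0 < C ∧ ∀ s : ℂ, |s.re| ≤ B → 1 ≤ |s.im| → ‖Complex.Gamma s‖ ≤ C := by
  have hc : ContinuousOn Real.Gamma (Set.Icc 1 (2 * B + 1)) := by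
    intro x hx
    refine (Real.differentiableAt_Gamma fun m => ?_).continuousAt.continuousWithinAt
    have := hx.1
    have : (0 : ℝ) ≤ m := Nat.cast_nonneg m
    intro h; linarith
  obtain ⟨C, hC⟩ := isCompact_Icc.exists_bound_of_continuousOn hc
  refine ⟨max C 1, by positivity, fun s h1 h2 => ?_⟩
  have h3 := abs_le.mp h1
  refine (Gamma_shift h2 (B + 1)).trans ?_
  have e : (s + ((B + 1 : ℕ) : ℂ)).re = s.re + (B + 1) := by simp
  refine (norm_Gamma_le (by rw [e]; linarith)).trans ?_
  rw [e]
  refine le_trans ?_ (le_max_left _ _)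
  refine (le_abs_self _).trans (hC _ ⟨by linarith, by linarith⟩)

lemma Gamma_inv_crude (B : ℕ) : ∃ C : ℝ, 0 < C ∧ ∀ s : ℂ, |s.re| ≤ B → 1 ≤ |s.im| →
    ‖(Complex.Gamma s)⁻¹‖ ≤ C * Real.exp (Real.pi * |s.im|) := by
  obtain ⟨C, hC, h⟩ := Gamma_crude (B + 1)
  refine ⟨C, hC, fun s h1 h2 => ?_⟩
  have hb : |(1 - s).re| ≤ ((B + 1 : ℕ) : ℝ) := by
    have := abs_le.mp h1
    push_cast
    rw [Complex.sub_re, Complex.one_re, abs_le]; constructor <;> linarith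
  have h3 := h (1 - s) hb (by simpa using h2)
  have hG : Complex.Gamma s ≠ 0 := Complex.Gamma_ne_zero fun m hm => by
    rw [hm] at h2; simp at h2; linarith
  have h4 := Complex.Gamma_mul_Gamma_one_sub s
  have hG1 : Complex.Gamma (1 - s) ≠ 0 := Complex.Gamma_ne_zero fun m hm => by
    have : |(1 - s).im| = |s.im| := by simp
    rw [← this, hm] at h2; simp at h2; linarith
  have hsin : Complex.sin (Real.pi * s) ≠ 0 := by
    intro h0; rw [h0, div_zero] at h4
    exact mul_ne_zero hG hG1 h4
  have h5 : (Complex.Gamma s)⁻¹ = Complex.Gamma (1 - s) * Complex.sin (Real.pi * s) / Real.pi := by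
    have hpi : (Real.pi : ℂ) ≠ 0 := by exact_mod_cast Real.pi_ne_zero
    rw [eq_div_iff hsin] at h4
    rw [inv_eq_iff_eq_inv, inv_div, eq_div_iff (mul_ne_zero hG1 hsin)]
    linear_combination h4
  rw [h5, norm_div, norm_mul, Complex.norm_real, Real.norm_of_nonneg Real.pi_pos.le]
  have h6 : ‖Complex.sin (Real.pi * s)‖ ≤ Real.exp (Real.pi * |s.im|) := by
    refine (norm_sin_le _).trans ?_
    have e : ((Real.pi : ℂ) * s).im = Real.pi * s.im := by simp
    rw [e]
    have a1 : Real.exp (Real.pi * s.im) ≤ Real.exp (Real.pi * |s.im|) :=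
      Real.exp_le_exp.mpr (mul_le_mul_of_nonneg_left (le_abs_self _) Real.pi_pos.le)
    have a2 : Real.exp (-(Real.pi * s.im)) ≤ Real.exp (Real.pi * |s.im|) :=
      Real.exp_le_exp.mpr (by
        rw [← mul_neg]; exact mul_le_mul_of_nonneg_left (neg_le_abs _) Real.pi_pos.le)
    linarith
  calc ‖Complex.Gamma (1 - s)‖ * ‖Complex.sin (Real.pi * s)‖ / Real.pi
      ≤ C * Real.exp (Real.pi * |s.im|) / 1 := by
        gcongr
        linarith [Real.pi_gt_three]
    _ = _ := by ring

lemma mellin_bound (f : ℝ → ℂ) {l r : ℝ} (hl : MellinConvergent f l) (hr : MellinConvergent f r) :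
    ∃ C : ℝ, ∀ s : ℂ, l ≤ s.re → s.re ≤ r → ‖mellin f s‖ ≤ C := by
  refine ⟨∫ t : ℝ in Set.Ioi 0, (‖(t : ℂ) ^ ((l : ℂ) - 1) • f t‖ + ‖(t : ℂ) ^ ((r : ℂ) - 1) • f t‖),
    fun s h1 h2 => ?_⟩
  unfold mellin
  refine MeasureTheory.norm_integral_le_of_norm_le (hl.norm.add hr.norm) ?_
  refine (MeasureTheory.ae_restrict_iff' measurableSet_Ioi).mpr (Eventually.of_forall fun t ht => ?_)
  have ht0 : 0 < t := ht
  simp only [norm_smul]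
  rw [← add_mul]
  refine mul_le_mul_of_nonneg_right ?_ (norm_nonneg _)
  rw [Complex.norm_cpow_eq_rpow_re_of_pos ht0, Complex.norm_cpow_eq_rpow_re_of_pos ht0,
    Complex.norm_cpow_eq_rpow_re_of_pos ht0]
  simp only [Complex.sub_re, Complex.ofReal_re, Complex.one_re]
  rcases le_total t 1 with h | h
  · have := Real.rpow_le_rpow_of_exponent_ge ht0 h (show l - 1 ≤ s.re - 1 by linarith)
    have : 0 ≤ t ^ (r - 1) := by positivity
    linarith
  · have := Real.rpow_le_rpow_of_exponent_le h (show s.re - 1 ≤ r - 1 by linarith)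
    have : 0 ≤ t ^ (l - 1) := by positivity
    linarith

lemma Lambda0_bound (B : ℕ) : ∃ C : ℝ, ∀ s : ℂ, |s.re| ≤ B → ‖completedRiemannZeta₀ s‖ ≤ C := by
  set P := HurwitzZeta.hurwitzEvenFEPair 0 with hP
  have hc : ∀ s : ℂ, MellinConvergent P.f_modif s := fun s =>
    ((P.isStrongFEPair_toStrongFEPair).hasMellin s).1
  obtain ⟨C, hC⟩ := mellin_bound P.f_modif (hc ((-B / 2 : ℝ) : ℂ)) (hc ((B / 2 : ℝ) : ℂ))
  refine ⟨C, fun s hs => ?_⟩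
  have hs' := abs_le.mp hs
  have e : completedRiemannZeta₀ s = mellin P.f_modif (s / 2) / 2 := rfl
  have h2 := hC (s / 2) (by rw [Complex.div_ofNat_re]; linarith) (by rw [Complex.div_ofNat_re]; linarith)
  rw [e, norm_div, Complex.norm_ofNat]
  linarith [norm_nonneg (mellin P.f_modif (s / 2))]

lemma hFun_eq (s : ℂ) : hFun s = Complex.Gammaℝ s := rfl

lemma hFun_ne {s : ℂ} (h : s.im ≠ 0) : hFun s ≠ 0 := by
  unfold hFun
  refine mul_ne_zero ?_ (Complex.Gamma_ne_zero fun m hm => h ?_)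
  · simp [Real.pi_ne_zero]
  · have : (s / 2).im = (-(m : ℂ)).im := by rw [hm]
    rw [Complex.div_ofNat_im] at this
    simp at this; exact this

lemma im_one_sub {s : ℂ} (h : s.im ≠ 0) : (1 - s).im ≠ 0 := by simpa using h

lemma chi_mul {s : ℂ} (h : s.im ≠ 0) : chiFun s * chiFun (1 - s) = 1 := by
  unfold chiFun
  have h1 := hFun_ne h
  have h2 := hFun_ne (im_one_sub h)
  rw [sub_sub_cancel]
  field_simp

lemma zeta_fe {s : ℂ} (h : s.im ≠ 0) : riemannZeta s = chiFun s * riemannZeta (1 - s) := by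
  have hs0 : s ≠ 0 := fun e => h (by rw [e]; simp)
  have hs1 : 1 - s ≠ 0 := fun e => im_one_sub h (by rw [e]; simp)
  rw [riemannZeta_def_of_ne_zero hs0, riemannZeta_def_of_ne_zero hs1, completedRiemannZeta_one_sub]
  have h1 := hFun_ne h
  have h2 := hFun_ne (im_one_sub h)
  rw [hFun_eq] at h1 h2
  unfold chiFun
  rw [hFun_eq, hFun_eq]
  field_simp

lemma hFun_conj (s : ℂ) : hFun ((starRingEnd ℂ) s) = (starRingEnd ℂ) (hFun s) := by
  unfold hFun
  have h := Complex.cpow_conj (Real.pi : ℂ) (-s / 2)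
    (by rw [Complex.arg_ofReal_of_nonneg Real.pi_pos.le]; exact Real.pi_pos.ne)
  rw [Complex.conj_ofReal] at h
  rw [map_mul, ← Complex.Gamma_conj, ← h]
  simp [map_ofNat]

lemma chi_conj (s : ℂ) : chiFun ((starRingEnd ℂ) s) = (starRingEnd ℂ) (chiFun s) := by
  unfold chiFun
  rw [map_div₀, ← hFun_conj, ← hFun_conj]; simp

lemma chi_half {s : ℂ} (h : s.im ≠ 0) (hr : s.re = 1 / 2) : ‖chiFun s‖ = 1 := by
  have e : 1 - s = (starRingEnd ℂ) s := by
    apply Complex.ext <;> simp [hr]; norm_num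
  have h1 := hFun_ne h
  unfold chiFun
  rw [e, hFun_conj, norm_div, RCLike.norm_conj, div_self (norm_ne_zero_iff.mpr h1)]

lemma pi_pow_bound (B : ℕ) : ∃ C : ℝ, 0 < C ∧ ∀ s : ℂ, |s.re| ≤ B → ‖(Real.pi : ℂ) ^ s‖ ≤ C := by
  refine ⟨Real.pi ^ (B : ℝ), by positivity, fun s hs => ?_⟩
  rw [Complex.norm_cpow_eq_rpow_re_of_pos Real.pi_pos]
  exact Real.rpow_le_rpow_of_exponent_le (by linarith [Real.pi_gt_three]) ((le_abs_self _).trans hs)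

lemma hFun_crude (B : ℕ) : ∃ C : ℝ, 0 < C ∧ ∀ s : ℂ, |s.re| ≤ B → 2 ≤ |s.im| →
    ‖hFun s‖ ≤ C ∧ ‖(hFun s)⁻¹‖ ≤ C * Real.exp (Real.pi * |s.im|) := by
  obtain ⟨C1, h1, k1⟩ := Gamma_crude B
  obtain ⟨C2, h2, k2⟩ := Gamma_inv_crude B
  obtain ⟨C3, h3, k3⟩ := pi_pow_bound B
  refine ⟨C3 * C1 + C3 * C2, by positivity, fun s hs ht => ?_⟩
  have a1 : |(s / 2).re| ≤ B := by
    rw [Complex.div_ofNat_re, abs_div]; simp only [Nat.abs_ofNat]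
    linarith [abs_nonneg s.re]
  have a2 : |(s / 2).im| = |s.im| / 2 := by rw [Complex.div_ofNat_im, abs_div]; simp
  have a3 : |(-s / 2).re| ≤ B := by
    rw [neg_div, Complex.neg_re, abs_neg]; exact a1
  have b1 := k1 (s / 2) a1 (by rw [a2]; linarith)
  have b2 := k2 (s / 2) a1 (by rw [a2]; linarith)
  have b3 := k3 _ a3
  have b4 := k3 _ a1
  constructor
  · unfold hFun
    rw [norm_mul]
    have : ‖(Real.pi : ℂ) ^ (-s / 2)‖ * ‖Complex.Gamma (s / 2)‖ ≤ C3 * C1 := by gcongr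
    linarith [mul_pos h3 h2]
  · unfold hFun
    rw [mul_inv, norm_mul, ← Complex.cpow_neg, neg_div, neg_neg]
    calc _ ≤ C3 * (C2 * Real.exp (Real.pi * |(s / 2).im|)) := by gcongr
      _ ≤ C3 * (C2 * Real.exp (Real.pi * |s.im|)) := by
        rw [a2]; gcongr; linarith [abs_nonneg s.im]
      _ ≤ _ := by
        rw [← mul_assoc]; gcongr; linarith [mul_pos h3 h1]

lemma chi_crude (B : ℕ) : ∃ C : ℝ, 0 < C ∧ ∀ s : ℂ, |s.re| ≤ B → 2 ≤ |s.im| →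
    ‖chiFun s‖ ≤ C * Real.exp (Real.pi * |s.im|) := by
  obtain ⟨C1, h1, k1⟩ := hFun_crude (B + 1)
  refine ⟨C1 * C1, by positivity, fun s hs ht => ?_⟩
  have hs' := abs_le.mp hs
  have a1 := (k1 (1 - s) (by push_cast; simp only [Complex.sub_re, Complex.one_re]; rw [abs_le]; constructor <;> linarith)
    (by simpa using ht)).1
  have a2 := (k1 s (by push_cast; linarith) ht).2
  unfold chiFun
  rw [div_eq_mul_inv, norm_mul, mul_assoc]
  gcongr

lemma zeta_crude (B : ℕ) : ∃ C : ℝ, 0 < C ∧ ∀ s : ℂ, |s.re| ≤ B → 2 ≤ |s.im| →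
    ‖riemannZeta s‖ ≤ C * Real.exp (Real.pi * |s.im|) := by
  obtain ⟨C1, h1, k1⟩ := hFun_crude B
  obtain ⟨C2, k2⟩ := Lambda0_bound B
  refine ⟨(|C2| + 2) * C1, by positivity, fun s hs ht => ?_⟩
  have hs0 : s ≠ 0 := ne_zero_of_im (by linarith)
  have hn := norm_ge_one_of_im (s := s) (by linarith)
  have hn1 := norm_ge_one_of_im (s := 1 - s) (by simp; linarith)
  rw [riemannZeta_def_of_ne_zero hs0, ← hFun_eq, div_eq_mul_inv, norm_mul, mul_assoc]
  have a2 := (k1 s hs ht).2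
  have a3 : ‖completedRiemannZeta s‖ ≤ |C2| + 2 := by
    rw [completedRiemannZeta_eq]
    refine (norm_sub_le _ _).trans ?_
    have b1 : ‖completedRiemannZeta₀ s - 1 / s‖ ≤ |C2| + 1 := by
      refine (norm_sub_le _ _).trans (add_le_add ((k2 s hs).trans (le_abs_self _)) ?_)
      rw [norm_div, norm_one]; exact div_le_one_of_le₀ hn (norm_nonneg _)
    have b2 : ‖1 / (1 - s)‖ ≤ 1 := by
      rw [norm_div, norm_one]; exact div_le_one_of_le₀ hn1 (norm_nonneg _)
    linarith
  gcongr

end ZDE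

namespace ZDE
open Filter Topology

lemma Gamma_one_add (t : ℝ) (ht : 0 < t) :
    ‖Complex.Gamma (1 + t * Complex.I)‖ ^ 2 = Real.pi * t / Real.sinh (Real.pi * t) := by
  have hne : (t : ℂ) * Complex.I ≠ 0 := by simp [ht.ne']
  have h1 : Complex.Gamma (1 + t * Complex.I) = t * Complex.I * Complex.Gamma (t * Complex.I) := by
    rw [add_comm, Complex.Gamma_add_one _ hne]
  have h2 : (starRingEnd ℂ) (1 + t * Complex.I) = 1 - t * Complex.I := by simp [sub_eq_add_neg]
  have h3 : ((‖Complex.Gamma (1 + t * Complex.I)‖ ^ 2 : ℝ) : ℂ) =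
      t * Complex.I * (Real.pi / Complex.sin (Real.pi * (t * Complex.I))) := by
    push_cast
    rw [← Complex.mul_conj', ← Complex.Gamma_conj, h2, ← Complex.Gamma_mul_Gamma_one_sub, h1]
    ring
  have hs : Complex.sin (Real.pi * (t * Complex.I)) = (Real.sinh (Real.pi * t) : ℝ) * Complex.I := by
    rw [← mul_assoc, Complex.sin_mul_I]; push_cast; rfl
  have hsh : 0 < Real.sinh (Real.pi * t) := Real.sinh_pos_iff.mpr (by positivity)
  rw [hs] at h3
  have : (Real.sinh (Real.pi * t) : ℂ) ≠ 0 := by exact_mod_cast hsh.ne'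
  have h4 : (t : ℂ) * Complex.I * (Real.pi / ((Real.sinh (Real.pi * t) : ℝ) * Complex.I)) =
      ((Real.pi * t / Real.sinh (Real.pi * t) : ℝ) : ℂ) := by
    rw [Complex.ofReal_div, Complex.ofReal_mul]
    field_simp [Complex.I_ne_zero]
  rw [h4] at h3
  exact_mod_cast h3

lemma Gamma_shift_bounds (A : ℕ) {t : ℝ} (ht : 1 ≤ t) :
    t ^ A * ‖Complex.Gamma (1 + t * Complex.I)‖ ≤ ‖Complex.Gamma (1 + A + t * Complex.I)‖ ∧
    ‖Complex.Gamma (1 + A + t * Complex.I)‖ ≤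
      (Nat.factorial (A + 1)) * t ^ A * ‖Complex.Gamma (1 + t * Complex.I)‖ := by
  induction A with
  | zero => simp
  | succ A ih =>
    have e : (1 : ℂ) + ((A + 1 : ℕ) : ℂ) + t * Complex.I = (1 + A + t * Complex.I) + 1 := by
      push_cast; ring
    have him : (1 + (A : ℂ) + t * Complex.I).im = t := by simp
    have hne : (1 + (A : ℂ) + t * Complex.I) ≠ 0 := ne_zero_of_im (by rw [him]; exact ht.trans (le_abs_self _))
    rw [e, Complex.Gamma_add_one _ hne, norm_mul]
    have l1 : t ≤ ‖1 + (A : ℂ) + t * Complex.I‖ := by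
      have := Complex.abs_im_le_norm (1 + (A : ℂ) + t * Complex.I)
      rw [him] at this; exact (le_abs_self _).trans this
    have l2 : ‖1 + (A : ℂ) + t * Complex.I‖ ≤ (A + 2) * t := by
      refine (norm_add_le _ _).trans ?_
      have a1 : ‖(1 : ℂ) + A‖ = 1 + A := by
        rw [show (1 : ℂ) + A = ((1 + A : ℕ) : ℂ) by push_cast; ring, Complex.norm_natCast]; push_cast; ring
      have a2 : ‖(t : ℂ) * Complex.I‖ = t := by
        simp [abs_of_nonneg (by linarith : 0 ≤ t)]
      rw [a1, a2]
      have : (0 : ℝ) ≤ A := Nat.cast_nonneg A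
      nlinarith
    constructor
    · calc t ^ (A + 1) * ‖Complex.Gamma (1 + t * Complex.I)‖
          = t * (t ^ A * ‖Complex.Gamma (1 + t * Complex.I)‖) := by ring
        _ ≤ _ := by gcongr; exact ih.1
    · have e2 : ((Nat.factorial (A + 1 + 1) : ℕ) : ℝ) = (A + 2) * (Nat.factorial (A + 1) : ℕ) := by
        rw [Nat.factorial_succ (A + 1)]; push_cast; ring
      calc _ ≤ ((A + 2) * t) * ((Nat.factorial (A + 1)) * t ^ A * ‖Complex.Gamma (1 + t * Complex.I)‖) := by
            gcongr; exact ih.2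
        _ = _ := by rw [e2]; ring

lemma Gamma_cos_bounds {t c : ℝ} (ht : 1 ≤ t)
    (h1 : (Real.exp (Real.pi * t / 2) - Real.exp (-(Real.pi * t / 2))) / 2 ≤ c)
    (h2 : c ≤ (Real.exp (Real.pi * t / 2) + Real.exp (-(Real.pi * t / 2))) / 2) :
    t / 4 ≤ ‖Complex.Gamma (1 + t * Complex.I)‖ ^ 2 * c ^ 2 ∧
    ‖Complex.Gamma (1 + t * Complex.I)‖ ^ 2 * c ^ 2 ≤ 4 * t := by
  have hpi := Real.pi_gt_three
  have hpi4 := Real.pi_lt_four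
  rw [Gamma_one_add t (by linarith), Real.sinh_eq]
  set e := Real.exp (Real.pi * t / 2) with he
  set e' := Real.exp (-(Real.pi * t / 2)) with he'
  have hee : e * e' = 1 := by rw [he, he', ← Real.exp_add]; simp
  have x1 : Real.exp (Real.pi * t) = e ^ 2 := by rw [he, ← Real.exp_nat_mul]; congr 1; push_cast; ring
  have x2 : Real.exp (-(Real.pi * t)) = e' ^ 2 := by rw [he', ← Real.exp_nat_mul]; congr 1; push_cast; ring
  rw [x1, x2]
  have he2 : 2 ≤ e := by
    have := Real.add_one_le_exp (Real.pi * t / 2)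
    nlinarith
  have hep : 0 < e' := Real.exp_pos _
  have he3 : e' ≤ 1 / 2 := by nlinarith
  have hden : 0 < (e ^ 2 - e' ^ 2) / 2 := by nlinarith
  have hc0 : 0 ≤ c := by linarith
  have hd1 : 0 < e - e' := by linarith
  have hs1 : 0 < e + e' := by linarith
  have c1 : (e - e') ^ 2 / 4 ≤ c ^ 2 := by nlinarith
  have c2 : c ^ 2 ≤ (e + e') ^ 2 / 4 := by nlinarith
  have f1 : e ^ 2 - e' ^ 2 = (e - e') * (e + e') := by ring
  constructor
  · rw [div_mul_eq_mul_div, le_div_iff₀ hden]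
    have g1 : (e ^ 2 - e' ^ 2) / 2 ≤ 4 * c ^ 2 := by
      rw [f1]; nlinarith
    have g2 : t / 4 * ((e ^ 2 - e' ^ 2) / 2) ≤ t / 4 * (4 * c ^ 2) := by gcongr
    have g3 : t * c ^ 2 ≤ Real.pi * t * c ^ 2 := by
      have : 0 ≤ t * c ^ 2 := by positivity
      nlinarith
    linarith
  · rw [div_mul_eq_mul_div, div_le_iff₀ hden]
    have g1 : c ^ 2 ≤ (e ^ 2 - e' ^ 2) / 2 := by
      rw [f1]; nlinarith
    calc Real.pi * t * c ^ 2 ≤ 4 * t * ((e ^ 2 - e' ^ 2) / 2) := by gcongr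

lemma chi_right (A : ℕ) : ∃ c C : ℝ, 0 < c ∧ 0 < C ∧ ∀ s : ℂ, s.re = 1 + A → 1 ≤ s.im →
    c * s.im ^ ((A : ℝ) + 1 / 2) ≤ ‖chiFun s‖⁻¹ ∧ ‖chiFun s‖⁻¹ ≤ C * s.im ^ ((A : ℝ) + 1 / 2) := by
  set K : ℝ := 2 * (2 * Real.pi) ^ (-((1 : ℝ) + A)) with hK
  have hK0 : 0 < K := by have := Real.pi_pos; positivity
  refine ⟨K * (1 / 2), K * ((Nat.factorial (A + 1)) * 2), by positivity, by positivity, fun s hs ht => ?_⟩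
  set t := s.im with htd
  have hs' : s = 1 + A + t * Complex.I := by
    apply Complex.ext <;> simp [hs, htd]
  have hX : ‖chiFun s‖⁻¹ = K * (‖Complex.Gamma s‖ * ‖Complex.cos (Real.pi * s / 2)‖) := by
    rw [chi_eq (by linarith), norm_inv, inv_inv, norm_mul, norm_mul, norm_mul]
    have : ((2 : ℂ) * Real.pi) = ((2 * Real.pi : ℝ) : ℂ) := by push_cast; ring
    rw [this, Complex.norm_cpow_eq_rpow_re_of_pos (by have := Real.pi_pos; positivity), Complex.neg_re, hs,
      Complex.norm_ofNat, hK]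
    ring
  set c := ‖Complex.cos (Real.pi * s / 2)‖ with hc
  have l1 := norm_cos_ge (Real.pi * s / 2)
  have l2 := norm_cos_le (Real.pi * s / 2)
  rw [pis_im] at l1 l2
  obtain ⟨b1, b2⟩ := Gamma_cos_bounds ht l1 l2
  obtain ⟨d1, d2⟩ := Gamma_shift_bounds A ht
  rw [← hs'] at d1 d2
  set g := ‖Complex.Gamma (1 + t * Complex.I)‖ with hg
  have hg0 : 0 ≤ g := norm_nonneg _
  have hc0 : 0 ≤ c := norm_nonneg _
  have ht0 : 0 < t := by linarith
  have hpow : t ^ ((A : ℝ) + 1 / 2) = t ^ A * √t := by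
    rw [Real.rpow_add ht0, Real.rpow_natCast, Real.sqrt_eq_rpow]
  have m1 : 1 / 2 * √t ≤ g * c := by
    refine le_of_sq_le_sq ?_ (by positivity)
    rw [mul_pow, mul_pow, Real.sq_sqrt ht0.le]; linarith
  have m2 : g * c ≤ 2 * √t := by
    refine le_of_sq_le_sq ?_ (by positivity)
    rw [mul_pow, mul_pow, Real.sq_sqrt ht0.le]; linarith
  rw [hX, hpow]
  clear_value K
  constructor
  · rw [mul_assoc]
    refine mul_le_mul_of_nonneg_left ?_ hK0.le
    calc 1 / 2 * (t ^ A * √t) = t ^ A * (1 / 2 * √t) := by ring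
      _ ≤ t ^ A * (g * c) := by gcongr
      _ = (t ^ A * g) * c := by ring
      _ ≤ _ := by gcongr
  · rw [mul_assoc]
    refine mul_le_mul_of_nonneg_left ?_ hK0.le
    calc ‖Complex.Gamma s‖ * c ≤ ((Nat.factorial (A + 1)) * t ^ A * g) * c := by gcongr
      _ = (Nat.factorial (A + 1)) * t ^ A * (g * c) := by ring
      _ ≤ (Nat.factorial (A + 1)) * t ^ A * (2 * √t) := by gcongr
      _ = _ := by ring

end ZDE

namespace ZDE
open Filter Topology

lemma three_lines {J : ℕ} {p : Fin J → ℂ} {f : ℂ → ℂ} {l r Y K E Q : ℝ} (hlr : l < r) (hY : 0 < Y)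
    (hQ : 1 ≤ Q)
    (hd : ∀ z : ℂ, l ≤ z.re → z.re ≤ r → |z.im| ≤ Y → ∀ j, DifferentiableAt ℂ f (z + p j))
    (hl : ∀ z : ℂ, z.re = l → |z.im| ≤ Y → nrm p f z ≤ K * Q ^ (-l))
    (hr : ∀ z : ℂ, z.re = r → |z.im| ≤ Y → nrm p f z ≤ K * Q ^ (-r))
    (hE : ∀ z : ℂ, l ≤ z.re → z.re ≤ r → |z.im| = Y → nrm p f z ≤ E)
    (hEK : E * Real.exp (-(Y ^ 2 / 4)) * Q ^ r ≤ K)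
    (z0 : ℂ) (h1 : l ≤ z0.re) (h2 : z0.re ≤ r) (h3 : |z0.im| ≤ Y / 2) :
    nrm p f z0 ≤ K * Real.exp ((r - l) ^ 2) * Q ^ (-z0.re) := by
  have hQ0 : 0 < Q := by linarith
  set U : Set ℂ := Set.Ioo l r ×ℂ Set.Ioo (-Y) Y with hU
  have hUo : IsOpen U := isOpen_Ioo.reProdIm isOpen_Ioo
  have hcl : closure U = Set.Icc l r ×ℂ Set.Icc (-Y) Y := by
    rw [hU, Complex.closure_reProdIm, closure_Ioo hlr.ne, closure_Ioo (by linarith : -Y ≠ Y)]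
  set G : ℂ → EuclideanSpace ℂ (Fin J) := fun z =>
    Complex.exp ((z - z0) ^ 2 + z * Real.log Q) • vec p f z with hG
  have hGn : ∀ z, ‖G z‖ = Real.exp ((z.re - z0.re) ^ 2 - (z.im - z0.im) ^ 2) * Q ^ z.re * nrm p f z := by
    intro z
    simp only [hG, norm_smul]
    rw [Complex.norm_exp]
    have : ((z - z0) ^ 2 + z * (Real.log Q : ℂ)).re =
        ((z.re - z0.re) ^ 2 - (z.im - z0.im) ^ 2) + Real.log Q * z.re := by
      simp [sq]; ring
    rw [this, Real.exp_add, Real.rpow_def_of_pos hQ0]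
    rfl
  have hmem : ∀ z, z ∈ closure U → l ≤ z.re ∧ z.re ≤ r ∧ |z.im| ≤ Y := by
    intro z hz
    rw [hcl, Complex.mem_reProdIm] at hz
    exact ⟨hz.1.1, hz.1.2, abs_le.mpr hz.2⟩
  have hdiff : DiffContOnCl ℂ G U := by
    refine DifferentiableOn.diffContOnCl fun z hz => ?_
    obtain ⟨a, b, c⟩ := hmem z hz
    exact (((by fun_prop : DifferentiableAt ℂ (fun z => Complex.exp ((z - z0) ^ 2 + z * Real.log Q)) z)).smul
      (vec_diff (hd z a b c))).differentiableWithinAt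
  have hb : Bornology.IsBounded U :=
    (Metric.isBounded_Ioo l r).reProdIm (Metric.isBounded_Ioo (-Y) Y)
  have hsq : ∀ z : ℂ, l ≤ z.re → z.re ≤ r → (z.re - z0.re) ^ 2 ≤ (r - l) ^ 2 := by
    intro z a b
    apply sq_le_sq'  <;> linarith
  have hK0 : 0 ≤ K := by
    have := (nrm_nonneg p f l).trans (hl (l : ℂ) (by simp) (by simp; linarith))
    have h : 0 < Q ^ (-l) := by positivity
    exact nonneg_of_mul_nonneg_left this h
  have hside : ∀ z : ℂ, l ≤ z.re → z.re ≤ r → nrm p f z ≤ K * Q ^ (-z.re) →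
      ‖G z‖ ≤ K * Real.exp ((r - l) ^ 2) := by
    intro z a b c
    have hn0 := nrm_nonneg p f z
    rw [hGn]
    calc _ ≤ Real.exp ((r - l) ^ 2) * Q ^ z.re * (K * Q ^ (-z.re)) := by
          gcongr
          nlinarith [hsq z a b, sq_nonneg (z.im - z0.im)]
      _ = K * Real.exp ((r - l) ^ 2) * (Q ^ z.re * Q ^ (-z.re)) := by ring
      _ = _ := by rw [← Real.rpow_add hQ0]; simp
  have hfr : ∀ z ∈ frontier U, ‖G z‖ ≤ K * Real.exp ((r - l) ^ 2) := by
    intro z hz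
    rw [hUo.frontier_eq] at hz
    obtain ⟨a, b, c⟩ := hmem z hz.1
    by_cases e1 : z.re = l
    · exact hside z a b (by rw [e1]; exact hl z e1 c)
    by_cases e2 : z.re = r
    · exact hside z a b (by rw [e2]; exact hr z e2 c)
    have e3 : |z.im| = Y := by
      by_contra hne
      apply hz.2
      rw [hU, Complex.mem_reProdIm]
      exact ⟨⟨lt_of_le_of_ne a (Ne.symm e1), lt_of_le_of_ne b e2⟩, abs_lt.mp (lt_of_le_of_ne c hne)⟩
    have e4 := hE z a b e3
    have hn0 := nrm_nonneg p f z
    have hE0 : 0 ≤ E := (nrm_nonneg _ _ _).trans e4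
    rw [hGn]
    have e5 : Y ^ 2 / 4 ≤ (z.im - z0.im) ^ 2 := by
      have : Y / 2 ≤ |z.im - z0.im| := by
        have := abs_sub_abs_le_abs_sub z.im z0.im
        linarith
      rw [← sq_abs (z.im - z0.im)]
      nlinarith
    calc _ ≤ Real.exp ((r - l) ^ 2 + -(Y ^ 2 / 4)) * Q ^ r * E := by
          gcongr
          linarith [hsq z a b]
      _ = (E * Real.exp (-(Y ^ 2 / 4)) * Q ^ r) * Real.exp ((r - l) ^ 2) := by rw [Real.exp_add]; ring
      _ ≤ _ := by gcongr
  have hz0 : z0 ∈ closure U := by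
    rw [hcl, Complex.mem_reProdIm]
    have := abs_le.mp h3
    exact ⟨⟨h1, h2⟩, ⟨by linarith, by linarith⟩⟩
  have key := Complex.norm_le_of_forall_mem_frontier_norm_le hb hdiff hfr hz0
  rw [hGn] at key
  simp only [sub_self] at key
  have hq : 0 < Q ^ z0.re := by positivity
  rw [Real.rpow_neg hQ0.le, ← div_eq_mul_inv, le_div_iff₀ hq]
  simpa [mul_comm] using key

end ZDE

namespace ZDE
open Filter Topology

/-- Dirichlet polynomial -/
noncomputable def DD (N : ℕ) (s : ℂ) : ℂ := ∑ n ∈ Finset.Icc 1 N, (n : ℂ) ^ (-s)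

/-- the constant -/
noncomputable def C2 : ℝ := ∑' n : ℕ, 1 / (n : ℝ) ^ 2

lemma C2_nonneg : 0 ≤ C2 := tsum_nonneg fun n => by positivity

lemma shift_le (K : ℕ) : ∑' n : ℕ, 1 / ((n + K : ℕ) : ℝ) ^ 2 ≤ C2 := by
  have hs : Summable (fun n : ℕ => 1 / (n : ℝ) ^ 2) := Real.summable_one_div_nat_pow.mpr (by norm_num)
  have := hs.sum_add_tsum_nat_add K
  unfold C2
  rw [← this]
  have h2 : 0 ≤ ∑ i ∈ Finset.range K, 1 / (i : ℝ) ^ 2 := Finset.sum_nonneg fun n _ => by positivity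
  linarith

lemma zeta_tail {s : ℂ} (hs : 2 ≤ s.re) {X : ℝ} (hX : 0 < X) :
    ‖riemannZeta s - DD ⌊X⌋₊ s‖ ≤ X ^ (-(s.re - 2)) * C2 := by
  set K := ⌊X⌋₊ with hK
  have h1 : 1 < s.re := by linarith
  have hsum : Summable (fun n : ℕ => 1 / (n : ℂ) ^ s) := Complex.summable_one_div_nat_cpow.mpr h1
  have hs0 : s ≠ 0 := by intro h; rw [h] at h1; simp at h1; linarith
  have e := hsum.sum_add_tsum_nat_add (K + 1)
  rw [← zeta_eq_tsum_one_div_nat_cpow h1] at e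
  have e2 : ∑ i ∈ Finset.range (K + 1), 1 / (i : ℂ) ^ s = DD K s := by
    unfold DD
    rw [Finset.sum_range_succ', Finset.range_eq_Ico]
    have : ∑ n ∈ Finset.Icc 1 K, (n : ℂ) ^ (-s) = ∑ n ∈ Finset.Ico 0 K, ((n + 1 : ℕ) : ℂ) ^ (-s) := by
      rw [Finset.sum_Ico_add' (fun n : ℕ => (n : ℂ) ^ (-s)) 0 K 1]
      rfl
    rw [this]
    simp [Complex.cpow_neg, hs0]
  rw [e2] at e
  rw [← e, add_sub_cancel_left]
  have hsq : Summable (fun n : ℕ => 1 / ((n + (K + 1) : ℕ) : ℝ) ^ 2) :=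
    (summable_nat_add_iff (f := fun n : ℕ => 1 / (n : ℝ) ^ 2) (K + 1)).mpr
      (Real.summable_one_div_nat_pow.mpr (by norm_num))
  refine (tsum_of_norm_bounded (hsq.hasSum.mul_left (X ^ (-(s.re - 2)))) fun i => ?_).trans
    (mul_le_mul_of_nonneg_left (shift_le _) (by positivity))
  have hpos : 0 < i + (K + 1) := by omega
  have hXn : X ≤ ((i + (K + 1) : ℕ) : ℝ) := by
    have := (Nat.lt_floor_add_one X).le
    push_cast
    have : (0 : ℝ) ≤ i := Nat.cast_nonneg i
    linarith
  have hnp : (0 : ℝ) < ((i + (K + 1) : ℕ) : ℝ) := by exact_mod_cast hpos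
  rw [norm_div, norm_one, Complex.norm_natCast_cpow_of_pos hpos, one_div, ← Real.rpow_neg hnp.le]
  set n : ℝ := ((i + (K + 1) : ℕ) : ℝ)
  have e3 : n ^ (-s.re) = n ^ (-(s.re - 2)) * (1 / n ^ 2) := by
    rw [one_div, ← Real.rpow_natCast n 2, ← Real.rpow_neg hnp.le, ← Real.rpow_add hnp]
    congr 1; push_cast; ring
  rw [e3]
  exact mul_le_mul_of_nonneg_right
    (Real.rpow_le_rpow_of_nonpos (z := -(s.re - 2)) hX hXn (by linarith)) (by positivity)

lemma LSm (a : ℝ) {a' : ℝ} (h : a' < a) (ha' : a' ≤ 1) (h0 : 0 < a') :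
    ∀ᶠ T : ℝ in atTop, ∀ I : Finset ℕ, (∀ n ∈ I, 1 ≤ n ∧ (n : ℝ) ≤ T ^ a') →
      ∀ (b : ℕ → ℂ) (z : ℂ),
      nrm (pp a T) (fun s => ∑ n ∈ I, b n * (n : ℂ) ^ (-s)) z ^ 2 ≤
        2 * JJ a T * ∑ n ∈ I, ‖b n‖ ^ 2 * (n : ℝ) ^ (-(2 * z.re)) := by
  filter_upwards [large_sieve_gen a h ha' h0] with T hT I hI b z
  have := hT (-1) (by simp) I hI b z
  have e1 : ∀ s : ℂ, ((-1 : ℝ) : ℂ) * s = -s := fun s => by simp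
  have e2 : 2 * (-1 * z.re) = -(2 * z.re) := by ring
  simpa only [e1, e2] using this

lemma LSp (a : ℝ) {a' : ℝ} (h : a' < a) (ha' : a' ≤ 1) (h0 : 0 < a') :
    ∀ᶠ T : ℝ in atTop, ∀ N : ℕ, (N : ℝ) ≤ T ^ a' → ∀ (z : ℂ),
      nrm (pp a T) (fun s => DD N (1 - s)) z ^ 2 ≤
        2 * JJ a T * ∑ n ∈ Finset.Icc 1 N, (n : ℝ) ^ (2 * z.re - 2) := by
  filter_upwards [large_sieve_gen a h ha' h0] with T hT N hN z
  have := hT 1 (by simp) (Finset.Icc 1 N) (fun n hn => by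
    obtain ⟨h1, h2⟩ := Finset.mem_Icc.mp hn
    exact ⟨h1, le_trans (by exact_mod_cast h2) hN⟩) (fun n => (n : ℂ)⁻¹) z
  have e1 : ∀ s : ℂ, ((1 : ℝ) : ℂ) * s = s := fun s => by simp
  simp only [e1, one_mul] at this
  convert this using 2
  · refine nrm_congr fun j => ?_
    unfold DD
    refine Finset.sum_congr rfl fun n hn => ?_
    have hn0 : (n : ℂ) ≠ 0 := by
      have := (Finset.mem_Icc.mp hn).1
      exact_mod_cast (by omega : n ≠ 0)
    rw [neg_sub, sub_eq_add_neg, add_comm, Complex.cpow_add _ _ hn0, Complex.cpow_neg_one]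
  · refine Finset.sum_congr rfl fun n hn => ?_
    have hn0 : (0 : ℝ) < n := by
      have := (Finset.mem_Icc.mp hn).1
      exact_mod_cast this
    rw [Real.rpow_sub hn0, norm_inv, Complex.norm_natCast]
    norm_num
    field_simp

lemma DD_conj (N : ℕ) (s : ℂ) : DD N ((starRingEnd ℂ) s) = (starRingEnd ℂ) (DD N s) := by
  unfold DD
  rw [map_sum]
  refine Finset.sum_congr rfl fun n _ => ?_
  have h := Complex.cpow_conj (n : ℂ) (-s) (by rw [Complex.natCast_arg]; exact Real.pi_pos.ne)
  simpa using h

lemma DD_diff (N : ℕ) (s : ℂ) : DifferentiableAt ℂ (DD N) s := by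
  unfold DD
  refine DifferentiableAt.fun_sum fun n hn => ?_
  have hn0 : (n : ℂ) ≠ 0 := by
    have := (Finset.mem_Icc.mp hn).1
    exact_mod_cast (by omega : n ≠ 0)
  exact (differentiableAt_id.neg).const_cpow (Or.inl hn0)

lemma DD_norm_le (N A : ℕ) {s : ℂ} (hs : -(A : ℝ) ≤ s.re) : ‖DD N s‖ ≤ (N : ℝ) ^ (A + 1) := by
  unfold DD
  refine (norm_sum_le _ _).trans ?_
  have : ∀ n ∈ Finset.Icc 1 N, ‖(n : ℂ) ^ (-s)‖ ≤ (N : ℝ) ^ A := by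
    intro n hn
    obtain ⟨h1, h2⟩ := Finset.mem_Icc.mp hn
    rw [Complex.norm_natCast_cpow_of_pos h1]
    calc (n : ℝ) ^ (-s).re ≤ (n : ℝ) ^ (A : ℝ) := by
          apply Real.rpow_le_rpow_of_exponent_le
          · exact_mod_cast h1
          · simp; linarith
      _ = (n : ℝ) ^ A := Real.rpow_natCast _ _
      _ ≤ _ := by gcongr
  refine (Finset.sum_le_sum this).trans ?_
  simp [pow_succ, mul_comm]

/-- The error function -/
noncomputable def ff (N : ℕ) (s : ℂ) : ℂ := riemannZeta s - DD N s - chiFun s * DD N (1 - s)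

lemma ff_conj (N : ℕ) (s : ℂ) : ff N ((starRingEnd ℂ) s) = (starRingEnd ℂ) (ff N s) := by
  unfold ff
  have h : 1 - (starRingEnd ℂ) s = (starRingEnd ℂ) (1 - s) := by simp
  rw [riemannZeta_conj, DD_conj, chi_conj, h, DD_conj]
  simp

lemma ff_fe (N : ℕ) {s : ℂ} (h : s.im ≠ 0) : ff N s = chiFun s * ff N (1 - s) := by
  unfold ff
  rw [zeta_fe h, sub_sub_cancel]
  linear_combination DD N s * chi_mul h

end ZDE

namespace ZDE
open Filter Topology

/-- length of the Dirichlet polynomial -/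
noncomputable def NN (T : ℝ) : ℕ := ⌊T ^ (1 / 2 : ℝ)⌋₊

lemma NN_le {T : ℝ} (hT : 1 ≤ T) : (NN T : ℝ) ≤ T ^ (1 / 2 : ℝ) := Nat.floor_le (by positivity)

lemma NN_lt (T : ℝ) : T ^ (1 / 2 : ℝ) < NN T + 1 := Nat.lt_floor_add_one _

lemma NN_pos {T : ℝ} (hT : 1 ≤ T) : 1 ≤ NN T := by
  rw [NN, Nat.one_le_floor_iff]
  exact Real.one_le_rpow hT (by norm_num)

lemma pp_bd {a : ℝ} (ha : a ≤ 1) : ∀ᶠ T : ℝ in atTop, ∀ j : Fin (JJ a T),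
    T ≤ (pp a T j).im ∧ (pp a T j).im ≤ 3 * T := by
  filter_upwards [eventually_ge_atTop 3] with T hT j
  have hl : 0 < Real.log T := Real.log_pos (by linarith)
  have hh0 : 0 < hh T := by unfold hh; positivity
  rw [pp_im]
  have hj : ((j : ℕ) : ℝ) ≤ (T ^ a + 3) * (2 * Real.log T) := by
    have h1 : (j : ℕ) < ⌈(T ^ a + 3) * (2 * Real.log T)⌉₊ := j.2
    exact (Nat.lt_ceil.mp h1).le
  have h2 : ((j : ℕ) : ℝ) * hh T ≤ T ^ a + 3 := by
    unfold hh
    rw [mul_one_div, div_le_iff₀ (by positivity)]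
    exact hj
  have h3 : T ^ a ≤ T := by
    simpa using Real.rpow_le_rpow_of_exponent_le (by linarith : 1 ≤ T) ha
  have : 0 ≤ ((j : ℕ) : ℝ) * hh T := by positivity
  constructor <;> linarith

lemma pp_bd2 {a : ℝ} (ha : a ≤ 1) : ∀ᶠ T : ℝ in atTop, 8 ≤ T ∧ ∀ z : ℂ, |z.im| ≤ T / 4 →
    ∀ j : Fin (JJ a T), T / 2 ≤ (z + pp a T j).im ∧ (z + pp a T j).im ≤ 4 * T ∧
      (z + pp a T j).re = z.re := by
  filter_upwards [pp_bd ha, eventually_ge_atTop 8] with T hT h8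
  refine ⟨h8, fun z hz j => ?_⟩
  have := hT j
  rw [abs_le] at hz
  simp only [Complex.add_im, Complex.add_re, pp_re, add_zero, and_true]
  constructor <;> linarith

lemma nrm_of_sq {J : ℕ} {p : Fin J → ℂ} {f : ℂ → ℂ} {z : ℂ} {S B : ℝ} (hB : 0 ≤ B)
    (h : nrm p f z ^ 2 ≤ 2 * J * S) (hS : S ≤ B ^ 2) : nrm p f z ≤ 2 * √J * B := by
  refine le_of_sq_le_sq ?_ (by positivity)
  rw [mul_pow, mul_pow, Real.sq_sqrt (Nat.cast_nonneg J)]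
  have : 0 ≤ (J : ℝ) * B ^ 2 := by positivity
  have h2 : (2 : ℝ) * J * S ≤ 2 * J * B ^ 2 := by gcongr
  nlinarith

lemma tail_right {a a' : ℝ} (h : a' < a) (ha' : a' ≤ 1) (h0 : 1 / 2 ≤ a') {A : ℕ} (hA1 : 1 ≤ A)
    (hA : 1 / 4 + (A : ℝ) / 2 ≤ a' * (A - 1)) :
    ∃ C : ℝ, 0 < C ∧ ∀ᶠ T : ℝ in atTop, ∀ z : ℂ, z.re = 1 + A →
      nrm (pp a T) (fun s => riemannZeta s - DD (NN T) s) z ≤ C * √(JJ a T) * T ^ (-(1 / 4 + (A : ℝ) / 2)) := by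
  refine ⟨4 + C2, by linarith [C2_nonneg], ?_⟩
  filter_upwards [LSm a h ha' (by linarith), eventually_ge_atTop 1] with T hLS hT z hz
  have hT0 : 0 < T := by linarith
  have hX : 0 < T ^ a' := by positivity
  set N := NN T with hN
  set M := ⌊T ^ a'⌋₊ with hM
  have hNM : N ≤ M := Nat.floor_le_floor (Real.rpow_le_rpow_of_exponent_le hT h0)
  have hN1 := NN_pos hT
  have hNr : (1 : ℝ) ≤ N := by exact_mod_cast hN1
  have e : ∀ s, riemannZeta s - DD N s = (riemannZeta s - DD M s) +
      ∑ n ∈ Finset.Ioc N M, (1 : ℂ) * (n : ℂ) ^ (-s) := by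
    intro s
    have : DD M s = DD N s + ∑ n ∈ Finset.Ioc N M, (1 : ℂ) * (n : ℂ) ^ (-s) := by
      unfold DD
      simp only [one_mul]
      have := Finset.sum_Ioc_consecutive (fun n : ℕ => (n : ℂ) ^ (-s)) (Nat.zero_le N) hNM
      have e0 : ∀ k, Finset.Icc 1 k = Finset.Ioc 0 k := fun k => rfl
      rw [e0, e0, this]
    rw [this]; ring
  simp_rw [e]
  refine (nrm_add_le _ _ _ _).trans ?_
  set β := T ^ (-(1 / 4 + (A : ℝ) / 2)) with hβ
  have hβ0 : 0 ≤ β := by positivity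
  have b1 : nrm (pp a T) (fun s => riemannZeta s - DD M s) z ≤ (C2 * β) * √(JJ a T) := by
    refine nrm_le_const (mul_nonneg C2_nonneg hβ0) fun j => ?_
    have hre : (z + pp a T j).re = 1 + A := by simp [pp_re, hz]
    have hA1' : (1 : ℝ) ≤ A := by exact_mod_cast hA1
    refine (zeta_tail (by rw [hre]; linarith) hX).trans ?_
    rw [mul_comm]
    refine mul_le_mul_of_nonneg_left ?_ C2_nonneg
    rw [hre, ← Real.rpow_mul hT0.le, hβ]
    apply Real.rpow_le_rpow_of_exponent_le hT
    linarith
  have b2 : nrm (pp a T) (fun s => ∑ n ∈ Finset.Ioc N M, (1 : ℂ) * (n : ℂ) ^ (-s)) z ≤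
      2 * √(JJ a T) * (2 * β) := by
    refine nrm_of_sq (by positivity) (hLS _ (fun n hn => ?_) (fun _ => 1) z) ?_
    · obtain ⟨h1, h2⟩ := Finset.mem_Ioc.mp hn
      exact ⟨by omega, le_trans (by exact_mod_cast h2) (Nat.floor_le hX.le)⟩
    · have hs : ∀ n ∈ Finset.Ioc N M, ‖(1 : ℂ)‖ ^ 2 * (n : ℝ) ^ (-(2 * z.re)) ≤
          T ^ (-(A : ℝ)) * ((n : ℝ) ^ 2)⁻¹ := by
        intro n hn
        obtain ⟨h1, h2⟩ := Finset.mem_Ioc.mp hn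
        have hn0 : (0 : ℝ) < n := by exact_mod_cast (by omega : 0 < n)
        have hTn : T ^ (1 / 2 : ℝ) ≤ n := by
          have : ((N : ℝ) + 1) ≤ n := by exact_mod_cast h1
          exact (NN_lt T).le.trans this
        have e3 : (n : ℝ) ^ (-(2 * z.re)) = (n : ℝ) ^ (-(2 * (A : ℝ))) * ((n : ℝ) ^ 2)⁻¹ := by
          rw [← Real.rpow_natCast (n : ℝ) 2, ← Real.rpow_neg hn0.le, ← Real.rpow_add hn0, hz]
          congr 1; push_cast; ring
        have e4 : T ^ (-(A : ℝ)) = (T ^ (1 / 2 : ℝ)) ^ (-(2 * (A : ℝ))) := by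
          rw [← Real.rpow_mul hT0.le]; congr 1; ring
        rw [e3, e4, norm_one, one_pow, one_mul]
        refine mul_le_mul_of_nonneg_right ?_ (by positivity)
        exact Real.rpow_le_rpow_of_nonpos (by positivity) hTn
          (by have : (0 : ℝ) ≤ A := Nat.cast_nonneg A
              linarith)
      refine (Finset.sum_le_sum hs).trans ?_
      rw [← Finset.mul_sum]
      have h5 := sum_Ioc_inv_sq_le_sub (α := ℝ) (k := N) (n := M) (by omega) hNM
      have h6 : (N : ℝ)⁻¹ - (M : ℝ)⁻¹ ≤ 2 * T ^ (-(1 / 2) : ℝ) := by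
        have : (N : ℝ)⁻¹ ≤ 2 * T ^ (-(1 / 2) : ℝ) := by
          rw [Real.rpow_neg hT0.le, inv_le_comm₀ (by positivity) (by positivity), mul_inv, inv_inv]
          have := NN_lt T
          rw [← hN] at this
          linarith
        have h7 : 0 ≤ (M : ℝ)⁻¹ := by positivity
        linarith
      calc T ^ (-(A : ℝ)) * ∑ n ∈ Finset.Ioc N M, ((n : ℝ) ^ 2)⁻¹
          ≤ T ^ (-(A : ℝ)) * (2 * T ^ (-(1 / 2) : ℝ)) :=
            mul_le_mul_of_nonneg_left (h5.trans h6) (by positivity)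
        _ = 2 * β ^ 2 := by
            rw [hβ, ← Real.rpow_natCast _ 2, ← Real.rpow_mul hT0.le, mul_left_comm,
              ← Real.rpow_add hT0]
            congr 2; push_cast; ring
        _ ≤ (2 * β) ^ 2 := by nlinarith [sq_nonneg β]
  calc _ ≤ _ := add_le_add b1 b2
    _ = _ := by ring

lemma refl_right {a : ℝ} (h : 1 / 2 < a) (ha : a ≤ 1) (A : ℕ) :
    ∃ C : ℝ, 0 < C ∧ ∀ᶠ T : ℝ in atTop, ∀ z : ℂ, z.re = 1 + A → |z.im| ≤ T / 4 →
      nrm (pp a T) (fun s => chiFun s * DD (NN T) (1 - s)) z ≤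
        C * √(JJ a T) * T ^ (-(1 / 4 + (A : ℝ) / 2)) := by
  obtain ⟨c, C, hc, hC, hχ⟩ := chi_right A
  refine ⟨c⁻¹ * 2 ^ ((A : ℝ) + 1 / 2) * 2, by positivity, ?_⟩
  filter_upwards [LSp a h (by norm_num) (by norm_num), pp_bd2 ha] with T hLS ⟨hT, hb⟩ z hz hz2
  have hT0 : 0 < T := by linarith
  have h1 : nrm (pp a T) (fun s => DD (NN T) (1 - s)) z ≤ 2 * √(JJ a T) * T ^ (1 / 4 + (A : ℝ) / 2) := by
    refine nrm_of_sq (by positivity) (hLS (NN T) (NN_le (by linarith)) z) ?_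
    have hs : ∀ n ∈ Finset.Icc 1 (NN T), (n : ℝ) ^ (2 * z.re - 2) ≤ (T ^ (1 / 2 : ℝ)) ^ (2 * (A : ℝ)) := by
      intro n hn
      obtain ⟨h1, h2⟩ := Finset.mem_Icc.mp hn
      have e1 : 2 * z.re - 2 = 2 * (A : ℝ) := by rw [hz]; ring
      rw [e1]
      refine Real.rpow_le_rpow (by positivity) ?_ (by positivity)
      exact le_trans (by exact_mod_cast h2) (NN_le (by linarith))
    refine (Finset.sum_le_sum hs).trans ?_
    rw [Finset.sum_const, Nat.card_Icc, Nat.add_sub_cancel, nsmul_eq_mul]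
    calc (NN T : ℝ) * (T ^ (1 / 2 : ℝ)) ^ (2 * (A : ℝ)) ≤ T ^ (1 / 2 : ℝ) * (T ^ (1 / 2 : ℝ)) ^ (2 * (A : ℝ)) := by
          gcongr; exact NN_le (by linarith)
      _ = _ := by
          rw [← Real.rpow_mul hT0.le, ← Real.rpow_natCast _ 2, ← Real.rpow_mul hT0.le,
              ← Real.rpow_add hT0]
          congr 1; push_cast; ring
  have h2 : nrm (pp a T) (fun s => chiFun s * DD (NN T) (1 - s)) z ≤
      (c⁻¹ * 2 ^ ((A : ℝ) + 1 / 2) * T ^ (-((A : ℝ) + 1 / 2))) * nrm (pp a T) (fun s => DD (NN T) (1 - s)) z := by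
    refine nrm_le_mul (by positivity) fun j => ?_
    rw [norm_mul]
    refine mul_le_mul_of_nonneg_right ?_ (norm_nonneg _)
    obtain ⟨b1, b2, b3⟩ := hb z hz2 j
    have h3 := (hχ (z + pp a T j) (by rw [b3, hz]) (by linarith)).1
    have h4 : c * (T / 2) ^ ((A : ℝ) + 1 / 2) ≤ ‖chiFun (z + pp a T j)‖⁻¹ := by
      refine le_trans ?_ h3
      gcongr
    have h5 := inv_anti₀ (by positivity) h4
    rw [inv_inv] at h5
    refine h5.trans (le_of_eq ?_)
    rw [Real.div_rpow hT0.le (by norm_num), Real.rpow_neg hT0.le]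
    field_simp
  refine h2.trans ((mul_le_mul_of_nonneg_left h1 (by positivity)).trans (le_of_eq ?_))
  have e5 : T ^ (-((A : ℝ) + 1 / 2)) * T ^ (1 / 4 + (A : ℝ) / 2) = T ^ (-(1 / 4 + (A : ℝ) / 2)) := by
    rw [← Real.rpow_add hT0]; congr 1; ring
  rw [← e5]; ring

lemma edge_small (C : ℝ) (m : ℕ) : ∀ᶠ T : ℝ in atTop,
    C * Real.exp (Real.pi * (4 * T)) * T ^ m * Real.exp (-((T / 4) ^ 2 / 4)) ≤ 1 := by
  filter_upwards [eventually_ge_atTop (64 * (4 * Real.pi + m + 1)), eventually_ge_atTop 1,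
    Real.tendsto_exp_atTop.eventually_ge_atTop C] with T h1 h2 h3
  have hTm : T ^ m ≤ Real.exp (m * T) := by
    rw [Real.exp_nat_mul]
    exact pow_le_pow_left₀ (by linarith) (by linarith [Real.add_one_le_exp T]) m
  calc C * Real.exp (Real.pi * (4 * T)) * T ^ m * Real.exp (-((T / 4) ^ 2 / 4))
      ≤ Real.exp T * Real.exp (Real.pi * (4 * T)) * Real.exp (m * T) * Real.exp (-((T / 4) ^ 2 / 4)) := by
        gcongr
    _ = Real.exp (T + Real.pi * (4 * T) + m * T + -((T / 4) ^ 2 / 4)) := by simp only [Real.exp_add]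
    _ ≤ 1 := by
        rw [Real.exp_le_one_iff]
        nlinarith

lemma conj_pt {a T : ℝ} (z : ℂ) (j : Fin (JJ a T)) :
    1 - (starRingEnd ℂ) (z + pp a T j) = (1 - (starRingEnd ℂ) z) + pp a T j := by
  simp [pp]; ring

lemma ff_left {a a' : ℝ} (h : a' < a) (ha : a ≤ 1) (h0 : 1 / 2 ≤ a') {A : ℕ} (hA1 : 1 ≤ A)
    (hA : 1 / 4 + (A : ℝ) / 2 ≤ a' * (A - 1)) :
    ∃ C : ℝ, 0 < C ∧ ∀ᶠ T : ℝ in atTop,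
      (∀ z : ℂ, z.re = 1 + A → |z.im| ≤ T / 4 →
        nrm (pp a T) (fun s => chiFun s * DD (NN T) (1 - s)) z ≤
          C * √(JJ a T) * T ^ (-(1 / 4 + (A : ℝ) / 2))) ∧
      (∀ z : ℂ, z.re = 1 + A → |z.im| ≤ T / 4 →
        nrm (pp a T) (ff (NN T)) z ≤ C * √(JJ a T) * T ^ (-(1 / 4 + (A : ℝ) / 2))) ∧
      (∀ z : ℂ, z.re = -A → |z.im| ≤ T / 4 →
        nrm (pp a T) (ff (NN T)) z ≤ C * √(JJ a T) * T ^ (1 / 4 + (A : ℝ) / 2)) := by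
  obtain ⟨C1, hC1, k1⟩ := tail_right h (by linarith) h0 hA1 hA
  obtain ⟨C2, hC2, k2⟩ := refl_right (a := a) (by linarith) ha A
  obtain ⟨c, C3, hc, hC3, hχ⟩ := chi_right A
  have hR : ∀ᶠ T : ℝ in atTop, ∀ z : ℂ, z.re = 1 + A → |z.im| ≤ T / 4 →
        nrm (pp a T) (ff (NN T)) z ≤ (C1 + C2) * √(JJ a T) * T ^ (-(1 / 4 + (A : ℝ) / 2)) := by
    filter_upwards [k1, k2] with T k1 k2 z hz hz2
    have e : ff (NN T) = fun s => (riemannZeta s - DD (NN T) s) + (- (chiFun s * DD (NN T) (1 - s))) := by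
      funext s; unfold ff; ring
    rw [e]
    refine (nrm_add_le _ _ _ _).trans ?_
    have h3 : nrm (pp a T) (fun s => - (chiFun s * DD (NN T) (1 - s))) z ≤
        nrm (pp a T) (fun s => (chiFun s * DD (NN T) (1 - s))) z := nrm_mono fun j => by rw [norm_neg]
    have h4 := k1 z hz
    have h5 := k2 z hz hz2
    linarith
  refine ⟨C1 + C2 + C3 * 4 ^ ((A : ℝ) + 1 / 2) * (C1 + C2), by positivity, ?_⟩
  have hCC : 0 ≤ C3 * 4 ^ ((A : ℝ) + 1 / 2) * (C1 + C2) := by positivity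
  filter_upwards [k2, hR, pp_bd2 ha] with T k2 hR ⟨hT, hb⟩
  have hT0 : 0 < T := by linarith
  refine ⟨fun z hz hz2 => (k2 z hz hz2).trans ?_, fun z hz hz2 => (hR z hz hz2).trans ?_, fun z hz hz2 => ?_⟩
  · exact mul_le_mul_of_nonneg_right (mul_le_mul_of_nonneg_right (by linarith) (by positivity)) (by positivity)
  · exact mul_le_mul_of_nonneg_right (mul_le_mul_of_nonneg_right (by linarith) (by positivity)) (by positivity)
  · set w := 1 - (starRingEnd ℂ) z with hw
    have hwre : w.re = 1 + A := by simp [hw, hz]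
    have hwim : |w.im| ≤ T / 4 := by simpa [hw] using hz2
    have h1 : nrm (pp a T) (ff (NN T)) z ≤ (C3 * (4 * T) ^ ((A : ℝ) + 1 / 2)) * nrm (pp a T) (ff (NN T)) w := by
      unfold nrm
      have hp : ∀ j, ‖ff (NN T) (z + pp a T j)‖ ≤ (C3 * (4 * T) ^ ((A : ℝ) + 1 / 2)) * ‖ff (NN T) (w + pp a T j)‖ := by
        intro j
        obtain ⟨b1, b2, b3⟩ := hb w hwim j
        have hne : (w + pp a T j).im ≠ 0 := by linarith
        set s := w + pp a T j with hs
        have e1 : z + pp a T j = (starRingEnd ℂ) (1 - s) := by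
          have := conj_pt z j
          rw [← hw, ← hs] at this
          rw [← this]; simp
        rw [e1, ff_conj, Complex.norm_conj, ff_fe (NN T) (im_one_sub hne), sub_sub_cancel, norm_mul]
        refine mul_le_mul_of_nonneg_right ?_ (norm_nonneg _)
        have e2 := congrArg norm (chi_mul hne)
        rw [norm_mul, norm_one] at e2
        rw [eq_inv_of_mul_eq_one_right e2]
        refine (hχ s (by rw [b3, hwre]) (by linarith)).2.trans ?_
        gcongr
        linarith
      have := nrm_le_mul (p := pp a T) (z := (0 : ℂ)) (f := fun s => ff (NN T) (z + s))
        (g := fun s => ff (NN T) (w + s)) (δ := C3 * (4 * T) ^ ((A : ℝ) + 1 / 2)) (by positivity)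
        (fun j => by simpa using hp j)
      simpa [nrm, vec] using this
    refine h1.trans ((mul_le_mul_of_nonneg_left (hR w hwre hwim) (by positivity)).trans ?_)
    have e5 : T ^ ((A : ℝ) + 1 / 2) * T ^ (-(1 / 4 + (A : ℝ) / 2)) = T ^ (1 / 4 + (A : ℝ) / 2) := by
      rw [← Real.rpow_add hT0]; congr 1; ring
    rw [Real.mul_rpow (by norm_num) hT0.le, ← e5]
    have : 0 ≤ (C1 + C2) * √(JJ a T) * (T ^ ((A : ℝ) + 1 / 2) * T ^ (-(1 / 4 + (A : ℝ) / 2))) := by positivity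
    nlinarith

end ZDE

namespace ZDE
open Filter Topology

lemma harm_le (N : ℕ) : ∑ n ∈ Finset.Icc 1 N, (n : ℝ) ^ (-1 : ℝ) ≤ 1 + Real.log N := by
  have h := harmonic_le_one_add_log N
  rw [harmonic_eq_sum_Icc] at h
  push_cast at h
  simpa [Real.rpow_neg_one] using h

lemma refl_half {a : ℝ} (h : 1 / 2 < a) (ha : a ≤ 1) :
    ∀ᶠ T : ℝ in atTop, ∀ z : ℂ, z.re = 1 / 2 → |z.im| ≤ T / 4 →
      nrm (pp a T) (fun s => chiFun s * DD (NN T) (1 - s)) z ≤ 2 * √(JJ a T) * (1 + Real.log T) := by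
  filter_upwards [LSp a h (by norm_num) (by norm_num), pp_bd2 ha] with T hLS ⟨hT, hb⟩ z hz hz2
  have hT0 : 0 < T := by linarith
  have hl : 0 ≤ Real.log T := Real.log_nonneg (by linarith)
  have h2 : nrm (pp a T) (fun s => chiFun s * DD (NN T) (1 - s)) z ≤ nrm (pp a T) (fun s => DD (NN T) (1 - s)) z := by
    refine nrm_mono fun j => ?_
    obtain ⟨b1, b2, b3⟩ := hb z hz2 j
    rw [norm_mul, chi_half (by linarith) (by rw [b3, hz]), one_mul]
  refine h2.trans (nrm_of_sq (by linarith) (hLS (NN T) (NN_le (by linarith)) z) ?_)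
  have e : 2 * z.re - 2 = -1 := by rw [hz]; norm_num
  rw [e]
  refine (harm_le _).trans ?_
  have h3 : Real.log (NN T) ≤ Real.log T := by
    have hN : (1 : ℝ) ≤ NN T := by exact_mod_cast NN_pos (by linarith : 1 ≤ T)
    refine Real.log_le_log (by linarith) ((NN_le (by linarith)).trans ?_)
    simpa using Real.rpow_le_rpow_of_exponent_le (by linarith : 1 ≤ T) (by norm_num : (1 / 2 : ℝ) ≤ 1)
  nlinarith

lemma edge_bd {a : ℝ} (ha : a ≤ 1) (A : ℕ) : ∃ C : ℝ, 0 < C ∧ ∀ᶠ T : ℝ in atTop,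
    ∀ z : ℂ, -(A : ℝ) ≤ z.re → z.re ≤ 1 + A → |z.im| ≤ T / 4 →
      nrm (pp a T) (fun s => chiFun s * DD (NN T) (1 - s)) z ≤
        C * Real.exp (Real.pi * (4 * T)) * T ^ (A + 2) * √(JJ a T) ∧
      nrm (pp a T) (ff (NN T)) z ≤ C * Real.exp (Real.pi * (4 * T)) * T ^ (A + 2) * √(JJ a T) := by
  obtain ⟨C1, h1, k1⟩ := chi_crude (A + 1)
  obtain ⟨C2, h2, k2⟩ := zeta_crude (A + 1)
  refine ⟨C2 + 1 + C1, by positivity, ?_⟩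
  filter_upwards [pp_bd2 ha] with T ⟨hT, hb⟩ z hz1 hz2 hz3
  have hT0 : 0 < T := by linarith
  have hN : (NN T : ℝ) ^ (A + 2) ≤ T ^ (A + 2) := by
    refine pow_le_pow_left₀ (by positivity) ((NN_le (by linarith)).trans ?_) _
    simpa using Real.rpow_le_rpow_of_exponent_le (by linarith : 1 ≤ T) (by norm_num : (1 / 2 : ℝ) ≤ 1)
  have hN1 : (NN T : ℝ) ^ (A + 1) ≤ (NN T : ℝ) ^ (A + 2) :=
    pow_le_pow_right₀ (by exact_mod_cast NN_pos (by linarith : 1 ≤ T)) (by omega)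
  have hT1 : 1 ≤ T ^ (A + 2) := one_le_pow₀ (by linarith)
  set X := Real.exp (Real.pi * (4 * T)) with hX
  have hX1 : 1 ≤ X := Real.one_le_exp (by have := Real.pi_pos; positivity)
  have hpt : ∀ j, ‖chiFun (z + pp a T j) * DD (NN T) (1 - (z + pp a T j))‖ ≤ C1 * X * T ^ (A + 2) ∧
      ‖riemannZeta (z + pp a T j)‖ ≤ C2 * X * T ^ (A + 2) ∧ ‖DD (NN T) (z + pp a T j)‖ ≤ X * T ^ (A + 2) := by
    intro j
    obtain ⟨b1, b2, b3⟩ := hb z hz3 j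
    set s := z + pp a T j
    have habs : |s.re| ≤ ((A + 1 : ℕ) : ℝ) := by
      rw [b3, abs_le]; push_cast; constructor <;> linarith
    have him : |s.im| = s.im := abs_of_nonneg (by linarith)
    have hexp : Real.exp (Real.pi * |s.im|) ≤ X := by
      rw [him]; exact Real.exp_le_exp.mpr (mul_le_mul_of_nonneg_left b2 Real.pi_pos.le)
    have d1 : ‖DD (NN T) (1 - s)‖ ≤ T ^ (A + 2) :=
      ((DD_norm_le (NN T) A (by simp [b3]; linarith)).trans hN1).trans hN
    have d2 : ‖DD (NN T) s‖ ≤ T ^ (A + 2) :=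
      ((DD_norm_le (NN T) A (by rw [b3]; linarith)).trans hN1).trans hN
    have c1 := (k1 s habs (by rw [him]; linarith)).trans (mul_le_mul_of_nonneg_left hexp h1.le)
    have c2 := (k2 s habs (by rw [him]; linarith)).trans (mul_le_mul_of_nonneg_left hexp h2.le)
    refine ⟨?_, ?_, ?_⟩
    · rw [norm_mul]; gcongr
    · calc _ ≤ C2 * X * 1 := by rw [mul_one]; exact c2
        _ ≤ _ := by gcongr
    · calc _ ≤ 1 * T ^ (A + 2) := by rw [one_mul]; exact d2
        _ ≤ _ := by gcongr
  have p1 : 0 ≤ C1 * X * T ^ (A + 2) := by positivity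
  have p2 : 0 ≤ C2 * X * T ^ (A + 2) := by positivity
  have p3 : 0 ≤ X * T ^ (A + 2) := by positivity
  constructor
  · refine nrm_le_const (by positivity) fun j => (hpt j).1.trans ?_
    linarith
  · refine nrm_le_const (by positivity) fun j => ?_
    obtain ⟨q1, q2, q3⟩ := hpt j
    unfold ff
    refine (norm_sub_le _ _).trans ((add_le_add_left (norm_sub_le _ _) _).trans ?_)
    linarith

lemma zeta_D {a a' : ℝ} (h : a' < a) (ha : a ≤ 1) (h0 : 1 / 2 ≤ a') {A : ℕ} (hA1 : 1 ≤ A)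
    (hA : 1 / 4 + (A : ℝ) / 2 ≤ a' * (A - 1)) :
    ∃ C : ℝ, 0 < C ∧ ∀ᶠ T : ℝ in atTop, ∀ z : ℂ, 1 / 2 ≤ z.re → z.re ≤ 1 + A → |z.im| ≤ T / 8 →
      nrm (pp a T) (fun s => riemannZeta s - DD (NN T) s) z ≤
        C * (1 + Real.log T) * √(JJ a T) * T ^ (1 / 4 - z.re / 2) := by
  obtain ⟨C1, hC1, k1⟩ := ff_left h ha h0 hA1 hA
  obtain ⟨C2, hC2, k2⟩ := edge_bd (a := a) ha A
  have hA0 : (0 : ℝ) ≤ A := Nat.cast_nonneg A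
  refine ⟨(C1 + 2) * Real.exp ((1 + A - -(A : ℝ)) ^ 2) + (C1 + 2) * Real.exp ((1 + A - 1 / 2 : ℝ) ^ 2), by positivity, ?_⟩
  filter_upwards [k1, k2, refl_half (a := a) (by linarith) ha, edge_small C2 (A + 2 + (A + 1)), pp_bd2 ha] with
    T ⟨kg, kr, kl⟩ k2 kh ke ⟨hT, hb⟩ z hz1 hz2 hz3
  have hT0 : 0 < T := by linarith
  have hl : 0 ≤ Real.log T := Real.log_nonneg (by linarith)
  set Q : ℝ := T ^ (1 / 2 : ℝ) with hQ
  have hQ1 : 1 ≤ Q := Real.one_le_rpow (by linarith) (by norm_num)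
  have hQp : ∀ x : ℝ, Q ^ x = T ^ (x / 2) := fun x => by
    rw [hQ, ← Real.rpow_mul hT0.le]; congr 1; ring
  set S := √(JJ a T) with hS
  have hS0 : 0 ≤ S := Real.sqrt_nonneg _
  set K := (C1 + 2) * (1 + Real.log T) * S * T ^ (1 / 4 : ℝ) with hK
  set E := C2 * Real.exp (Real.pi * (4 * T)) * T ^ (A + 2) * S with hE
  have hK1 : ∀ x : ℝ, C1 * S * T ^ (1 / 4 - x / 2) ≤ K * Q ^ (-x) := by
    intro x
    have : T ^ (1 / 4 - x / 2) = T ^ (1 / 4 : ℝ) * Q ^ (-x) := by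
      rw [hQp, ← Real.rpow_add hT0]; congr 1; ring
    rw [this, hK]
    have h3 : 0 ≤ S * (T ^ (1 / 4 : ℝ) * Q ^ (-x)) := by positivity
    nlinarith [mul_nonneg hl h3, mul_nonneg hC1.le (mul_nonneg hl h3)]
  have hEK : E * Real.exp (-((T / 4) ^ 2 / 4)) * Q ^ (1 + (A : ℝ)) ≤ K := by
    have h1 : Q ^ (1 + (A : ℝ)) ≤ T ^ (A + 1) := by
      rw [hQp, ← Real.rpow_natCast]
      apply Real.rpow_le_rpow_of_exponent_le (by linarith)
      push_cast; linarith
    have h2 : 1 ≤ (C1 + 2) * (1 + Real.log T) * T ^ (1 / 4 : ℝ) := by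
      have : 1 ≤ T ^ (1 / 4 : ℝ) := Real.one_le_rpow (by linarith) (by norm_num)
      have h5 : 1 ≤ (C1 + 2) * (1 + Real.log T) := by nlinarith
      nlinarith
    calc E * Real.exp (-((T / 4) ^ 2 / 4)) * Q ^ (1 + (A : ℝ))
        ≤ E * Real.exp (-((T / 4) ^ 2 / 4)) * T ^ (A + 1) := by gcongr
      _ = (C2 * Real.exp (Real.pi * (4 * T)) * T ^ (A + 2 + (A + 1)) * Real.exp (-((T / 4) ^ 2 / 4))) * S := by
          rw [hE]; ring
      _ ≤ 1 * S := by gcongr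
      _ ≤ ((C1 + 2) * (1 + Real.log T) * T ^ (1 / 4 : ℝ)) * S := by gcongr
      _ = K := by rw [hK]; ring
  have hdg : ∀ z : ℂ, |z.im| ≤ T / 4 → ∀ j, DifferentiableAt ℂ (fun s => chiFun s * DD (NN T) (1 - s)) (z + pp a T j) := by
    intro z hz j
    obtain ⟨b1, -, -⟩ := hb z hz j
    refine (chi_diff (by linarith)).mul ?_
    exact (DD_diff (NN T) _).comp (z + pp a T j) (f := fun s => 1 - s) (by fun_prop)
  have hdf : ∀ z : ℂ, |z.im| ≤ T / 4 → ∀ j, DifferentiableAt ℂ (ff (NN T)) (z + pp a T j) := by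
    intro z hz j
    obtain ⟨b1, -, -⟩ := hb z hz j
    exact ((zeta_diff (by linarith)).sub (DD_diff _ _)).sub (hdg z hz j)
  have hre1 : -(1 / 4 + (A : ℝ) / 2) = 1 / 4 - (1 + A) / 2 := by ring
  have hre2 : (1 / 4 + (A : ℝ) / 2) = 1 / 4 - (-A) / 2 := by ring
  have B1 : nrm (pp a T) (ff (NN T)) z ≤ K * Real.exp ((1 + A - -(A : ℝ)) ^ 2) * Q ^ (-z.re) := by
    refine three_lines (Y := T / 4) (E := E) (by linarith) (by linarith) hQ1 (fun w _ _ hw j => hdf w hw j)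
      (fun w hw hw2 => ?_) (fun w hw hw2 => ?_) (fun w hw hw2 hw3 => (k2 w hw hw2 hw3.le).2) hEK z
      (by linarith) hz2 (by linarith)
    · refine (kl w hw hw2).trans ?_
      rw [hre2]; exact hK1 _
    · refine (kr w hw hw2).trans ?_
      rw [hre1]; exact hK1 _
  have B2 : nrm (pp a T) (fun s => chiFun s * DD (NN T) (1 - s)) z ≤
      K * Real.exp ((1 + A - 1 / 2 : ℝ) ^ 2) * Q ^ (-z.re) := by
    refine three_lines (Y := T / 4) (E := E) (by linarith) (by linarith) hQ1 (fun w _ _ hw j => hdg w hw j)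
      (fun w hw hw2 => ?_) (fun w hw hw2 => ?_) (fun w hw hw2 hw3 => (k2 w (by linarith) hw2 hw3.le).1) hEK z
      (by linarith) hz2 (by linarith)
    · refine (kh w hw hw2).trans ?_
      have e : T ^ (1 / 4 : ℝ) * Q ^ (-(1 / 2) : ℝ) = 1 := by
        rw [hQp, ← Real.rpow_add hT0]; norm_num
      rw [hK, mul_assoc _ (T ^ (1 / 4 : ℝ)), e]
      have : 0 ≤ (1 + Real.log T) * S := by positivity
      nlinarith [mul_nonneg hC1.le this]
    · refine (kg w hw hw2).trans ?_
      rw [hre1]; exact hK1 _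
  have e : (fun s => riemannZeta s - DD (NN T) s) = fun s => ff (NN T) s + chiFun s * DD (NN T) (1 - s) := by
    funext s; unfold ff; ring
  rw [e]
  refine (nrm_add_le _ _ _ _).trans ((add_le_add B1 B2).trans (le_of_eq ?_))
  have : T ^ (1 / 4 - z.re / 2) = T ^ (1 / 4 : ℝ) * Q ^ (-z.re) := by
    rw [hQp, ← Real.rpow_add hT0]; congr 1; ring
  rw [this, hK]; ring

end ZDE

namespace ZDE
open Filter Topology

lemma zeta_D_small {a : ℝ} (h : 1 / 2 < a) (ha : a ≤ 1) {σ1 : ℝ} (hσ : 1 / 2 < σ1) (B1 : ℝ) {δ : ℝ} (hδ : 0 < δ) :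
    ∀ᶠ T : ℝ in atTop, ∀ z : ℂ, σ1 ≤ z.re → z.re ≤ B1 → |z.im| ≤ T / 8 →
      nrm (pp a T) (fun s => riemannZeta s - DD (NN T) s) z ≤ δ * √(JJ a T) := by
  obtain ⟨a', h1, h2⟩ := exists_between h
  obtain ⟨A, hA⟩ := exists_nat_ge (max B1 (max 1 ((1 / 4 + a') / (a' - 1 / 2))))
  have hA1 : (1 : ℝ) ≤ A := ((le_max_left _ _).trans (le_max_right _ _)).trans hA
  have hA2 : (1 / 4 + a') / (a' - 1 / 2) ≤ A := ((le_max_right _ _).trans (le_max_right _ _)).trans hA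
  have hA3 : B1 ≤ A := (le_max_left _ _).trans hA
  rw [div_le_iff₀ (by linarith)] at hA2
  obtain ⟨C, hC, k⟩ := zeta_D (A := A) h2 ha h1.le (by exact_mod_cast hA1) (by linarith)
  filter_upwards [k, log_le_pow (b := σ1 / 2 - 1 / 4) (C := C / δ) (by linarith), eventually_ge_atTop 1] with
    T k1 k2 hT z hz1 hz2 hz3
  have hT0 : 0 < T := by linarith
  refine (k1 z (by linarith) (by linarith) hz3).trans ?_
  have hl := Real.log_nonneg hT
  have e1 : T ^ (1 / 4 - z.re / 2) ≤ T ^ (-(σ1 / 2 - 1 / 4)) :=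
    Real.rpow_le_rpow_of_exponent_le hT (by linarith)
  have e2 : C * (1 + Real.log T) ≤ δ * T ^ (σ1 / 2 - 1 / 4) := by
    rw [div_mul_eq_mul_div, div_le_iff₀ hδ] at k2
    linarith
  calc C * (1 + Real.log T) * √(JJ a T) * T ^ (1 / 4 - z.re / 2)
      ≤ (δ * T ^ (σ1 / 2 - 1 / 4)) * √(JJ a T) * T ^ (-(σ1 / 2 - 1 / 4)) := by gcongr
    _ = δ * √(JJ a T) * (T ^ (σ1 / 2 - 1 / 4) * T ^ (-(σ1 / 2 - 1 / 4))) := by ring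
    _ = _ := by rw [← Real.rpow_add hT0]; simp

/-- tail -/
noncomputable def tl (σ : ℝ) (K : ℕ) : ℝ := ∑' n : ℕ, ((n + K : ℕ) : ℝ) ^ (-(2 * σ))

lemma tl_nonneg (σ : ℝ) (K : ℕ) : 0 ≤ tl σ K := tsum_nonneg fun n => by positivity

lemma summ {σ : ℝ} (hσ : 1 / 2 < σ) : Summable (fun n : ℕ => (n : ℝ) ^ (-(2 * σ))) :=
  Real.summable_nat_rpow.mpr (by linarith)

lemma tl_tendsto (σ : ℝ) : Tendsto (tl σ) atTop (𝓝 0) :=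
  tendsto_sum_nat_add fun n : ℕ => (n : ℝ) ^ (-(2 * σ))

lemma sum_le_tl {σ : ℝ} (hσ : 1 / 2 < σ) (K : ℕ) (I : Finset ℕ) (hI : ∀ n ∈ I, K ≤ n) :
    ∑ n ∈ I, (n : ℝ) ^ (-(2 * σ)) ≤ tl σ K := by
  have h := (summ hσ).sum_add_tsum_nat_add K
  have hd : Disjoint (Finset.range K) I := by
    rw [Finset.disjoint_left]
    intro n hn hn2
    have := hI n hn2
    have := Finset.mem_range.mp hn
    omega
  have h2 := (summ hσ).sum_le_tsum (Finset.range K ∪ I) (fun n _ => by positivity)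
  rw [Finset.sum_union hd, ← h] at h2
  unfold tl
  linarith

lemma pow_mono_re {n : ℕ} (hn : 1 ≤ n) {σ x : ℝ} (h : σ ≤ x) : (n : ℝ) ^ (-(2 * x)) ≤ (n : ℝ) ^ (-(2 * σ)) :=
  Real.rpow_le_rpow_of_exponent_le (by exact_mod_cast hn) (by linarith)

lemma zeta_nrm {a : ℝ} (h : 1 / 2 < a) (ha : a ≤ 1) {σ1 : ℝ} (hσ : 1 / 2 < σ1) (B1 : ℝ) :
    ∃ C : ℝ, 0 < C ∧ ∀ᶠ T : ℝ in atTop, ∀ z : ℂ, σ1 ≤ z.re → z.re ≤ B1 → |z.im| ≤ T / 8 →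
      nrm (pp a T) riemannZeta z ≤ C * √(JJ a T) := by
  refine ⟨1 + 2 * √(tl σ1 1), by positivity, ?_⟩
  filter_upwards [zeta_D_small h ha hσ B1 one_pos, LSm a h (by norm_num) (by norm_num), eventually_ge_atTop 1]
    with T h1 h2 hT z hz1 hz2 hz3
  have e : nrm (pp a T) riemannZeta z = nrm (pp a T) (fun s => (riemannZeta s - DD (NN T) s) +
      ∑ n ∈ Finset.Icc 1 (NN T), (1 : ℂ) * (n : ℂ) ^ (-s)) z := nrm_congr fun j => by simp [DD]
  rw [e]
  refine (nrm_add_le _ _ _ _).trans ?_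
  have h3 := h1 z hz1 hz2 hz3
  have h4 : nrm (pp a T) (fun s => ∑ n ∈ Finset.Icc 1 (NN T), (1 : ℂ) * (n : ℂ) ^ (-s)) z ≤
      2 * √(JJ a T) * √(tl σ1 1) := by
    refine nrm_of_sq (by positivity) (h2 _ (fun n hn => ?_) (fun _ => 1) z) ?_
    · obtain ⟨h1, h2⟩ := Finset.mem_Icc.mp hn
      exact ⟨h1, le_trans (by exact_mod_cast h2) (NN_le hT)⟩
    · rw [Real.sq_sqrt (tl_nonneg _ _)]
      refine le_trans (Finset.sum_le_sum fun n hn => ?_) (sum_le_tl hσ 1 (Finset.Icc 1 (NN T))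
        fun n hn => (Finset.mem_Icc.mp hn).1)
      rw [norm_one, one_pow, one_mul]
      exact pow_mono_re (Finset.mem_Icc.mp hn).1 hz1
  linarith

/-- mollifier -/
noncomputable def MM (Q : ℕ) (s : ℂ) : ℂ := ∑ d ∈ Q.divisors, (ArithmeticFunction.moebius d : ℂ) * (d : ℂ) ^ (-s)

/-- coefficients of the mollified polynomial -/
noncomputable def cc (N Q n : ℕ) : ℂ :=
  ∑ x ∈ (Finset.Icc 1 N ×ˢ Q.divisors) with x.1 * x.2 = n, (ArithmeticFunction.moebius x.2 : ℂ)

lemma DM_eq (N Q : ℕ) (s : ℂ) :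
    DD N s * MM Q s = ∑ n ∈ Finset.Icc 1 (N * Q), cc N Q n * (n : ℂ) ^ (-s) := by
  unfold DD MM
  rw [Finset.sum_mul_sum, ← Finset.sum_product']
  have hmap : ∀ x ∈ Finset.Icc 1 N ×ˢ Q.divisors, x.1 * x.2 ∈ Finset.Icc 1 (N * Q) := by
    intro x hx
    obtain ⟨h1, h2⟩ := Finset.mem_product.mp hx
    obtain ⟨h3, h4⟩ := Finset.mem_Icc.mp h1
    have h5 := Nat.pos_of_mem_divisors h2
    have h6 := Nat.divisor_le h2
    exact Finset.mem_Icc.mpr ⟨Nat.mul_pos h3 h5, Nat.mul_le_mul h4 h6⟩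
  rw [← Finset.sum_fiberwise_of_maps_to hmap]
  refine Finset.sum_congr rfl fun n _ => ?_
  unfold cc
  rw [Finset.sum_mul]
  refine Finset.sum_congr rfl fun x hx => ?_
  rw [← (Finset.mem_filter.mp hx).2, Nat.cast_mul, Complex.natCast_mul_natCast_cpow]
  ring

lemma cc_norm (N Q : ℕ) {n : ℕ} (hn : 1 ≤ n) : ‖cc N Q n‖ ≤ Q := by
  unfold cc
  refine (norm_sum_le _ _).trans ?_
  refine (Finset.sum_le_card_nsmul _ _ 1 fun x _ => ?_).trans ?_
  · rw [Complex.norm_intCast]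
    exact_mod_cast ArithmeticFunction.abs_moebius_le_one
  · rw [nsmul_eq_mul, mul_one]
    have : ((Finset.Icc 1 N ×ˢ Q.divisors).filter (fun x => x.1 * x.2 = n)).card ≤ Q.divisors.card := by
      refine Finset.card_le_card_of_injOn (fun x => x.2) (fun x hx => ?_) (fun x hx y hy hxy => ?_)
      · exact (Finset.mem_product.mp (Finset.mem_filter.mp hx).1).2
      · have h1 := (Finset.mem_filter.mp hx)
        have h2 := (Finset.mem_filter.mp hy)
        have h3 := Nat.pos_of_mem_divisors (Finset.mem_product.mp h1.1).2
        simp only at hxy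
        refine Prod.ext ?_ hxy
        have := h1.2.trans h2.2.symm
        rw [← hxy] at this
        exact Nat.eq_of_mul_eq_mul_right h3 this
    exact_mod_cast this.trans (Nat.card_divisors_le_self Q)

lemma cc_small {N Q n : ℕ} (hQ : Q ≠ 0) (hn : 1 ≤ n) (hN : n ≤ N) :
    cc N Q n = if n.gcd Q = 1 then 1 else 0 := by
  have h1 : cc N Q n = ∑ d ∈ (n.gcd Q).divisors, (ArithmeticFunction.moebius d : ℂ) := by
    unfold cc
    refine Finset.sum_nbij' (fun x => x.2) (fun d => (n / d, d)) ?_ ?_ ?_ ?_ ?_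
    · intro x hx
      obtain ⟨h1, h2⟩ := Finset.mem_filter.mp hx
      have h3 := Nat.dvd_of_mem_divisors (Finset.mem_product.mp h1).2
      exact Nat.mem_divisors.mpr ⟨Nat.dvd_gcd ⟨x.1, by rw [← h2, mul_comm]⟩ h3, Nat.gcd_ne_zero_right hQ⟩
    · intro d hd
      have h3 := Nat.dvd_of_mem_divisors hd
      have h4 := h3.trans (Nat.gcd_dvd_left n Q)
      have h5 := h3.trans (Nat.gcd_dvd_right n Q)
      refine Finset.mem_filter.mpr ⟨Finset.mem_product.mpr ⟨Finset.mem_Icc.mpr ⟨?_, ?_⟩, ?_⟩, ?_⟩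
      · exact Nat.div_pos (Nat.le_of_dvd hn h4) (Nat.pos_of_dvd_of_pos h4 hn)
      · exact (Nat.div_le_self _ _).trans hN
      · exact Nat.mem_divisors.mpr ⟨h5, hQ⟩
      · exact Nat.div_mul_cancel h4
    · intro x hx
      obtain ⟨h1, h2⟩ := Finset.mem_filter.mp hx
      have h3 := Nat.pos_of_mem_divisors (Finset.mem_product.mp h1).2
      refine Prod.ext ?_ rfl
      simp only
      rw [← h2, Nat.mul_div_cancel _ h3]
    · intro d hd; rfl
    · intro x hx; rfl
  rw [h1]
  have h2 := ArithmeticFunction.coe_mul_zeta_apply (f := ArithmeticFunction.moebius) (x := n.gcd Q)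
  rw [ArithmeticFunction.moebius_mul_coe_zeta, ArithmeticFunction.one_apply] at h2
  rw [← Int.cast_sum, ← h2]
  split_ifs <;> simp

lemma DM_sub {P N : ℕ} (hN : 1 ≤ N) (s : ℂ) :
    DD N s * MM P.factorial s - 1 = ∑ n ∈ Finset.Icc 2 (N * P.factorial), cc N P.factorial n * (n : ℂ) ^ (-s) := by
  rw [DM_eq]
  have h1 : 1 ≤ N * P.factorial := Nat.mul_pos hN (Nat.factorial_pos P)
  rw [← Finset.add_sum_Ioc_eq_sum_Icc h1, cc_small (Nat.factorial_ne_zero P) le_rfl hN]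
  simp
  rfl

lemma cc_sq {P N n : ℕ} (hn : 2 ≤ n) : ‖cc N P.factorial n‖ ^ 2 ≤
    (if P < n then (1 : ℝ) else 0) + (P.factorial : ℝ) ^ 2 * (if N < n then (1 : ℝ) else 0) := by
  by_cases h : N < n
  · rw [if_pos h, mul_one]
    have := pow_le_pow_left₀ (norm_nonneg _) (cc_norm N P.factorial (n := n) (by omega)) 2
    split_ifs <;> linarith
  · rw [cc_small (Nat.factorial_ne_zero P) (by omega) (by omega), if_neg h]
    by_cases h2 : P < n
    · rw [if_pos h2]; split_ifs <;> simp
    · have : n.gcd P.factorial = n := Nat.gcd_eq_left (Nat.dvd_factorial (by omega) (by omega))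
      rw [if_neg (by omega)]
      simp [h2]

lemma MM_norm {Q : ℕ} {s : ℂ} (hs : 0 ≤ s.re) : ‖MM Q s‖ ≤ Q := by
  unfold MM
  refine (norm_sum_le _ _).trans ?_
  refine (Finset.sum_le_card_nsmul _ _ 1 fun d hd => ?_).trans ?_
  · rw [norm_mul, Complex.norm_intCast, Complex.norm_natCast_cpow_of_pos (Nat.pos_of_mem_divisors hd)]
    have h1 : |((ArithmeticFunction.moebius d : ℤ) : ℝ)| ≤ 1 := by
      exact_mod_cast ArithmeticFunction.abs_moebius_le_one
    have h2 : (d : ℝ) ^ (-s).re ≤ 1 := by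
      apply Real.rpow_le_one_of_one_le_of_nonpos
      · exact_mod_cast Nat.pos_of_mem_divisors hd
      · simpa using hs
    calc _ ≤ (1 : ℝ) * 1 := by gcongr
      _ = 1 := one_mul 1
  · rw [nsmul_eq_mul, mul_one]
    exact_mod_cast Nat.card_divisors_le_self Q

lemma MM_diff (Q : ℕ) (s : ℂ) : DifferentiableAt ℂ (MM Q) s := by
  unfold MM
  refine DifferentiableAt.fun_sum fun n hn => ?_
  have hn0 : (n : ℂ) ≠ 0 := by
    have := Nat.pos_of_mem_divisors hn
    exact_mod_cast (by omega : n ≠ 0)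
  exact ((differentiableAt_id.neg).const_cpow (Or.inl hn0)).const_mul _

lemma DM_small {a : ℝ} (h : 1 / 2 < a) (ha : a ≤ 1) {σ1 : ℝ} (hσ : 1 / 2 < σ1) {δ : ℝ} (hδ : 0 < δ) :
    ∃ P0 : ℕ, ∀ P ≥ P0, ∀ᶠ T : ℝ in atTop, ∀ z : ℂ, σ1 ≤ z.re →
      nrm (pp a T) (fun s => DD (NN T) s * MM P.factorial s - 1) z ≤ δ * √(JJ a T) := by
  obtain ⟨a', h1, h2⟩ := exists_between h
  have ht := tl_tendsto σ1
  have hev := ht.eventually_le_const (show (0 : ℝ) < (δ / 2) ^ 2 / 2 by positivity)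
  obtain ⟨P0, hP0⟩ := eventually_atTop.mp hev
  refine ⟨P0, fun P hP => ?_⟩
  have hP1 := hP0 (P + 1) (by omega)
  have hN : Tendsto (fun T : ℝ => NN T + 1) atTop atTop := by
    refine (tendsto_add_atTop_nat 1).comp ?_
    exact (tendsto_nat_floor_atTop (α := ℝ)).comp (tendsto_rpow_atTop (by norm_num))
  have hN2 := (ht.comp hN).eventually_le_const (show (0 : ℝ) < (δ / 2) ^ 2 / 2 / (P.factorial : ℝ) ^ 2 by
    have := Nat.factorial_pos P; positivity)
  have hbig := (tendsto_rpow_atTop (sub_pos.mpr h1)).eventually_ge_atTop (P.factorial : ℝ)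
  filter_upwards [LSm a h2 (by linarith) (by linarith), hN2, hbig, eventually_ge_atTop 1] with T hLS hN2 hbig hT z hz
  have hT0 : 0 < T := by linarith
  have hF : (0 : ℝ) < P.factorial := by exact_mod_cast Nat.factorial_pos P
  have e0 : (fun s => DD (NN T) s * MM P.factorial s - 1) = fun s => ∑ n ∈ Finset.Icc 2 (NN T * P.factorial),
      cc (NN T) P.factorial n * (n : ℂ) ^ (-s) := funext fun s => DM_sub (NN_pos hT) s
  rw [e0]
  have : nrm (pp a T) (fun s => ∑ n ∈ Finset.Icc 2 (NN T * P.factorial), cc (NN T) P.factorial n * (n : ℂ) ^ (-s)) z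
      ≤ 2 * √(JJ a T) * (δ / 2) := by
    refine nrm_of_sq (by positivity) (hLS _ (fun n hn => ?_) _ z) ?_
    · obtain ⟨h1, h2⟩ := Finset.mem_Icc.mp hn
      refine ⟨by omega, ?_⟩
      calc (n : ℝ) ≤ NN T * P.factorial := by exact_mod_cast h2
        _ ≤ T ^ (1 / 2 : ℝ) * T ^ (a' - 1 / 2) := by
            gcongr
            exact NN_le hT
        _ = T ^ a' := by rw [← Real.rpow_add hT0]; congr 1; ring
    · have hterm : ∀ n ∈ Finset.Icc 2 (NN T * P.factorial), ‖cc (NN T) P.factorial n‖ ^ 2 * (n : ℝ) ^ (-(2 * z.re)) ≤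
          (if P < n then (n : ℝ) ^ (-(2 * σ1)) else 0) +
            (P.factorial : ℝ) ^ 2 * (if NN T < n then (n : ℝ) ^ (-(2 * σ1)) else 0) := by
        intro n hn
        have hn2 := (Finset.mem_Icc.mp hn).1
        calc _ ≤ ((if P < n then (1 : ℝ) else 0) + (P.factorial : ℝ) ^ 2 * (if NN T < n then (1 : ℝ) else 0)) *
              (n : ℝ) ^ (-(2 * σ1)) := by
              refine mul_le_mul (cc_sq hn2) (pow_mono_re (by omega) hz) (by positivity) ?_
              split_ifs <;> positivity
          _ = _ := by split_ifs <;> ring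
      refine (Finset.sum_le_sum hterm).trans ?_
      rw [Finset.sum_add_distrib, ← Finset.mul_sum, ← Finset.sum_filter, ← Finset.sum_filter]
      have s1 := sum_le_tl hσ (P + 1) ((Finset.Icc 2 (NN T * P.factorial)).filter (fun n => P < n))
        (fun n hn => (Finset.mem_filter.mp hn).2)
      have s2 := sum_le_tl hσ (NN T + 1) ((Finset.Icc 2 (NN T * P.factorial)).filter (fun n => NN T < n))
        (fun n hn => (Finset.mem_filter.mp hn).2)
      simp only [Function.comp] at hN2
      have s3 := mul_le_mul_of_nonneg_left (s2.trans hN2) (by positivity : 0 ≤ (P.factorial : ℝ) ^ 2)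
      rw [mul_div_cancel₀ _ (by positivity)] at s3
      linarith
  linarith

end ZDE

namespace ZDE
open Filter Topology

lemma JJ_pos (a : ℝ) {T : ℝ} (hT : 1 < T) : 1 ≤ JJ a T := by
  have hl := Real.log_pos hT
  have : 0 < T ^ a := Real.rpow_pos_of_pos (by linarith) _
  exact Nat.ceil_pos.mpr (by positivity)

lemma eta_zeta {a : ℝ} (h : 1 / 2 < a) (ha : a ≤ 1) {σ1 : ℝ} (hσ : 1 / 2 < σ1) (B1 B2 : ℝ) (k : ℕ) {δ : ℝ} (hδ : 0 < δ) :
    ∀ᶠ T : ℝ in atTop, ∀ z : ℂ, σ1 ≤ z.re → z.re ≤ B1 → |z.im| ≤ B2 →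
      nrm (pp a T) (fun s => etaN k s - riemannZeta s) z ≤ δ * √(JJ a T) := by
  obtain ⟨σ0, h1, h2⟩ := exists_between hσ
  set r := (σ1 - σ0) / (k + 1) with hr
  have hr0 : 0 < r := div_pos (by linarith) (by positivity)
  have hkr : (k + 1) * r = σ1 - σ0 := by rw [hr]; field_simp
  obtain ⟨C, hC, kC⟩ := zeta_nrm (a := a) h ha h1 (B1 + (k + 1) * r)
  have key := etaN_approx (l := atTop) (JJ a) (fun T => pp a T)
    (fun _ n => {z : ℂ | σ0 + n * r ≤ z.re ∧ z.re ≤ B1 + (k + 1) * r - n * r ∧ |z.im| ≤ B2 + (k + 1) * r - n * r})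
    (fun T => T - (B2 + (k + 1) * r)) (tendsto_atTop_add_const_right _ _ tendsto_id)
    (fun T => max 1 √(JJ a T)) (fun T => by positivity) hr0 hC.le ?_ ?_ ?_ k δ hδ
  · filter_upwards [key, eventually_gt_atTop 1] with T hk hT z hz1 hz2 hz3
    have hJ : max 1 √(JJ a T) = √(JJ a T) := by
      apply max_eq_right
      rw [Real.one_le_sqrt]
      exact_mod_cast JJ_pos a hT
    rw [hJ] at hk
    refine hk z ⟨?_, ?_, ?_⟩
    · push_cast; linarith
    · push_cast; linarith
    · push_cast; linarith
  · intro T n z hz w hw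
    obtain ⟨a1, a2, a3⟩ := hz
    have b1 := abs_le.mp (ball_re hw)
    have b2 := abs_le.mp (ball_im hw)
    push_cast at a1 a2 a3
    rw [abs_le] at a3
    refine ⟨by linarith, by linarith, abs_le.mpr ⟨by linarith, by linarith⟩⟩
  · filter_upwards [pp_bd ha] with T hT n z hz j
    obtain ⟨a1, a2, a3⟩ := hz
    have hn : 0 ≤ (n : ℝ) * r := by positivity
    rw [abs_le] at a3
    simp only [Complex.add_re, Complex.add_im, pp_re]
    have := (hT j).1
    constructor <;> linarith
  · filter_upwards [kC, eventually_ge_atTop (8 * (B2 + (k + 1) * r))] with T hT hT2 n z hz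
    obtain ⟨a1, a2, a3⟩ := hz
    have hn : 0 ≤ (n : ℝ) * r := by positivity
    refine (hT z (by linarith) (by linarith) (by linarith)).trans ?_
    gcongr
    exact le_max_right _ _

/-- mollified normalised eta -/
noncomputable def GG (k P : ℕ) (s : ℂ) : ℂ := etaN k s * MM P.factorial s

lemma GG_small {a : ℝ} (h : 1 / 2 < a) (ha : a ≤ 1) {σ1 : ℝ} (hσ : 1 / 2 < σ1) (B1 B2 : ℝ) (k : ℕ) {δ : ℝ} (hδ : 0 < δ) :
    ∃ P0 : ℕ, ∀ P ≥ P0, ∀ᶠ T : ℝ in atTop, ∀ z : ℂ, σ1 ≤ z.re → z.re ≤ B1 → |z.im| ≤ B2 →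
      nrm (pp a T) (fun s => GG k P s - 1) z ≤ δ * √(JJ a T) := by
  obtain ⟨P0, hP⟩ := DM_small (a := a) h ha hσ (half_pos hδ)
  refine ⟨P0, fun P hPP => ?_⟩
  have hF : (0 : ℝ) < P.factorial := by exact_mod_cast Nat.factorial_pos P
  have hδ' : 0 < δ / 4 / P.factorial := by positivity
  filter_upwards [hP P hPP, eta_zeta h ha hσ B1 B2 k hδ', zeta_D_small h ha hσ B1 hδ',
    eventually_ge_atTop (8 * B2)] with T h1 h2 h3 hT z hz1 hz2 hz3
  have e : (fun s => GG k P s - 1) = fun s => ((etaN k s - riemannZeta s) * MM P.factorial s +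
      (riemannZeta s - DD (NN T) s) * MM P.factorial s) + (DD (NN T) s * MM P.factorial s - 1) := by
    funext s; unfold GG; ring
  rw [e]
  refine (nrm_add_le _ _ _ _).trans ((add_le_add_left (nrm_add_le _ _ _ _) _).trans ?_)
  have hM : ∀ (f : ℂ → ℂ), nrm (pp a T) (fun s => f s * MM P.factorial s) z ≤ P.factorial * nrm (pp a T) f z := by
    intro f
    refine nrm_le_mul hF.le fun j => ?_
    rw [norm_mul, mul_comm]
    refine mul_le_mul_of_nonneg_right (MM_norm ?_) (norm_nonneg _)
    simp only [Complex.add_re, pp_re]; linarith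
  have q1 := (hM (fun s => etaN k s - riemannZeta s)).trans (mul_le_mul_of_nonneg_left (h2 z hz1 hz2 hz3) hF.le)
  have q2 := (hM (fun s => riemannZeta s - DD (NN T) s)).trans (mul_le_mul_of_nonneg_left (h3 z hz1 hz2 (by linarith)) hF.le)
  have q3 := h1 z hz1
  have e2 : (P.factorial : ℝ) * (δ / 4 / P.factorial * √(JJ a T)) = δ / 4 * √(JJ a T) := by field_simp
  rw [e2] at q1 q2
  linarith

end ZDE

namespace ZDE
open Filter Topology

lemma zeta_far {s : ℂ} (hs : 2 ≤ s.re) : ‖riemannZeta s - 1‖ ≤ (3 / 2 : ℝ) ^ (-(s.re - 2)) * C2 := by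
  have h := zeta_tail hs (X := 3 / 2) (by norm_num)
  have e : ⌊(3 / 2 : ℝ)⌋₊ = 1 := by rw [Nat.floor_eq_iff (by norm_num)]; norm_num
  rw [e] at h
  simpa [DD] using h

lemma MM_far {Q : ℕ} (hQ : Q ≠ 0) {s : ℂ} (hs : 2 ≤ s.re) : ‖MM Q s - 1‖ ≤ (3 / 2 : ℝ) ^ (-(s.re - 2)) * C2 := by
  have h1 : 1 ∈ Q.divisors := Nat.one_mem_divisors.mpr hQ
  unfold MM
  rw [← Finset.add_sum_erase _ _ h1]
  simp only [ArithmeticFunction.moebius_apply_one, Int.cast_one, Nat.cast_one, Complex.one_cpow, mul_one,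
    add_sub_cancel_left]
  refine (norm_sum_le _ _).trans ?_
  have hterm : ∀ d ∈ Q.divisors.erase 1, ‖(ArithmeticFunction.moebius d : ℂ) * (d : ℂ) ^ (-s)‖ ≤
      (3 / 2 : ℝ) ^ (-(s.re - 2)) * (1 / (d : ℝ) ^ 2) := by
    intro d hd
    obtain ⟨h2, h3⟩ := Finset.mem_erase.mp hd
    have h4 := Nat.pos_of_mem_divisors h3
    have hd2 : (2 : ℝ) ≤ d := by exact_mod_cast (by omega : 2 ≤ d)
    have hd0 : (0 : ℝ) < d := by linarith
    rw [norm_mul, Complex.norm_intCast, Complex.norm_natCast_cpow_of_pos h4]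
    have hmu : |((ArithmeticFunction.moebius d : ℤ) : ℝ)| ≤ 1 := by
      exact_mod_cast ArithmeticFunction.abs_moebius_le_one
    have e3 : (d : ℝ) ^ (-s).re = (d : ℝ) ^ (-(s.re - 2)) * (1 / (d : ℝ) ^ 2) := by
      rw [one_div, ← Real.rpow_natCast (d : ℝ) 2, ← Real.rpow_neg hd0.le, ← Real.rpow_add hd0]
      congr 1; simp; ring
    have e4 : (d : ℝ) ^ (-(s.re - 2)) ≤ (3 / 2 : ℝ) ^ (-(s.re - 2)) :=
      Real.rpow_le_rpow_of_nonpos (by norm_num) (by linarith) (by linarith)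
    rw [e3]
    calc _ ≤ 1 * ((3 / 2 : ℝ) ^ (-(s.re - 2)) * (1 / (d : ℝ) ^ 2)) := by gcongr
      _ = _ := one_mul _
  refine (Finset.sum_le_sum hterm).trans ?_
  rw [← Finset.mul_sum]
  refine mul_le_mul_of_nonneg_left ?_ (by positivity)
  exact (Real.summable_one_div_nat_pow.mpr (by norm_num : 1 < 2)).sum_le_tsum _ (fun n _ => by positivity)

lemma far_small : ∃ C0 : ℝ, 3 ≤ C0 ∧ ∀ x ≥ C0, (3 / 2 : ℝ) ^ (-(x - 2)) * C2 ≤ 1 / 16 := by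
  have h1 : Tendsto (fun x : ℝ => (3 / 2 : ℝ) ^ (-(x - 2)) * C2) atTop (𝓝 0) := by
    have h2 : Tendsto (fun x : ℝ => -(x - 2)) atTop atBot :=
      tendsto_neg_atTop_atBot.comp (tendsto_atTop_add_const_right _ _ tendsto_id)
    have h3 := (tendsto_rpow_atBot_of_base_gt_one (3 / 2 : ℝ) (by norm_num)).comp h2
    simpa using h3.mul_const C2
  obtain ⟨c, hc⟩ := eventually_atTop.mp (h1.eventually_le_const (by norm_num : (0 : ℝ) < 1 / 16))
  exact ⟨max 3 c, le_max_left _ _, fun x hx => hc x ((le_max_right _ _).trans hx)⟩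

lemma eta_far (k : ℕ) : ∃ Y : ℝ, ∀ s : ℂ, (k : ℝ) + 3 ≤ s.re → Y ≤ s.im →
    ‖etaN k s - riemannZeta s‖ ≤ 1 / 16 := by
  have key := etaN_approx (l := atTop) (fun _ : ℝ => 1) (fun _ _ => 0)
    (fun T n => {z : ℂ | 2 + (n : ℝ) ≤ z.re ∧ T + n ≤ z.im}) (fun T => T) tendsto_id
    (fun _ => 1) (fun _ => one_pos) (r := 1) (A := 1 + C2) one_pos (by linarith [C2_nonneg]) ?_ ?_ ?_ k
    (1 / 16) (by norm_num)
  · obtain ⟨T, hT⟩ := key.exists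
    refine ⟨T + (k + 1), fun s h1 h2 => ?_⟩
    have h3 := hT s ⟨by push_cast; linarith, by push_cast; linarith⟩
    have h4 := sum_le_nrm (J := 1) (fun _ => 0) (fun s => etaN k s - riemannZeta s) s
    simp at h4
    linarith
  · intro T n z hz w hw
    obtain ⟨a1, a2⟩ := hz
    have b1 := abs_le.mp (ball_re hw)
    have b2 := abs_le.mp (ball_im hw)
    push_cast at a1 a2
    exact ⟨by linarith, by linarith⟩
  · refine Eventually.of_forall fun T n z hz j => ?_
    obtain ⟨a1, a2⟩ := hz
    have : (0 : ℝ) ≤ n := Nat.cast_nonneg n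
    simp only [add_zero]
    constructor <;> linarith
  · refine Eventually.of_forall fun T n z hz => ?_
    obtain ⟨a1, a2⟩ := hz
    have hn : (0 : ℝ) ≤ n := Nat.cast_nonneg n
    refine (nrm_le_const (δ := 1 + C2) (by linarith [C2_nonneg]) fun j => ?_).trans (by simp)
    simp only [add_zero]
    have h1 := zeta_far (s := z) (by linarith)
    have h2 : (3 / 2 : ℝ) ^ (-(z.re - 2)) ≤ 1 :=
      Real.rpow_le_one_of_one_le_of_nonpos (by norm_num) (by linarith)
    have h3 : (3 / 2 : ℝ) ^ (-(z.re - 2)) * C2 ≤ 1 * C2 := mul_le_mul_of_nonneg_right h2 C2_nonneg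
    calc ‖riemannZeta z‖ = ‖1 + (riemannZeta z - 1)‖ := by rw [add_sub_cancel]
      _ ≤ 1 + ‖riemannZeta z - 1‖ := (norm_add_le _ _).trans (by simp)
      _ ≤ _ := by linarith

lemma far (k : ℕ) (c : ℝ) : ∃ C0 Y : ℝ, c ≤ C0 ∧ ∀ s : ℂ, C0 ≤ s.re → Y ≤ s.im →
    etaN k s ≠ 0 ∧ ∀ P, ‖GG k P s - 1‖ ≤ 1 / 2 := by
  obtain ⟨C0, h1, h2⟩ := far_small
  obtain ⟨Y, hY⟩ := eta_far k
  refine ⟨max c (max C0 (k + 3)), Y, le_max_left _ _, fun s hs1 hs2 => ?_⟩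
  have ha : C0 ≤ s.re := ((le_max_left _ _).trans (le_max_right _ _)).trans hs1
  have hb : (k : ℝ) + 3 ≤ s.re := ((le_max_right _ _).trans (le_max_right _ _)).trans hs1
  have e1 := hY s hb hs2
  have e2 := (zeta_far (s := s) (by linarith)).trans (h2 s.re ha)
  have e3 : ‖etaN k s - 1‖ ≤ 1 / 8 := by
    have : etaN k s - 1 = (etaN k s - riemannZeta s) + (riemannZeta s - 1) := by ring
    rw [this]
    exact (norm_add_le _ _).trans (by linarith)
  refine ⟨fun h => ?_, fun P => ?_⟩
  · rw [h] at e3; norm_num at e3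
  · have e4 := (MM_far (Nat.factorial_ne_zero P) (s := s) (by linarith)).trans (h2 s.re ha)
    have : GG k P s - 1 = (etaN k s - 1) * (MM P.factorial s - 1) + ((etaN k s - 1) + (MM P.factorial s - 1)) := by
      unfold GG; ring
    rw [this]
    refine (norm_add_le _ _).trans ?_
    rw [norm_mul]
    have e5 := norm_add_le (etaN k s - 1) (MM P.factorial s - 1)
    have e6 : ‖etaN k s - 1‖ * ‖MM P.factorial s - 1‖ ≤ 1 / 8 * (1 / 16) := by gcongr
    linarith

lemma jensen_count {G : ℂ → ℂ} {c : ℂ} {r R : ℝ} (hr : 0 < r) (hrR : r < R)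
    (hG : AnalyticOnNhd ℂ G (Metric.closedBall c R)) (hc : G c ≠ 0) (S : Finset ℂ)
    (hS : ∀ ρ ∈ S, ρ ∈ Metric.closedBall c r ∧ G ρ = 0) :
    (S.card : ℝ) * Real.log (R / r) ≤ Real.circleAverage (fun w => Real.log ‖G w‖) c R - Real.log ‖G c‖ := by
  have hR : 0 < R := hr.trans hrR
  have hRa : |R| = R := abs_of_pos hR
  have j := AnalyticOnNhd.circleAverage_log_norm (R := R) hR.ne' (by rwa [hRa]) hc
  rw [hRa] at j
  rw [j, add_sub_cancel_right]
  set D := MeromorphicOn.divisor G (Metric.closedBall c R) with hD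
  have hfin : (Function.support fun u => (D u : ℝ) * Real.log (R * ‖c - u‖⁻¹)).Finite :=
    (D.finiteSupport (isCompact_closedBall c R)).subset fun u hu => by
      simp only [Function.mem_support] at hu ⊢
      intro h; apply hu; rw [h]; simp
  rw [finsum_eq_sum_of_support_subset (s := hfin.toFinset ∪ S) _ (by
    intro u hu
    simp only [Finset.coe_union, Set.Finite.coe_toFinset]
    exact Or.inl hu)]
  have hnn : ∀ u, 0 ≤ (D u : ℝ) * Real.log (R * ‖c - u‖⁻¹) := by
    intro u
    by_cases hu : u ∈ Metric.closedBall c R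
    · refine mul_nonneg (by exact_mod_cast MeromorphicOn.AnalyticOnNhd.divisor_nonneg hG u) ?_
      rcases eq_or_ne (c - u) 0 with h | h
      · rw [h]; simp
      · have h2 : 0 < ‖c - u‖ := norm_pos_iff.mpr h
        apply Real.log_nonneg
        rw [← div_eq_mul_inv, le_div_iff₀ h2, one_mul]
        rwa [Metric.mem_closedBall, dist_comm, dist_eq_norm] at hu
    · have : D u = 0 := Function.locallyFinsuppWithin.apply_eq_zero_of_notMem D hu
      rw [this]; simp
  calc (S.card : ℝ) * Real.log (R / r) = ∑ u ∈ S, Real.log (R / r) := by simp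
    _ ≤ ∑ u ∈ S, (D u : ℝ) * Real.log (R * ‖c - u‖⁻¹) := by
        refine Finset.sum_le_sum fun u hu => ?_
        obtain ⟨h1, h2⟩ := hS u hu
        have huR : u ∈ Metric.closedBall c R := Metric.closedBall_subset_closedBall hrR.le h1
        have hcu : c - u ≠ 0 := by
          intro h; rw [sub_eq_zero.mp h] at hc; exact hc h2
        have hp : 0 < ‖c - u‖ := norm_pos_iff.mpr hcu
        have hle : ‖c - u‖ ≤ r := by rwa [Metric.mem_closedBall, dist_comm, dist_eq_norm] at h1
        have hD1 : 1 ≤ D u := by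
          rw [hD, MeromorphicOn.AnalyticOnNhd.divisor_apply hG huR]
          have o1 : analyticOrderAt G u ≠ 0 := by
            rw [Ne, (hG u huR).analyticOrderAt_eq_zero]; simpa using h2
          have o2 : analyticOrderAt G u ≠ ⊤ := by
            rw [Ne, analyticOrderAt_eq_top]
            intro h
            exact hc (hG.eqOn_zero_of_preconnected_of_eventuallyEq_zero
              (convex_closedBall c R).isPreconnected huR h (Metric.mem_closedBall_self hR.le))
          obtain ⟨n, hn⟩ := ENat.ne_top_iff_exists.mp o2
          rw [← hn] at o1 ⊢
          have : n ≠ 0 := by exact_mod_cast o1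
          have hn1 : (1 : ℤ) ≤ n := by omega
          simpa using hn1
        have hlog : Real.log (R / r) ≤ Real.log (R * ‖c - u‖⁻¹) := by
          rw [← div_eq_mul_inv]
          exact Real.log_le_log (by positivity) (by gcongr)
        have hl0 : 0 ≤ Real.log (R / r) := Real.log_nonneg (by rw [le_div_iff₀ hr]; linarith)
        have : (1 : ℝ) ≤ D u := by exact_mod_cast hD1
        nlinarith
    _ ≤ _ := Finset.sum_le_sum_of_subset_of_nonneg Finset.subset_union_right fun u _ _ => hnn u

lemma jensen_count2 {G : ℂ → ℂ} {c : ℂ} {r R : ℝ} (hr : 0 < r) (hrR : r < R)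
    (hG : AnalyticOnNhd ℂ G (Metric.closedBall c R)) (hc : ‖G c - 1‖ ≤ 1 / 2) (S : Finset ℂ)
    (hS : ∀ ρ ∈ S, ρ ∈ Metric.closedBall c r ∧ G ρ = 0) :
    (S.card : ℝ) * Real.log (R / r) ≤ Real.circleAverage (fun w => ‖G w - 1‖) c R + 2 * ‖G c - 1‖ := by
  have hR : 0 < R := hr.trans hrR
  have hx : 1 - ‖G c - 1‖ ≤ ‖G c‖ := by
    have := norm_sub_le (G c) (G c - 1)
    simp at this; linarith
  have hc0 : G c ≠ 0 := by intro h; rw [h] at hc; norm_num at hc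
  have h1 := jensen_count hr hrR hG hc0 S hS
  have h2 : -Real.log ‖G c‖ ≤ 2 * ‖G c - 1‖ := by
    have h3 := Real.one_sub_inv_le_log_of_pos (norm_pos_iff.mpr hc0)
    have h4 : ‖G c‖⁻¹ ≤ 1 + 2 * ‖G c - 1‖ := by
      rw [inv_le_iff_one_le_mul₀ (norm_pos_iff.mpr hc0)]
      have := norm_nonneg (G c - 1)
      nlinarith
    linarith
  have h5 : Real.circleAverage (fun w => Real.log ‖G w‖) c R ≤ Real.circleAverage (fun w => ‖G w - 1‖) c R := by
    have hG' : AnalyticOnNhd ℂ G (Metric.sphere c |R|) :=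
      hG.mono (by rw [abs_of_pos hR]; exact Metric.sphere_subset_closedBall)
    refine Real.circleAverage_mono hG'.meromorphicOn.circleIntegrable_log_norm ?_ fun w _ => ?_
    · refine ContinuousOn.circleIntegrable' ?_
      exact (hG'.continuousOn.sub continuousOn_const).norm
    · rcases eq_or_ne (G w) 0 with h | h
      · rw [h]; simp
      · have := Real.log_le_sub_one_of_pos (norm_pos_iff.mpr h)
        have h6 := norm_sub_norm_le (G w) 1
        rw [norm_one] at h6
        linarith
  linarith

end ZDE

namespace ZDE
open Filter Topology

lemma count_upper {J : ℕ} {p : Fin J → ℂ} {G : ℂ → ℂ} {c : ℂ} {r R B : ℝ} (hr : 0 < r) (hrR : r < R)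
    (hG : ∀ j, AnalyticOnNhd ℂ G (Metric.closedBall (c + p j) R))
    (hc : ∀ j, ‖G (c + p j) - 1‖ ≤ 1 / 2)
    (hB : ∀ z ∈ Metric.closedBall c R, ∑ j, ‖G (z + p j) - 1‖ ≤ B) (S : Fin J → Finset ℂ)
    (hS : ∀ j, ∀ ρ ∈ S j, ρ ∈ Metric.closedBall (c + p j) r ∧ G ρ = 0) :
    (∑ j, ((S j).card : ℝ)) * Real.log (R / r) ≤ 3 * B := by
  have hR : 0 < R := hr.trans hrR
  rw [Finset.sum_mul]
  refine (Finset.sum_le_sum fun j _ => jensen_count2 hr hrR (hG j) (hc j) (S j) (hS j)).trans ?_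
  rw [Finset.sum_add_distrib, ← Finset.mul_sum]
  have h1 := hB c (Metric.mem_closedBall_self hR.le)
  have hci : ∀ j ∈ (Finset.univ : Finset (Fin J)), CircleIntegrable (fun z => ‖G (z + p j) - 1‖) c R := by
    intro j _
    refine ContinuousOn.circleIntegrable' ?_
    refine ContinuousOn.norm (ContinuousOn.sub ?_ continuousOn_const)
    refine (hG j).continuousOn.comp (Continuous.continuousOn (by fun_prop)) fun z hz => ?_
    rw [abs_of_pos hR] at hz
    have := Metric.sphere_subset_closedBall hz
    simpa using this
  have h2 : ∑ j, Real.circleAverage (fun w => ‖G w - 1‖) (c + p j) R ≤ B := by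
    have e : ∀ j, Real.circleAverage (fun w => ‖G w - 1‖) (c + p j) R =
        Real.circleAverage (fun z => ‖G (z + p j) - 1‖) c R := by
      intro j
      rw [← Real.circleAverage_map_add_const, ← Real.circleAverage_map_add_const (c := c)]
      simp only [add_assoc]
    simp only [e]
    rw [← Real.circleAverage_fun_sum hci]
    refine Real.circleAverage_mono_on_of_le_circle ?_ fun z hz => ?_
    · exact CircleIntegrable.fun_sum _ hci
    · rw [abs_of_pos hR] at hz
      exact hB z (Metric.sphere_subset_closedBall hz)
  linarith

open scoped Classical in
lemma count_lower {a T η C r : ℝ} (hl : 0 < Real.log T) (hη : 0 < η) (hη1 : η ≤ 1) (hh1 : hh T ≤ η / 2)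
    {ρ : ℂ} (h1 : T < ρ.im) (h2 : ρ.im < T + T ^ a) (h3 : |ρ.re - C| ≤ r - η) :
    η / (2 * hh T) ≤ ((Finset.univ.filter fun j : Fin (JJ a T) =>
      ρ ∈ Metric.closedBall ((C : ℂ) + pp a T j) r).card : ℝ) := by
  have hpos : 0 < hh T := by unfold hh; positivity
  set h := hh T with hdef
  set j0 := ⌈(ρ.im - T) / h⌉₊ with hj0
  set m := ⌊η / h⌋₊ with hm
  have a1 : (ρ.im - T) / h ≤ j0 := Nat.le_ceil _
  have a2 : (j0 : ℝ) < (ρ.im - T) / h + 1 := Nat.ceil_lt_add_one (div_nonneg (by linarith) hpos.le)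
  have a3 : (m : ℝ) ≤ η / h := Nat.floor_le (by positivity)
  have a4 : η / h < m + 1 := Nat.lt_floor_add_one _
  rw [div_le_iff₀ hpos] at a1
  rw [← sub_lt_iff_lt_add, lt_div_iff₀ hpos] at a2
  rw [le_div_iff₀ hpos] at a3
  have b : ∀ i : ℕ, i < m → ρ.im ≤ T + ((j0 + i : ℕ) : ℝ) * h ∧ T + ((j0 + i : ℕ) : ℝ) * h ≤ ρ.im + η := by
    intro i hi
    have c1 : (i : ℝ) + 1 ≤ m := by exact_mod_cast hi
    have c2 : (0 : ℝ) ≤ i := Nat.cast_nonneg i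
    have c3 : ((i : ℝ) + 1) * h ≤ m * h := by gcongr
    have c4 : 0 ≤ (i : ℝ) * h := by positivity
    push_cast
    constructor <;> nlinarith
  have hJ : ∀ i : ℕ, i < m → j0 + i < JJ a T := by
    intro i hi
    have c1 := (b i hi).2
    have c2 : ((j0 + i : ℕ) : ℝ) * h < T ^ a + 3 := by linarith
    have c3 : ((j0 + i : ℕ) : ℝ) < (T ^ a + 3) * (2 * Real.log T) := by
      have : (T ^ a + 3) * (2 * Real.log T) = (T ^ a + 3) / h := by
        rw [hdef]; unfold hh; field_simp
      rw [this, lt_div_iff₀ hpos]; exact c2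
    have c4 := c3.trans_le (Nat.le_ceil _)
    exact_mod_cast c4
  have hcard : m ≤ (Finset.univ.filter fun j : Fin (JJ a T) =>
      ρ ∈ Metric.closedBall ((C : ℂ) + pp a T j) r).card := by
    have := Finset.card_le_card_of_injOn (s := (Finset.univ : Finset (Fin m)))
      (t := Finset.univ.filter fun j : Fin (JJ a T) => ρ ∈ Metric.closedBall ((C : ℂ) + pp a T j) r)
      (fun i => ⟨j0 + i, hJ i i.2⟩) ?_ ?_
    · simpa using this
    · intro i _
      simp only [Finset.coe_filter, Finset.mem_univ, true_and]
      show ρ ∈ Metric.closedBall _ r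
      rw [Metric.mem_closedBall, dist_eq_norm]
      refine (Complex.norm_le_abs_re_add_abs_im _).trans ?_
      have e1 : (ρ - ((C : ℂ) + pp a T ⟨j0 + i, hJ i i.2⟩)).re = ρ.re - C := by simp [pp_re]
      have e2 : (ρ - ((C : ℂ) + pp a T ⟨j0 + i, hJ i i.2⟩)).im = ρ.im - (T + ((j0 + i : ℕ) : ℝ) * h) := by
        simp [pp_im, hdef]
      rw [e1, e2]
      have := b i i.2
      have e3 : |ρ.im - (T + ((j0 + i : ℕ) : ℝ) * h)| ≤ η := by
        rw [abs_le]; constructor <;> linarith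
      linarith
    · intro i _ i' _ hii
      simp only [Fin.mk.injEq] at hii
      exact Fin.ext (by omega)
  have : (m : ℝ) ≤ _ := Nat.cast_le.mpr hcard
  refine le_trans ?_ this
  have e1 : η / (2 * h) = η / h / 2 := by field_simp
  have e2 : 2 ≤ η / h := by rw [le_div_iff₀ hpos]; linarith
  rw [e1]; linarith

lemma JJ_le {a T : ℝ} (hl : 0 < Real.log T) (hh1 : hh T ≤ 1) (hTa : 4 ≤ T ^ a) :
    (JJ a T : ℝ) ≤ 2 * T ^ a / hh T := by
  have hpos : 0 < hh T := by unfold hh; positivity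
  have h1 : (JJ a T : ℝ) < (T ^ a + 3) * (2 * Real.log T) + 1 := Nat.ceil_lt_add_one (by positivity)
  have e : (T ^ a + 3) * (2 * Real.log T) = (T ^ a + 3) / hh T := by
    unfold hh; field_simp
  have e2 : 1 ≤ 1 / hh T := by rw [le_div_iff₀ hpos]; linarith
  rw [e] at h1
  calc (JJ a T : ℝ) ≤ (T ^ a + 3) / hh T + 1 / hh T := by linarith
    _ = (T ^ a + 4) / hh T := by ring
    _ ≤ _ := by gcongr; linarith

lemma GG_analytic {k P : ℕ} {c : ℂ} {R : ℝ} (h : Metric.closedBall c R ⊆ Om) :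
    AnalyticOnNhd ℂ (GG k P) (Metric.closedBall c R) := by
  have h1 : DifferentiableOn ℂ (GG k P) Om := fun s hs =>
    ((etaN_diff k hs).mul (MM_diff P.factorial s)).differentiableWithinAt
  exact (h1.analyticOnNhd Om_open).mono h

lemma hh_tendsto : Tendsto hh atTop (𝓝 0) := by
  have h1 : Tendsto (fun T : ℝ => 2 * Real.log T) atTop atTop :=
    Real.tendsto_log_atTop.const_mul_atTop (by norm_num)
  refine h1.inv_tendsto_atTop.congr fun T => ?_
  simp only [hh, Pi.inv_apply, one_div]

open scoped Classical in
theorem final_count {a : ℝ} (h : 1 / 2 < a) (ha : a ≤ 1) {σ : ℝ} (hσ : 1 / 2 < σ) (k : ℕ) {ε : ℝ} (hε : 0 < ε) :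
    ∀ᶠ T : ℝ in atTop, ∀ S : Finset ℂ,
      (∀ ρ ∈ S, etaMT (k + 1) ρ = 0 ∧ σ < ρ.re ∧ T < ρ.im ∧ ρ.im < T + T ^ a) →
      (S.card : ℝ) ≤ ε * T ^ a := by
  obtain ⟨C0, Y, hC0, hfar⟩ := far k (σ + 1)
  set η := min 1 ((σ - 1 / 2) / 4) with hη
  have hη0 : 0 < η := lt_min one_pos (by linarith)
  have hη1 : η ≤ 1 := min_le_left _ _
  have hη2 : η ≤ (σ - 1 / 2) / 4 := min_le_right _ _
  set R := C0 - σ + 2 * η with hR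
  set r := C0 - σ + η with hr
  have hr0 : 0 < r := by linarith
  have hrR : r < R := by linarith
  have hR0 : 0 < R := by linarith
  set L := Real.log (R / r) with hL
  have hL0 : 0 < L := Real.log_pos (by rw [lt_div_iff₀ hr0]; linarith)
  set δ := ε * η * L / 12 with hδ
  have hδ0 : 0 < δ := by positivity
  obtain ⟨P, hP⟩ := GG_small h ha (σ1 := σ - 2 * η) (by linarith) (C0 + R) R k hδ0
  have hTa : Tendsto (fun T : ℝ => T ^ a) atTop atTop := tendsto_rpow_atTop (by linarith)
  filter_upwards [hP P le_rfl, pp_bd ha, eventually_ge_atTop (max 2 (max Y (tau0 + R + 1))),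
    hh_tendsto.eventually_le_const (show 0 < η / 2 by linarith), hTa.eventually_ge_atTop 4]
    with T g1 g2 g3 g4 g5 S hS
  have hT2 : 2 ≤ T := (le_max_left _ _).trans g3
  have hTY : Y ≤ T := ((le_max_left _ _).trans (le_max_right _ _)).trans g3
  have hTt : tau0 + R + 1 ≤ T := ((le_max_right _ _).trans (le_max_right _ _)).trans g3
  have hl : 0 < Real.log T := Real.log_pos (by linarith)
  have hpos : 0 < hh T := by unfold hh; positivity
  have hJ0 : (0 : ℝ) ≤ JJ a T := Nat.cast_nonneg _
  have hzero : ∀ ρ ∈ S, etaN k ρ = 0 := fun ρ hρ => by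
    unfold etaN; rw [(hS ρ hρ).1, zero_mul]
  have up := count_upper (p := pp a T) (G := GG k P) (c := (C0 : ℂ)) (r := r) (R := R)
    (B := δ * JJ a T) hr0 hrR ?_ ?_ ?_
    (fun j => S.filter fun ρ => ρ ∈ Metric.closedBall ((C0 : ℂ) + pp a T j) r) ?_
  · have low : (S.card : ℝ) * (η / (2 * hh T)) ≤
        ∑ j, (((S.filter fun ρ => ρ ∈ Metric.closedBall ((C0 : ℂ) + pp a T j) r).card : ℕ) : ℝ) := by
      have sw : ∑ j, ((S.filter fun ρ => ρ ∈ Metric.closedBall ((C0 : ℂ) + pp a T j) r).card) =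
          ∑ ρ ∈ S, (Finset.univ.filter fun j : Fin (JJ a T) =>
            ρ ∈ Metric.closedBall ((C0 : ℂ) + pp a T j) r).card := by
        simp only [Finset.card_filter]
        exact Finset.sum_comm
      rw [← Nat.cast_sum, sw, Nat.cast_sum, ← nsmul_eq_mul]
      refine Finset.card_nsmul_le_sum _ _ _ fun ρ hρ => ?_
      obtain ⟨s1, s2, s3, s4⟩ := hS ρ hρ
      refine count_lower hl hη0 hη1 g4 s3 s4 ?_
      have hlt : ρ.re < C0 := by
        by_contra hcon
        exact (hfar ρ (not_lt.mp hcon) (by linarith)).1 (hzero ρ hρ)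
      rw [abs_le]; constructor <;> linarith
    have j1 := JJ_le (a := a) hl (by linarith) g5
    have k1 : (S.card : ℝ) * (η / (2 * hh T)) * L ≤ 3 * (δ * (2 * T ^ a / hh T)) := by
      calc _ ≤ _ := mul_le_mul_of_nonneg_right low hL0.le
        _ ≤ _ := up
        _ ≤ _ := by gcongr
    have k2 : 3 * (δ * (2 * T ^ a / hh T)) = (ε * T ^ a) * (η * L / (2 * hh T)) := by
      rw [hδ]; field_simp; norm_num
    have k3 : (S.card : ℝ) * (η / (2 * hh T)) * L = S.card * (η * L / (2 * hh T)) := by ring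
    rw [k2, k3] at k1
    exact le_of_mul_le_mul_right k1 (by positivity)
  · intro j
    refine GG_analytic fun s hs => ?_
    have b1 := abs_le.mp (ball_re hs)
    have b2 := abs_le.mp (ball_im hs)
    have b3 := (g2 j).1
    simp [pp_re] at b1 b2
    exact ⟨by linarith, by linarith⟩
  · intro j
    refine (hfar _ ?_ ?_).2 P
    · simp [pp_re]
    · have b3 := (g2 j).1
      simp; linarith
  · intro z hz
    have b1 := abs_le.mp (ball_re hz)
    have b2 := ball_im hz
    simp at b1 b2
    have q1 := g1 z (by linarith) (by linarith) b2
    have q2 := sum_le_nrm (pp a T) (fun s => GG k P s - 1) z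
    have q3 : √(JJ a T : ℝ) * (δ * √(JJ a T : ℝ)) = δ * JJ a T := by
      nlinarith [Real.mul_self_sqrt hJ0]
    refine q2.trans ?_
    rw [← q3]
    gcongr
  · intro j ρ hρ
    obtain ⟨u1, u2⟩ := Finset.mem_filter.mp hρ
    refine ⟨u2, ?_⟩
    unfold GG; rw [hzero ρ u1, zero_mul]

lemma const_pos {k : ℕ} (hk : 1 ≤ k) {θ : ℝ} (hθ : 0 < θ) :
    0 < Real.log ((4 : ℝ) ^ k * Pmoll k θ) / 2 + ((k : ℝ) - 1) * Real.log 2 := by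
  have hk1 : (1 : ℝ) ≤ k := by exact_mod_cast hk
  have h1 : 1 < (4 : ℝ) ^ k * Pmoll k θ := by
    have e : (4 : ℝ) ^ k * (1 / (4 : ℝ) ^ k) = 1 := by field_simp
    have p1 : 0 < (k : ℝ) ^ 2 * θ / (3 * (2 * (k : ℝ) - 1) * ((4 : ℝ) ^ k / 4)) := by
      have : 0 < 2 * (k : ℝ) - 1 := by linarith
      positivity
    have p2 : 0 < 1 / ((4 : ℝ) ^ k * (2 * (k : ℝ) + 1) * θ) := by positivity
    have p3 : (0 : ℝ) < 4 ^ k := by positivity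
    unfold Pmoll
    rw [mul_add, e]
    have := mul_pos p3 (add_pos p1 p2)
    linarith
  have h2 := Real.log_pos h1
  have h3 : 0 ≤ ((k : ℝ) - 1) * Real.log 2 := mul_nonneg (by linarith) (Real.log_nonneg (by norm_num))
  linarith

end ZDE

/-- **Corollary 1.4 (zero-density estimate for `η_k`).** Let `k ≥ 1`,
`0 < θ < (2k+1)/(4(k+1))`, `H = T^a` with `1/2 + θ < a ≤ 1`, and let
`N_{η_k}(σ, m, H)` count the zeros `ρ'_k = β'_k + iγ'_k` of `η_k` with
`m > β'_k > σ > 1/2` and `T < γ'_k < T+H`, where `2 < m = o(H)`. Then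
`N_{η_k}(σ, m, H) ≤ (H/(2π(σ−1/2))) (log(4^k P_k(θ))/2 + (k−1) log 2 + o(1))`
as `T → ∞`. -/
theorem zero_density_eta (k : ℕ) (hk : 1 ≤ k) (θ a : ℝ) (hθ : 0 < θ)
    (hθ' : θ < (2 * (k : ℝ) + 1) / (4 * ((k : ℝ) + 1)))
    (ha : 1 / 2 + θ < a) (ha' : a ≤ 1)
    (σ : ℝ) (hσ : 1 / 2 < σ)
    (m : ℝ → ℝ) (hm : ∀ T, 2 < m T)
    (hmo : Tendsto (fun T : ℝ => m T / T ^ a) atTop (nhds 0)) :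
    ∃ ε : ℝ → ℝ, Tendsto ε atTop (nhds 0) ∧
      ∀ᶠ T : ℝ in atTop, ∀ S : Finset ℂ,
        (∀ ρ : ℂ, ρ ∈ S ↔
          (etaMT k ρ = 0 ∧ σ < ρ.re ∧ ρ.re < m T ∧ T < ρ.im ∧ ρ.im < T + T ^ a)) →
        (S.card : ℝ) ≤
          T ^ a / (2 * Real.pi * (σ - 1 / 2)) *
            (Real.log ((4 : ℝ) ^ k * Pmoll k θ) / 2 + ((k : ℝ) - 1) * Real.log 2 + ε T) := by
  refine ⟨fun _ => 0, tendsto_const_nhds, ?_⟩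
  have hc := ZDE.const_pos hk hθ
  set c := Real.log ((4 : ℝ) ^ k * Pmoll k θ) / 2 + ((k : ℝ) - 1) * Real.log 2 with hcdef
  obtain ⟨n, rfl⟩ : ∃ n, k = n + 1 := ⟨k - 1, by omega⟩
  have hd : 0 < 2 * Real.pi * (σ - 1 / 2) := by
    have := Real.pi_pos
    have : 0 < σ - 1 / 2 := by linarith
    positivity
  have key := ZDE.final_count (a := a) (by linarith) ha' hσ n (ε := c / (2 * Real.pi * (σ - 1 / 2))) (by positivity)
  filter_upwards [key] with T hT S hS
  have h1 := hT S fun ρ hρ => by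
    obtain ⟨a1, a2, _, a4, a5⟩ := (hS ρ).mp hρ
    exact ⟨a1, a2, a4, a5⟩
  refine h1.trans (le_of_eq ?_)
  rw [add_zero]; ring
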